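/- The symmetry group of any tiling of the Euclidean plane by convex polygons that is monocoronal up to rigid motions acts transitively on the vertices: for any two vertices x and y there is an isometry in the symmetry group mapping x to y. -/

import Mathlib

noncomputable section

open Set

abbrev E2 := EuclideanSpace ℝ (Fin 2)

/-- A convex polygon: a compact convex subset of the plane with nonempty interior
and finitely many extreme points. -/
def IsConvexPolygon (P : Set E2) : Prop :=
  IsCompact P ∧ Convex ℝ P ∧ (interior P).Nonempty ∧ (Set.extremePoints ℝ P).Finite

/-- A tiling of the plane by convex polygons. -/
def IsTiling (T : Set (Set E2)) : Prop :=
  T.Countable ∧ (∀ P ∈ T, IsConvexPolygon P) ∧ (⋃₀ T = Set.univ) ∧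
    T.Pairwise fun P Q => Disjoint (interior P) (interior Q)

/-- A vertex of a tiling: an extreme point of at least one tile. -/
def IsVertex (T : Set (Set E2)) (x : E2) : Prop :=
  ∃ P ∈ T, x ∈ Set.extremePoints ℝ P

/-- An isometry of the plane is orientation preserving if its linear part has
determinant `1`. -/
def OrientationPreserving (f : E2 ≃ᵃⁱ[ℝ] E2) : Prop :=
  LinearMap.det (f.linearIsometryEquiv.toLinearEquiv : E2 →ₗ[ℝ] E2) = 1

/-- Monocoronal up to rigid motions: any two vertex coronae are directly congruent. -/
def MonocoronalRM (T : Set (Set E2)) : Prop :=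
  ∀ x y : E2, IsVertex T x → IsVertex T y →
    ∃ f : E2 ≃ᵃⁱ[ℝ] E2, OrientationPreserving f ∧ f x = y ∧
      (fun P => f '' P) '' {P | P ∈ T ∧ x ∈ P} = {P | P ∈ T ∧ y ∈ P}

/-- Monocoronal up to congruence: any two vertex coronae are congruent
(mirror images allowed). -/
def MonocoronalC (T : Set (Set E2)) : Prop :=
  ∀ x y : E2, IsVertex T x → IsVertex T y →
    ∃ f : E2 ≃ᵃⁱ[ℝ] E2, f x = y ∧
      (fun P => f '' P) '' {P | P ∈ T ∧ x ∈ P} = {P | P ∈ T ∧ y ∈ P}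

/-- A symmetry of a tiling: an isometry mapping the set of tiles onto itself. -/
def IsSymmetry (T : Set (Set E2)) (f : E2 ≃ᵃⁱ[ℝ] E2) : Prop :=
  (fun P => f '' P) '' T = T

/-- The set of translation vectors of a tiling. -/
def periodVectors (T : Set (Set E2)) : Set E2 :=
  {v | IsSymmetry T (AffineIsometryEquiv.constVAdd ℝ E2 v)}


namespace MC

/-- planar cross product -/
def cr (a b : ℂ) : ℝ := a.re * b.im - a.im * b.re

def dt (a b : ℂ) : ℝ := a.re * b.re + a.im * b.im

structure Poly (P : Set ℂ) : Prop where
  cpt : IsCompact P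
  cvx : Convex ℝ P
  nei : (interior P).Nonempty
  fin : (P.extremePoints ℝ).Finite

abbrev ext (P : Set ℂ) : Set ℂ := P.extremePoints ℝ

def Rt (P : Set ℂ) (x a : ℂ) : Prop :=
  a ∈ ext P ∧ a ≠ x ∧ ∀ p ∈ P, 0 ≤ cr (a - x) (p - x)

def Lt (P : Set ℂ) (x a : ℂ) : Prop :=
  a ∈ ext P ∧ a ≠ x ∧ ∀ p ∈ P, 0 ≤ cr (p - x) (a - x)

lemma cr_swap (a b : ℂ) : cr a b = - cr b a := by unfold cr; ring
lemma cr_self (a : ℂ) : cr a a = 0 := by unfold cr; ring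
lemma cr_add_right (a b c : ℂ) : cr a (b + c) = cr a b + cr a c := by
  simp [cr]; ring
lemma cr_add_left (a b c : ℂ) : cr (a + b) c = cr a c + cr b c := by
  simp [cr]; ring
lemma cr_smul_right (t : ℝ) (a b : ℂ) : cr a (t • b) = t * cr a b := by
  simp [cr]; ring
lemma cr_smul_left (t : ℝ) (a b : ℂ) : cr (t • a) b = t * cr a b := by
  simp [cr]; ring
lemma cr_neg_right (a b : ℂ) : cr a (-b) = - cr a b := by simp [cr]; ring
lemma cr_neg_left (a b : ℂ) : cr (-a) b = - cr a b := by simp [cr]; ring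
lemma cr_zero_right (a : ℂ) : cr a 0 = 0 := by simp [cr]
lemma cr_zero_left (a : ℂ) : cr 0 a = 0 := by simp [cr]
lemma cr_sub_right (a b c : ℂ) : cr a (b - c) = cr a b - cr a c := by
  simp [cr]; ring
lemma cr_sub_left (a b c : ℂ) : cr (a - b) c = cr a c - cr b c := by
  simp [cr]; ring

lemma ne_zero_sq {d : ℂ} (h : d ≠ 0) : 0 < d.re ^ 2 + d.im ^ 2 := by
  have := Complex.normSq_pos.2 h
  rw [Complex.normSq_apply] at this; nlinarith

lemma par {a b : ℂ} (ha : a ≠ 0) (h : cr a b = 0) : ∃ t : ℝ, b = t • a := by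
  have := ne_zero_sq ha
  refine ⟨dt a b / (a.re ^ 2 + a.im ^ 2), ?_⟩
  unfold cr at h
  apply Complex.ext
  · simp only [Complex.smul_re, smul_eq_mul, dt]
    field_simp; linear_combination (-a.im) * h
  · simp only [Complex.smul_im, smul_eq_mul, dt]
    field_simp; linear_combination (a.re) * h

/-- Cramer -/
lemma cramer (a b w : ℂ) : (cr a b) • w = (cr w b) • a + (cr a w) • b := by
  apply Complex.ext <;> simp [cr] <;> ring

lemma cramer' {a b : ℂ} (w : ℂ) (h : cr a b ≠ 0) :
    w = (cr w b / cr a b) • a + (cr a w / cr a b) • b := by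
  have := cramer a b w
  have h2 : w = (cr a b)⁻¹ • ((cr w b) • a + (cr a w) • b) := by
    rw [← this, smul_smul, inv_mul_cancel₀ h, one_smul]
  conv_lhs => rw [h2]
  rw [smul_add, smul_smul, smul_smul, div_eq_inv_mul, div_eq_inv_mul]

lemma orient (x a p : ℂ) : cr (p - a) (x - a) = cr (a - x) (p - x) := by
  simp [cr]; ring

namespace Poly
variable {P : Set ℂ} (hP : Poly P)
include hP

lemma noline {d x : ℂ} (hd : d ≠ 0) (h : ∀ p ∈ P, cr d (p - x) = 0) : False := by
  obtain ⟨p, hp⟩ := hP.nei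
  rw [mem_interior_iff_mem_nhds, Metric.mem_nhds_iff] at hp
  obtain ⟨ε, hε, hb⟩ := hp
  have hdn : 0 < ‖d‖ := norm_pos_iff.2 hd
  have h1 := h p (hb (Metric.mem_ball_self hε))
  have h2 := h (p + (ε / 2 / ‖d‖) • (Complex.I * d)) (hb (by
    simp [norm_smul, abs_of_pos hε]; field_simp; norm_num))
  have e : p + (ε / 2 / ‖d‖) • (Complex.I * d) - x = (p - x) + (ε / 2 / ‖d‖) • (Complex.I * d) := by
    ring
  rw [e, cr_add_right, h1, cr_smul_right, zero_add] at h2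
  have h3 : cr d (Complex.I * d) = d.re ^ 2 + d.im ^ 2 := by simp [cr]; ring
  rw [h3] at h2
  have := ne_zero_sq hd
  have : 0 < (ε / 2 / ‖d‖) * (d.re ^ 2 + d.im ^ 2) := by positivity
  linarith

lemma hull : convexHull ℝ (ext P) = P := by
  have := closure_convexHull_extremePoints hP.cpt hP.cvx
  rwa [(hP.fin.isClosed_convexHull (𝕜 := ℝ)).closure_eq] at this

lemma half_of_ext {q : ℂ} {x : ℂ} (s : ℝ) (h : ∀ e ∈ ext P, 0 ≤ s * cr q (e - x)) :
    ∀ p ∈ P, 0 ≤ s * cr q (p - x) := by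
  have hc : Convex ℝ {p | 0 ≤ s * cr q (p - x)} := by
    intro p hp r hr α β hα hβ hab
    simp only [mem_ofPred_eq] at *
    have : α • p + β • r - x = α • (p - x) + β • (r - x) := by
      have : x = (α + β) • x := by rw [hab, one_smul]
      conv_lhs => rw [this]
      rw [add_smul, smul_sub, smul_sub]; ring
    rw [this, cr_add_right, cr_smul_right, cr_smul_right]
    nlinarith [mul_nonneg hα hp, mul_nonneg hβ hr]
  intro p hp
  rw [← hP.hull] at hp
  exact convexHull_min (fun e he => h e he) hc hp

lemma exists_support {x : ℂ} (hx : x ∉ interior P) :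
    ∃ d : ℂ, d ≠ 0 ∧ ∀ p ∈ P, 0 ≤ cr d (p - x) := by
  obtain ⟨f, hf⟩ := geometric_hahn_banach_open_point (hP.cvx.interior) isOpen_interior hx
  have hf' : ∀ p ∈ P, f p ≤ f x := by
    intro p hp
    have : p ∈ closure (interior P) := by
      rw [hP.cvx.closure_interior_eq_closure_of_nonempty_interior hP.nei]
      exact subset_closure hp
    have hcl : closure (interior P) ⊆ {p | f p ≤ f x} :=
      closure_minimal (fun y hy => (hf y hy).le) (isClosed_le f.continuous continuous_const)
    exact hcl this
  have hfz : ∀ z : ℂ, f z = z.re * f 1 + z.im * f Complex.I := by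
    intro z
    have : z = z.re • (1 : ℂ) + z.im • Complex.I := by
      apply Complex.ext <;> simp
    conv_lhs => rw [this]
    rw [map_add, map_smul, map_smul]; rfl
  refine ⟨⟨-f Complex.I, f 1⟩, ?_, ?_⟩
  · intro h0
    have h1 : f 1 = 0 := by simpa using congrArg Complex.im h0
    have h2 : f Complex.I = 0 := by simpa using congrArg Complex.re h0
    obtain ⟨p, hp⟩ := hP.nei
    have := hf p hp
    rw [hfz p, hfz x, h1, h2] at this; simp at this
  · intro p hp
    have h1 := hf' p hp
    rw [hfz p, hfz x] at h1
    simp [cr]; linarith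

lemma exists_side (s : ℝ) (hs : s ≠ 0) {x d : ℂ} (hd : d ≠ 0) 
    (h : ∀ p ∈ P, 0 ≤ s * cr d (p - x)) :
    ∃ a ∈ ext P, a ≠ x ∧ ∀ p ∈ P, 0 ≤ s * cr (a - x) (p - x) := by
  by_cases h1 : ∃ a ∈ ext P, cr d (a - x) = 0 ∧ 0 < dt d (a - x)
  · obtain ⟨a, ha, hc, hpos⟩ := h1
    obtain ⟨t, ht⟩ := par hd hc
    have ht0 : 0 < t := by
      have : dt d (a - x) = t * (d.re ^ 2 + d.im ^ 2) := by rw [ht]; simp [dt]; ring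
      rw [this] at hpos
      exact pos_of_mul_pos_left hpos (by positivity)
    refine ⟨a, ha, ?_, ?_⟩
    · rintro rfl
      simp [dt] at hpos
    · intro p hp
      rw [ht, cr_smul_left]
      have := mul_nonneg ht0.le (h p hp)
      linarith
  · push Not at h1
    have hne : {e ∈ ext P | 0 < s * cr d (e - x)}.Nonempty := by
      by_contra hcon
      rw [not_nonempty_iff_eq_empty, eq_empty_iff_forall_notMem] at hcon
      have h2 : ∀ p ∈ P, 0 ≤ (-s) * cr d (p - x) := by
        apply hP.half_of_ext
        intro e he
        have := hcon e
        simp only [mem_ofPred_eq, not_and, not_lt] at this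
        have := this he
        linarith
      apply hP.noline hd (x := x)
      intro p hp
      have := h p hp
      have := h2 p hp
      have h3 : s * cr d (p - x) = 0 := by linarith
      simpa [hs] using h3
    obtain ⟨a, ⟨ha, hapos⟩, hmax⟩ := (hP.fin.subset (sep_subset _ _)).exists_maximalFor
      (fun e => dt d (e - x) / (s * cr d (e - x))) _ hne
    refine ⟨a, ha, ?_, ?_⟩
    · rintro rfl
      simp [cr] at hapos
    · apply hP.half_of_ext
      intro e he
      rcases (h e (extremePoints_subset he)).eq_or_lt with h0 | h0
      · have hc : cr d (e - x) = 0 := by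
          simpa [hs] using h0.symm
        have hdt := h1 e he hc
        obtain ⟨t, ht⟩ := par hd hc
        have ht0 : t ≤ 0 := by
          by_contra hcon
          push Not at hcon
          have : dt d (e - x) = t * (d.re ^ 2 + d.im ^ 2) := by rw [ht]; simp [dt]; ring
          have := mul_pos hcon (ne_zero_sq hd)
          linarith
        rw [ht, cr_smul_right, cr_swap]
        nlinarith
      · have hle : dt d (e - x) / (s * cr d (e - x)) ≤ dt d (a - x) / (s * cr d (a - x)) := by
          by_contra hcon
          push Not at hcon
          have := hmax (j := e) ⟨he, h0⟩ hcon.le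
          exact absurd this (not_le.2 hcon)
        rw [div_le_div_iff₀ h0 hapos] at hle
        have key : (d.re ^ 2 + d.im ^ 2) * (s * cr (a - x) (e - x)) =
            dt d (a - x) * (s * cr d (e - x)) - dt d (e - x) * (s * cr d (a - x)) := by
          simp only [dt, cr]; ring
        have h5 := ne_zero_sq hd
        by_contra hcon
        push Not at hcon
        nlinarith

lemma exists_Rt {x : ℂ} (hx : x ∉ interior P) : ∃ a, Rt P x a := by
  obtain ⟨d, hd, h⟩ := hP.exists_support hx
  obtain ⟨a, h1, h2, h3⟩ := hP.exists_side 1 one_ne_zero hd (x := x) (by simpa using h)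
  exact ⟨a, h1, h2, by simpa using h3⟩

lemma exists_Lt {x : ℂ} (hx : x ∉ interior P) : ∃ a, Lt P x a := by
  obtain ⟨d, hd, h⟩ := hP.exists_support hx
  obtain ⟨a, h1, h2, h3⟩ := hP.exists_side (-1) (by norm_num) (neg_ne_zero.2 hd) (x := x)
    (by intro p hp; rw [cr_neg_left]; have := h p hp; linarith)
  refine ⟨a, h1, h2, ?_⟩
  intro p hp
  have := h3 p hp
  rw [cr_swap]; linarith

omit hP in
lemma ext_not_seg {e p q : ℂ} (he : e ∈ ext P) (hp : p ∈ P) (hq : q ∈ P) {t : ℝ} (ht : 0 < t)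
    (h : p - e = (-t) • (q - e)) : p = e ∧ q = e := by
  have hseg : e ∈ openSegment ℝ p q := by
    refine ⟨1 / (1 + t), t / (1 + t), by positivity, by positivity, by field_simp, ?_⟩
    have hp' : p = e - t • (q - e) := by
      have : p = e + (p - e) := by ring
      rw [this, h, neg_smul]; ring
    rw [hp']
    match_scalars <;> field_simp <;> ring
  exact mem_extremePoints.1 he |>.2 p hp q hq hseg

lemma Rt_unique {x a b : ℂ} (hx : x ∈ P) (ha : Rt P x a) (hb : Rt P x b) : a = b := by
  have h0 : cr (a - x) (b - x) = 0 := by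
    apply le_antisymm
    · have := hb.2.2 a (extremePoints_subset ha.1)
      rw [cr_swap] at this; linarith
    · exact ha.2.2 b (extremePoints_subset hb.1)
  have hax : a - x ≠ 0 := sub_ne_zero.2 ha.2.1
  obtain ⟨t, ht⟩ := par hax h0
  have ht0 : 0 < t := by
    by_contra hcon
    push Not at hcon
    refine hP.noline hax (x := x) fun p hp => le_antisymm ?_ (ha.2.2 p hp)
    have := hb.2.2 p hp
    rw [ht, cr_smul_left] at this
    rcases hcon.eq_or_lt with h | h
    · exfalso; rw [h, zero_smul] at ht; exact hb.2.1 (sub_eq_zero.1 ht)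
    · by_contra hh; push Not at hh; nlinarith
  rcases lt_trichotomy t 1 with h | h | h
  · -- b between x and a
    have := ext_not_seg hb.1 hx (extremePoints_subset ha.1) (t := t / (1 - t)) 
      (div_pos ht0 (by linarith)) (by
        have hb' : b = x + t • (a - x) := by rw [← ht]; ring
        have : 1 - t ≠ 0 := by linarith
        rw [hb']
        match_scalars <;> field_simp <;> ring)
    exact this.2
  · rw [h, one_smul] at ht; exact (sub_left_injective ht).symm
  · have := ext_not_seg ha.1 hx (extremePoints_subset hb.1) (t := 1 / (t - 1)) 
      (div_pos one_pos (by linarith)) (by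
        have hb' : b = x + t • (a - x) := by rw [← ht]; ring
        have : t - 1 ≠ 0 := by linarith
        rw [hb']
        match_scalars <;> field_simp <;> ring)
    exact this.2.symm

lemma Lt_unique {x a b : ℂ} (hx : x ∈ P) (ha : Lt P x a) (hb : Lt P x b) : a = b := by
  have h0 : cr (a - x) (b - x) = 0 := by
    apply le_antisymm
    · have := ha.2.2 b (extremePoints_subset hb.1)
      rw [cr_swap] at this; linarith
    · exact hb.2.2 a (extremePoints_subset ha.1)
  have hax : a - x ≠ 0 := sub_ne_zero.2 ha.2.1
  obtain ⟨t, ht⟩ := par hax h0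
  have ht0 : 0 < t := by
    by_contra hcon
    push Not at hcon
    refine hP.noline hax (x := x) fun p hp => le_antisymm ?_ ?_
    · have := ha.2.2 p hp
      rw [cr_swap] at this; linarith
    have := hb.2.2 p hp
    rw [ht, cr_smul_right, cr_swap] at this
    rcases hcon.eq_or_lt with h | h
    · exfalso; rw [h, zero_smul] at ht; exact hb.2.1 (sub_eq_zero.1 ht)
    · by_contra hh; push Not at hh; nlinarith
  rcases lt_trichotomy t 1 with h | h | h
  · have := ext_not_seg hb.1 hx (extremePoints_subset ha.1) (t := t / (1 - t)) 
      (div_pos ht0 (by linarith)) (by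
        have hb' : b = x + t • (a - x) := by rw [← ht]; ring
        have : 1 - t ≠ 0 := by linarith
        rw [hb']
        match_scalars <;> field_simp <;> ring)
    exact this.2
  · rw [h, one_smul] at ht; exact (sub_left_injective ht).symm
  · have := ext_not_seg ha.1 hx (extremePoints_subset hb.1) (t := 1 / (t - 1)) 
      (div_pos one_pos (by linarith)) (by
        have hb' : b = x + t • (a - x) := by rw [← ht]; ring
        have : t - 1 ≠ 0 := by linarith
        rw [hb']
        match_scalars <;> field_simp <;> ring)
    exact this.2.symm

/-- dichotomy at a boundary point -/
lemma dich {x a b : ℂ} (ha : Rt P x a) (hb : Lt P x b) :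
    0 < cr (a - x) (b - x) ∨ ∃ t : ℝ, 0 < t ∧ b - x = (-t) • (a - x) := by
  have hax : a - x ≠ 0 := sub_ne_zero.2 ha.2.1
  rcases (ha.2.2 b (extremePoints_subset hb.1)).eq_or_lt with h | h
  · right
    obtain ⟨t, ht⟩ := par hax h.symm
    refine ⟨-t, ?_, by rwa [neg_neg]⟩
    by_contra hcon
    push Not at hcon
    have ht0 : 0 ≤ t := by linarith
    rcases ht0.eq_or_lt with h0 | h0
    · rw [← h0, zero_smul] at ht; exact hb.2.1 (sub_eq_zero.1 ht)
    refine hP.noline hax (x := x) fun p hp => le_antisymm ?_ (ha.2.2 p hp)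
    have := hb.2.2 p hp
    rw [ht, cr_smul_right, cr_swap] at this
    by_contra hh; push Not at hh; nlinarith
  · exact Or.inl h

lemma ext_pos {x a b : ℂ} (hx : x ∈ ext P) (ha : Rt P x a) (hb : Lt P x b) :
    0 < cr (a - x) (b - x) := by
  rcases hP.dich ha hb with h | ⟨t, ht, h⟩
  · exact h
  · have := ext_not_seg hx (extremePoints_subset hb.1) (extremePoints_subset ha.1) ht h
    exact absurd this.2 ha.2.1

omit hP in
lemma ext_of_pos {x a b : ℂ} (hx : x ∈ P) (ha : Rt P x a) (hb : Lt P x b)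
    (h : 0 < cr (a - x) (b - x)) : x ∈ ext P := by
  rw [mem_extremePoints]
  refine ⟨hx, ?_⟩
  rintro p hp q hq ⟨α, β, hα, hβ, hab, hx'⟩
  have hz : α • (p - x) + β • (q - x) = 0 := by
    have : α • (p - x) + β • (q - x) = (α • p + β • q) - (α + β) • x := by
      rw [add_smul, smul_sub, smul_sub]; ring
    rw [this, hab, hx', one_smul, sub_self]
  have h1 := congrArg (cr (a - x)) hz
  have h2 := congrArg (fun z => cr z (b - x)) hz
  simp only [cr_add_right, cr_smul_right, cr_zero_right, cr_add_left, cr_smul_left, cr_zero_left]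
    at h1 h2
  have p1 := ha.2.2 p hp
  have q1 := ha.2.2 q hq
  have p2 := hb.2.2 p hp
  have q2 := hb.2.2 q hq
  have P1 : cr (a - x) (p - x) = 0 := by nlinarith [mul_nonneg hα.le p1, mul_nonneg hβ.le q1]
  have Q1 : cr (a - x) (q - x) = 0 := by nlinarith [mul_nonneg hα.le p1, mul_nonneg hβ.le q1]
  have P2 : cr (p - x) (b - x) = 0 := by nlinarith [mul_nonneg hα.le p2, mul_nonneg hβ.le q2]
  have Q2 : cr (q - x) (b - x) = 0 := by nlinarith [mul_nonneg hα.le p2, mul_nonneg hβ.le q2]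
  have c1 := cramer' (p - x) h.ne'
  have c2 := cramer' (q - x) h.ne'
  rw [P1, P2] at c1
  rw [Q1, Q2] at c2
  simp at c1 c2
  exact ⟨sub_eq_zero.1 c1, sub_eq_zero.1 c2⟩

lemma straight {x a b : ℂ} (hx : x ∈ P) (hne : x ∉ ext P) (ha : Rt P x a) (hb : Lt P x b) :
    ∃ t : ℝ, 0 < t ∧ b - x = (-t) • (a - x) := by
  rcases hP.dich ha hb with h | h
  · exact absurd (ext_of_pos hx ha hb h) hne
  · exact h

lemma ext_not_int {x : ℂ} (hx : x ∈ ext P) : x ∉ interior P := by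
  intro h
  rw [mem_interior_iff_mem_nhds, Metric.mem_nhds_iff] at h
  obtain ⟨ε, hε, hb⟩ := h
  have := ext_not_seg hx (p := x + (ε / 2 : ℝ)) (q := x - (ε / 2 : ℝ)) (hb (by simp [abs_of_pos hε, hε]))
    (hb (by simp [abs_of_pos hε, hε])) one_pos (by simp)
  have := this.1
  simp at this
  exact hε.ne' this

omit hP in
lemma Rt_symm {x a : ℂ} (hx : x ∈ ext P) (h : Rt P x a) : Lt P a x :=
  ⟨hx, h.2.1.symm, fun p hp => by rw [orient]; exact h.2.2 p hp⟩

omit hP in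
lemma Lt_symm {x a : ℂ} (hx : x ∈ ext P) (h : Lt P x a) : Rt P a x :=
  ⟨hx, h.2.1.symm, fun p hp => by rw [← orient]; exact h.2.2 p hp⟩

/-- P is inside the cone at an extreme point. -/
lemma in_cone {x a b p : ℂ} (hx : x ∈ ext P) (ha : Rt P x a) (hb : Lt P x b) (hp : p ∈ P) :
    ∃ α β : ℝ, 0 ≤ α ∧ 0 ≤ β ∧ p - x = α • (a - x) + β • (b - x) := by
  have h := hP.ext_pos hx ha hb
  exact ⟨_, _, div_nonneg (hb.2.2 p hp) h.le, div_nonneg (ha.2.2 p hp) h.le,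
    cramer' (p - x) h.ne'⟩

lemma ext_closed {O : Set ℂ} (hO : O ⊆ ext P) (hne : O.Nonempty)
    (h1 : ∀ x ∈ O, ∀ a, Rt P x a → a ∈ O) (h2 : ∀ x ∈ O, ∀ a, Lt P x a → a ∈ O) : O = ext P := by
  have hfin := hP.fin.subset hO
  have hconv : P ⊆ convexHull ℝ O := by
    intro p hp
    by_contra hcon
    obtain ⟨f, u, hf1, hf2⟩ := geometric_hahn_banach_closed_point (convex_convexHull ℝ O)
      (hfin.isClosed_convexHull (𝕜 := ℝ)) hcon
    obtain ⟨v, hv, hmax⟩ := hfin.exists_maximalFor f _ hne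
    have hmax' : ∀ w ∈ O, f w ≤ f v := by
      intro w hw
      by_contra hh
      push Not at hh
      exact absurd (hmax hw hh.le) (not_le.2 hh)
    have hvi := hP.ext_not_int (hO hv)
    obtain ⟨a, ha⟩ := hP.exists_Rt hvi
    obtain ⟨b, hb⟩ := hP.exists_Lt hvi
    obtain ⟨α, β, hα, hβ, he⟩ := hP.in_cone (hO hv) ha hb hp
    have e2 := congrArg f he
    rw [map_sub, map_add, map_smul, map_smul, map_sub, map_sub] at e2
    have := hmax' a (h1 v hv a ha)
    have := hmax' b (h2 v hv b hb)
    have := hf1 v (subset_convexHull ℝ O hv)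
    simp only [smul_eq_mul] at e2
    nlinarith
  have heq : convexHull ℝ O = P :=
    Subset.antisymm (convexHull_min (hO.trans extremePoints_subset) hP.cvx) hconv
  refine Subset.antisymm hO ?_
  have := extremePoints_convexHull_subset (𝕜 := ℝ) (A := O)
  rwa [heq] at this

end Poly
end MC

namespace MC
open Classical in
def nx (P : Set ℂ) (x : ℂ) : ℂ := if h : ∃ a, Rt P x a then h.choose else x
open Classical in
def pv (P : Set ℂ) (x : ℂ) : ℂ := if h : ∃ a, Lt P x a then h.choose else x

namespace Poly
variable {P : Set ℂ} (hP : Poly P)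
include hP

lemma nx_spec {x : ℂ} (hx : x ∉ interior P) : Rt P x (nx P x) := by
  have h := hP.exists_Rt hx
  unfold nx; rw [dif_pos h]; exact h.choose_spec
lemma pv_spec {x : ℂ} (hx : x ∉ interior P) : Lt P x (pv P x) := by
  have h := hP.exists_Lt hx
  unfold pv; rw [dif_pos h]; exact h.choose_spec
lemma nx_eq {x a : ℂ} (hx : x ∈ P) (h : Rt P x a) : nx P x = a := by
  have h' : ∃ a, Rt P x a := ⟨a, h⟩
  unfold nx; rw [dif_pos h']; exact hP.Rt_unique hx h'.choose_spec h
lemma pv_eq {x a : ℂ} (hx : x ∈ P) (h : Lt P x a) : pv P x = a := by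
  have h' : ∃ a, Lt P x a := ⟨a, h⟩
  unfold pv; rw [dif_pos h']; exact hP.Lt_unique hx h'.choose_spec h
lemma nx_ext {x : ℂ} (hx : x ∈ ext P) : nx P x ∈ ext P := (hP.nx_spec (hP.ext_not_int hx)).1
lemma pv_ext {x : ℂ} (hx : x ∈ ext P) : pv P x ∈ ext P := (hP.pv_spec (hP.ext_not_int hx)).1
lemma pv_nx {x : ℂ} (hx : x ∈ ext P) : pv P (nx P x) = x :=
  hP.pv_eq (extremePoints_subset (hP.nx_ext hx)) (Rt_symm hx (hP.nx_spec (hP.ext_not_int hx)))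
lemma nx_pv {x : ℂ} (hx : x ∈ ext P) : nx P (pv P x) = x :=
  hP.nx_eq (extremePoints_subset (hP.pv_ext hx)) (Lt_symm hx (hP.pv_spec (hP.ext_not_int hx)))
lemma nx_ne {x : ℂ} (hx : x ∈ ext P) : nx P x ≠ x := (hP.nx_spec (hP.ext_not_int hx)).2.1
lemma pv_ne {x : ℂ} (hx : x ∈ ext P) : pv P x ≠ x := (hP.pv_spec (hP.ext_not_int hx)).2.1
lemma pos {x : ℂ} (hx : x ∈ ext P) : 0 < cr (nx P x - x) (pv P x - x) :=
  hP.ext_pos hx (hP.nx_spec (hP.ext_not_int hx)) (hP.pv_spec (hP.ext_not_int hx))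
lemma nx_ne_pv {x : ℂ} (hx : x ∈ ext P) : nx P x ≠ pv P x := by
  intro h
  have := hP.pos hx
  rw [h, cr_self] at this
  exact lt_irrefl _ this

lemma ext_nonempty : (ext P).Nonempty := by
  have : P.Nonempty := hP.nei.mono interior_subset
  exact hP.cpt.extremePoints_nonempty this

lemma three_le : 3 ≤ (ext P).ncard := by
  obtain ⟨x, hx⟩ := hP.ext_nonempty
  have hsub : ({x, nx P x, pv P x} : Set ℂ) ⊆ ext P := by
    rintro y (rfl | rfl | rfl)
    exacts [hx, hP.nx_ext hx, hP.pv_ext hx]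
  have h := ncard_le_ncard hsub hP.fin
  rwa [ncard_eq_toFinset_card', Set.toFinset_insert, Set.toFinset_insert, Set.toFinset_singleton,
    Finset.card_eq_three.2 ⟨x, nx P x, pv P x, (hP.nx_ne hx).symm, (hP.pv_ne hx).symm,
    hP.nx_ne_pv hx, rfl⟩] at h

lemma iter_ext {x : ℂ} (hx : x ∈ ext P) (n : ℕ) : (nx P)^[n] x ∈ ext P := by
  induction n with
  | zero => exact hx
  | succ n ih => rw [Function.iterate_succ_apply']; exact hP.nx_ext ih

lemma nx_inj {x y : ℂ} (hx : x ∈ ext P) (hy : y ∈ ext P) (h : nx P x = nx P y) : x = y := by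
  rw [← hP.pv_nx hx, h, hP.pv_nx hy]

lemma ext_closed' {O : Set ℂ} (hO : O ⊆ ext P) (hne : O.Nonempty)
    (h1 : ∀ x ∈ O, nx P x ∈ O) : O = ext P := by
  have hfin := hP.fin.subset hO
  have hsurj : SurjOn (nx P) O O := by
    have hinj : InjOn (nx P) O := fun x hx y hy h => hP.nx_inj (hO hx) (hO hy) h
    exact ((hfin.injOn_iff_bijOn_of_mapsTo h1).1 hinj).surjOn
  refine hP.ext_closed hO hne ?_ ?_
  · intro x hx a ha
    rw [← hP.nx_eq (extremePoints_subset (hO hx)) ha]; exact h1 x hx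
  · intro x hx a ha
    rw [← hP.pv_eq (extremePoints_subset (hO hx)) ha]
    obtain ⟨y, hy, rfl⟩ := hsurj hx
    rwa [hP.pv_nx (hO hy)]

lemma orbit {x : ℂ} (hx : x ∈ ext P) : {y | ∃ n, (nx P)^[n] x = y} = ext P := by
  apply hP.ext_closed'
  · rintro y ⟨n, rfl⟩; exact hP.iter_ext hx n
  · exact ⟨x, 0, rfl⟩
  · rintro y ⟨n, rfl⟩; exact ⟨n + 1, Function.iterate_succ_apply' _ _ _⟩

lemma period {x : ℂ} (hx : x ∈ ext P) : Function.minimalPeriod (nx P) x = (ext P).ncard := by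
  have hper : x ∈ Function.periodicPts (nx P) := by
    have : ¬ InjOn (fun n => (nx P)^[n] x) (univ : Set ℕ) := by
      intro h
      exact infinite_univ (hP.fin.of_injOn (f := fun n => (nx P)^[n] x)
        (fun n _ => hP.iter_ext hx n) h)
    simp only [InjOn, not_forall, mem_univ] at this
    obtain ⟨i, _, j, _, hij, hne⟩ := this
    have key : ∀ i j : ℕ, i < j → (nx P)^[i] x = (nx P)^[j] x → x ∈ Function.periodicPts (nx P) := by
      intro i
      induction i with
      | zero => intro j hj h; exact ⟨j, hj, h.symm⟩
      | succ i ih =>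
        intro j hj h
        obtain ⟨j, rfl⟩ : ∃ l, j = l + 1 := ⟨j - 1, by omega⟩
        rw [Function.iterate_succ_apply', Function.iterate_succ_apply'] at h
        exact ih j (by omega) (hP.nx_inj (hP.iter_ext hx _) (hP.iter_ext hx _) h)
    rcases lt_or_gt_of_ne hne with h | h
    · exact key i j h hij
    · exact key j i h hij.symm
  have e : ext P = (fun n => (nx P)^[n] x) '' (Iio (Function.minimalPeriod (nx P) x)) := by
    rw [← hP.orbit hx]
    ext y
    constructor
    · rintro ⟨n, rfl⟩
      exact ⟨n % Function.minimalPeriod (nx P) x,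
        Nat.mod_lt _ (Function.minimalPeriod_pos_of_mem_periodicPts hper),
        Function.iterate_mod_minimalPeriod_eq⟩
    · rintro ⟨n, _, rfl⟩; exact ⟨n, rfl⟩
  rw [e, ncard_image_of_injOn Function.iterate_injOn_Iio_minimalPeriod]
  rw [ncard_eq_toFinset_card']; simp

lemma iter_card {x : ℂ} (hx : x ∈ ext P) : (nx P)^[(ext P).ncard] x = x := by
  rw [← hP.period hx]; exact Function.isPeriodicPt_minimalPeriod _ _

end Poly

/-- the group of orientation preserving motions -/
def motG : Subgroup (Equiv.Perm ℂ) where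
  carrier := {g | ∃ u v : ℂ, ‖u‖ = 1 ∧ ∀ z, g z = u * z + v}
  mul_mem' := by
    rintro g h ⟨u, v, hu, hg⟩ ⟨u', v', hu', hh⟩
    refine ⟨u * u', u * v' + v, by simp [hu, hu'], fun z => ?_⟩
    rw [Equiv.Perm.mul_apply, hh, hg]; ring
  one_mem' := ⟨1, 0, by simp, by simp⟩
  inv_mem' := by
    rintro g ⟨u, v, hu, hg⟩
    have hu0 : u ≠ 0 := by rintro rfl; simp at hu
    refine ⟨u⁻¹, -u⁻¹ * v, by simp [hu], fun z => ?_⟩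
    rw [Equiv.Perm.inv_eq_iff_eq, hg]
    field_simp; ring

abbrev Mot := motG

def mkMot (u v : ℂ) (hu : ‖u‖ = 1) : Mot :=
  ⟨{ toFun := fun z => u * z + v
     invFun := fun z => u⁻¹ * (z - v)
     left_inv := fun z => by
      have hu0 : u ≠ 0 := by rintro rfl; simp at hu
      field_simp; ring
     right_inv := fun z => by
      have hu0 : u ≠ 0 := by rintro rfl; simp at hu
      field_simp; ring }, u, v, hu, fun _ => rfl⟩

lemma mkMot_smul (u v : ℂ) (hu : ‖u‖ = 1) (z : ℂ) : mkMot u v hu • z = u * z + v := rfl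

def rot (g : Mot) : ℂ := g • (1 : ℂ) - g • (0 : ℂ)

lemma rot_spec (g : Mot) : ‖rot g‖ = 1 ∧ ∀ z : ℂ, g • z = rot g * z + g • (0 : ℂ) := by
  obtain ⟨g, u, v, hu, hg⟩ := g
  have h : ∀ z : ℂ, ((⟨g, u, v, hu, hg⟩ : Mot) • z) = u * z + v := hg
  have hr : rot ⟨g, u, v, hu, hg⟩ = u := by unfold rot; rw [h, h]; ring
  rw [hr]
  exact ⟨hu, fun z => by rw [h, h]; ring⟩

lemma rot_norm (g : Mot) : ‖rot g‖ = 1 := (rot_spec g).1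
lemma rot_ne (g : Mot) : rot g ≠ 0 := by
  intro h; have := rot_norm g; rw [h] at this; simp at this
lemma smul_def' (g : Mot) (z : ℂ) : g • z = rot g * z + g • (0 : ℂ) := (rot_spec g).2 z
lemma smul_sub' (g : Mot) (z w : ℂ) : g • z - g • w = rot g * (z - w) := by
  rw [smul_def' g z, smul_def' g w]; ring

lemma mot_ext {g h : Mot} {x y : ℂ} (hxy : x ≠ y) (hx : g • x = h • x) (hy : g • y = h • y) :
    g = h := by
  have h1 := smul_sub' g x y
  have h2 := smul_sub' h x y
  have hr : rot g = rot h := by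
    have h3 : rot g * (x - y) = rot h * (x - y) := by rw [← h1, ← h2, hx, hy]
    exact mul_right_cancel₀ (sub_ne_zero.2 hxy) h3
  have h0 : g • (0 : ℂ) = h • (0 : ℂ) := by
    rw [smul_def' g x, smul_def' h x, hr] at hx; exact add_left_cancel hx
  apply Subtype.ext
  apply Equiv.ext
  intro z
  have : g • z = h • z := by rw [smul_def' g z, smul_def' h z, hr, h0]
  exact this

lemma mot_dist (g : Mot) (x y : ℂ) : dist (g • x) (g • y) = dist x y := by
  rw [dist_eq_norm, smul_sub', norm_mul, rot_norm, one_mul, dist_eq_norm]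

lemma cr_rot {u : ℂ} (hu : ‖u‖ = 1) (a b : ℂ) : cr (u * a) (u * b) = cr a b := by
  have h : u.re ^ 2 + u.im ^ 2 = 1 := by
    have := Complex.sq_norm u
    rw [hu, Complex.normSq_apply] at this; nlinarith
  simp only [cr, Complex.mul_re, Complex.mul_im]
  linear_combination (a.re * b.im - a.im * b.re) * h

lemma cr_mot (g : Mot) (a b c d : ℂ) : cr (g • a - g • b) (g • c - g • d) = cr (a - b) (c - d) := by
  rw [smul_sub', smul_sub', cr_rot (rot_norm g)]

open scoped Pointwise

lemma mot_comb (g : Mot) {α β : ℝ} (h : α + β = 1) (p q : ℂ) :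
    g • (α • p + β • q) = α • (g • p) + β • (g • q) := by
  rw [smul_def' g (α • p + β • q), smul_def' g p, smul_def' g q]
  have : g • (0 : ℂ) = ((α + β : ℝ) : ℂ) * g • (0 : ℂ) := by rw [h]; simp
  conv_lhs => rw [this]
  simp only [Complex.real_smul, Complex.ofReal_add]; ring

def motHomeo (g : Mot) : ℂ ≃ₜ ℂ where
  toEquiv := g.1
  continuous_toFun := by
    have : (fun z : ℂ => g • z) = fun z => rot g * z + g • (0 : ℂ) := funext (smul_def' g)
    change Continuous (fun z : ℂ => g • z)
    rw [this]; fun_prop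
  continuous_invFun := by
    have : (fun z : ℂ => g⁻¹ • z) = fun z => rot g⁻¹ * z + g⁻¹ • (0 : ℂ) := funext (smul_def' g⁻¹)
    change Continuous (fun z : ℂ => g⁻¹ • z)
    rw [this]; fun_prop

lemma interior_mot (g : Mot) (P : Set ℂ) : interior (g • P) = g • interior P :=
  ((motHomeo g).image_interior P).symm

lemma ext_mot_sub (g : Mot) (P : Set ℂ) : g • ext P ⊆ ext (g • P) := by
  rintro _ ⟨x, hx, rfl⟩
  rw [mem_extremePoints] at *
  refine ⟨smul_mem_smul_set hx.1, ?_⟩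
  rintro _ ⟨p, hp, rfl⟩ _ ⟨q, hq, rfl⟩ ⟨α, β, hα, hβ, hab, h⟩
  have h' : g • (α • p + β • q) = g • x := by rw [mot_comb g hab]; exact h
  have := hx.2 p hp q hq ⟨α, β, hα, hβ, hab, smul_left_cancel g h'⟩
  exact ⟨congrArg (g • ·) this.1, congrArg (g • ·) this.2⟩

lemma ext_mot (g : Mot) (P : Set ℂ) : ext (g • P) = g • ext P := by
  refine Subset.antisymm ?_ (ext_mot_sub g P)
  have := ext_mot_sub g⁻¹ (g • P)
  rw [inv_smul_smul] at this
  have h2 := smul_set_mono (a := g) this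
  rwa [smul_inv_smul] at h2

lemma mem_ext_mot (g : Mot) (P : Set ℂ) (x : ℂ) : g • x ∈ ext (g • P) ↔ x ∈ ext P := by
  rw [ext_mot, smul_mem_smul_set_iff]

lemma Poly.mot {P : Set ℂ} (hP : Poly P) (g : Mot) : Poly (g • P) where
  cpt := hP.cpt.image (motHomeo g).continuous
  cvx := by
    rintro _ ⟨p, hp, rfl⟩ _ ⟨q, hq, rfl⟩ α β hα hβ hab
    exact ⟨α • p + β • q, hP.cvx hp hq hα hβ hab, mot_comb g hab p q⟩
  nei := by rw [interior_mot]; exact hP.nei.smul_set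
  fin := by
    have := ext_mot g P
    unfold ext at this; rw [this]; exact hP.fin.smul_set

lemma Rt_mot (g : Mot) {P : Set ℂ} {x a : ℂ} (h : Rt P x a) : Rt (g • P) (g • x) (g • a) := by
  refine ⟨(mem_ext_mot g P a).2 h.1, fun e => h.2.1 (smul_left_cancel g e), ?_⟩
  rintro _ ⟨p, hp, rfl⟩
  simp only
  rw [cr_mot]; exact h.2.2 p hp

lemma Lt_mot (g : Mot) {P : Set ℂ} {x a : ℂ} (h : Lt P x a) : Lt (g • P) (g • x) (g • a) := by
  refine ⟨(mem_ext_mot g P a).2 h.1, fun e => h.2.1 (smul_left_cancel g e), ?_⟩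
  rintro _ ⟨p, hp, rfl⟩
  simp only
  rw [cr_mot]; exact h.2.2 p hp

lemma Poly.nx_mot {P : Set ℂ} (hP : Poly P) (g : Mot) {x : ℂ} (hx : x ∈ P) (hi : x ∉ interior P) :
    nx (g • P) (g • x) = g • nx P x :=
  (hP.mot g).nx_eq (smul_mem_smul_set hx) (Rt_mot g (hP.nx_spec hi))

lemma Poly.pv_mot {P : Set ℂ} (hP : Poly P) (g : Mot) {x : ℂ} (hx : x ∈ P) (hi : x ∉ interior P) :
    pv (g • P) (g • x) = g • pv P x :=
  (hP.mot g).pv_eq (smul_mem_smul_set hx) (Lt_mot g (hP.pv_spec hi))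

lemma ncard_ext_mot (g : Mot) (P : Set ℂ) : (ext (g • P)).ncard = (ext P).ncard := by
  rw [ext_mot]; exact ncard_image_of_injective _ (MulAction.injective g)

end MC

namespace MC
open MeasureTheory
open scoped Pointwise

/-- tangent cone -/
def K (P : Set ℂ) (x : ℂ) : Set ℂ := {w | ∃ t : ℝ, 0 < t ∧ x + t • w ∈ P}

def mu (P : Set ℂ) (x : ℂ) : ℝ := volume.real (K P x ∩ Metric.ball 0 1)

lemma K_smul {P : Set ℂ} {x w : ℂ} (h : w ∈ K P x) {s : ℝ} (hs : 0 < s) : s • w ∈ K P x := by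
  obtain ⟨t, ht, h⟩ := h
  refine ⟨t / s, by positivity, ?_⟩
  rw [smul_smul, div_mul_cancel₀ _ hs.ne']; exact h

lemma K_small {P : Set ℂ} (hP : Convex ℝ P) {x w : ℂ} (hx : x ∈ P) {t s : ℝ} (hs : 0 ≤ s) (hst : s ≤ t)
    (h : x + t • w ∈ P) : x + s • w ∈ P := by
  rcases hs.eq_or_lt with rfl | hs
  · simpa using hx
  have ht : 0 < t := by linarith
  have := hP hx h (a := 1 - s / t) (b := s / t) (by rw [sub_nonneg, div_le_one ht]; exact hst)
    (by positivity) (by ring)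
  convert this using 1
  match_scalars <;> field_simp
  ring

lemma K_add {P : Set ℂ} (hP : Convex ℝ P) {x w v : ℂ} (h1 : w ∈ K P x) (h2 : v ∈ K P x) :
    w + v ∈ K P x := by
  obtain ⟨t, ht, h1⟩ := h1
  obtain ⟨s, hs, h2⟩ := h2
  refine ⟨t * s / (t + s), by positivity, ?_⟩
  have := hP h1 h2 (a := s / (t + s)) (b := t / (t + s)) (by positivity) (by positivity) 
    (by field_simp; ring)
  convert this using 1
  match_scalars <;> field_simp
  ring

lemma K_zero {P : Set ℂ} {x : ℂ} (hx : x ∈ P) : (0 : ℂ) ∈ K P x := ⟨1, one_pos, by simpa using hx⟩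

lemma K_of_mem {P : Set ℂ} {x p : ℂ} (hp : p ∈ P) : p - x ∈ K P x := ⟨1, one_pos, by simpa using hp⟩

lemma K_comb {P : Set ℂ} (hP : Convex ℝ P) {x w v : ℂ} (hx : x ∈ P) (h1 : w ∈ K P x) (h2 : v ∈ K P x)
    {α β : ℝ} (hα : 0 ≤ α) (hβ : 0 ≤ β) : α • w + β • v ∈ K P x := by
  have key : ∀ {w : ℂ} {α : ℝ}, w ∈ K P x → 0 ≤ α → α • w ∈ K P x := by
    intro w α h hα
    rcases hα.eq_or_lt with rfl | hα
    · rw [zero_smul]; exact K_zero hx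
    · exact K_smul h hα
  exact K_add hP (key h1 hα) (key h2 hβ)

lemma K_convex {P : Set ℂ} (hP : Convex ℝ P) {x : ℂ} (hx : x ∈ P) : Convex ℝ (K P x) :=
  fun _ hw _ hv _ _ hα hβ _ => K_comb hP hx hw hv hα hβ

lemma Poly.K_eq {P : Set ℂ} (hP : Poly P) {x a b : ℂ} (hx : x ∈ P) (ha : Rt P x a) (hb : Lt P x b) :
    K P x = {w | 0 ≤ cr (a - x) w ∧ 0 ≤ cr w (b - x)} := by
  ext w
  constructor
  · rintro ⟨t, ht, h⟩
    have h1 := ha.2.2 _ h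
    have h2 := hb.2.2 _ h
    rw [add_sub_cancel_left, cr_smul_right] at h1
    rw [add_sub_cancel_left, cr_smul_left] at h2
    exact ⟨nonneg_of_mul_nonneg_right h1 ht, nonneg_of_mul_nonneg_right h2 ht⟩
  · rintro ⟨h1, h2⟩
    have ka := K_of_mem (x := x) (extremePoints_subset ha.1)
    have kb := K_of_mem (x := x) (extremePoints_subset hb.1)
    rcases hP.dich ha hb with h | ⟨t, ht, h⟩
    · rw [cramer' w h.ne']
      exact K_comb hP.cvx hx ka kb (div_nonneg h2 h.le) (div_nonneg h1 h.le)
    · have : ∃ c ∈ P, 0 < cr (a - x) (c - x) := by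
        by_contra hcon
        push Not at hcon
        exact hP.noline (sub_ne_zero.2 ha.2.1) (x := x)
          fun p hp => le_antisymm (hcon p hp) (ha.2.2 p hp)
      obtain ⟨c, hc, hpos⟩ := this
      have kc := K_of_mem (x := x) hc
      rw [cramer' w hpos.ne']
      rcases le_total 0 (cr w (c - x)) with h3 | h3
      · exact K_comb hP.cvx hx ka kc (div_nonneg h3 hpos.le) (div_nonneg h1 hpos.le)
      · have : (cr w (c - x) / cr (a - x) (c - x)) • (a - x) = 
            (-(cr w (c - x) / cr (a - x) (c - x)) / t) • (b - x) := by
          rw [h, smul_smul]; congr 1; field_simp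
        rw [this]
        refine K_comb hP.cvx hx kb kc (div_nonneg ?_ ht.le) (div_nonneg h1 hpos.le)
        rw [neg_nonneg]; exact div_nonpos_of_nonpos_of_nonneg h3 hpos.le

lemma fin_ball (A : Set ℂ) : volume (A ∩ Metric.ball 0 1) ≠ ⊤ :=
  measure_ne_top_of_subset inter_subset_right Metric.isBounded_ball.measure_lt_top.ne

lemma sum_cones {ι : Type*} (s : Finset ι) (A : ι → Set ℂ)
    (hm : ∀ i ∈ s, NullMeasurableSet (A i) volume)
    (hd : ∀ i ∈ s, ∀ j ∈ s, i ≠ j → volume (A i ∩ A j) = 0) :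
    volume.real ((⋃ i ∈ s, A i) ∩ Metric.ball 0 1) = ∑ i ∈ s, volume.real (A i ∩ Metric.ball 0 1) := by
  rw [iUnion₂_inter]
  apply measureReal_biUnion_finset₀
  · intro i hi j hj hij
    refine measure_mono_null ?_ (hd i hi j hj hij)
    rintro z ⟨⟨h1, _⟩, h2, _⟩; exact ⟨h1, h2⟩
  · intro i hi
    exact (hm i hi).inter Metric.isOpen_ball.measurableSet.nullMeasurableSet
  · intro i _; exact fin_ball _

lemma vol_ball1 : volume.real (Metric.ball (0 : ℂ) 1) = Real.pi := by
  rw [measureReal_def, Complex.volume_ball]; simp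

/-- a line through zero is null -/
lemma line_null {d : ℂ} (hd : d ≠ 0) : volume {w : ℂ | cr w d = 0} = 0 := by
  let f : ℂ →ₗ[ℝ] ℝ :=
    { toFun := fun w => cr w d
      map_add' := fun a b => cr_add_left a b d
      map_smul' := fun t a => cr_smul_left t a d }
  have : ({w : ℂ | cr w d = 0}) = (LinearMap.ker f : Set ℂ) := by
    ext w; simp [f]
  rw [this]
  apply Measure.addHaar_submodule
  intro h
  have h1 : (Complex.I * d) ∈ LinearMap.ker f := by rw [h]; trivial
  have h2 : cr (Complex.I * d) d = 0 := h1
  have h3 : cr (Complex.I * d) d = -(d.re ^ 2 + d.im ^ 2) := by simp [cr]; ring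
  have := ne_zero_sq hd
  linarith

lemma cr_cont_left (d : ℂ) : Continuous fun w => cr w d := by unfold cr; fun_prop
lemma cr_cont_right (d : ℂ) : Continuous fun w => cr d w := by unfold cr; fun_prop

lemma half_vol {d : ℂ} (hd : d ≠ 0) :
    volume.real ({w : ℂ | 0 ≤ cr w d} ∩ Metric.ball 0 1) = Real.pi / 2 := by
  have hsum := sum_cones (Finset.univ : Finset Bool)
    (fun b => if b then {w : ℂ | 0 ≤ cr w d} else {w : ℂ | cr w d ≤ 0})
    (by
      rintro (_ | _) _
      · exact (isClosed_le (cr_cont_left d) continuous_const).measurableSet.nullMeasurableSet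
      · exact (isClosed_le continuous_const (cr_cont_left d)).measurableSet.nullMeasurableSet)
    (by
      rintro (_ | _) _ (_ | _) _ h <;> simp at h ⊢
      · refine measure_mono_null ?_ (line_null hd)
        rintro z ⟨h1, h2⟩; exact le_antisymm h1 h2
      · refine measure_mono_null ?_ (line_null hd)
        rintro z ⟨h1, h2⟩; exact le_antisymm h2 h1)
  have hU : (⋃ b ∈ (Finset.univ : Finset Bool), 
      (if b then {w : ℂ | 0 ≤ cr w d} else {w : ℂ | cr w d ≤ 0})) = univ := by
    rw [eq_univ_iff_forall]
    intro w
    simp only [Finset.mem_univ, iUnion_true, mem_iUnion]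
    rcases le_total 0 (cr w d) with h | h
    · exact ⟨true, h⟩
    · exact ⟨false, h⟩
  rw [hU, univ_inter, vol_ball1] at hsum
  simp at hsum
  have hneg : volume.real ({w : ℂ | cr w d ≤ 0} ∩ Metric.ball 0 1) =
      volume.real ({w : ℂ | 0 ≤ cr w d} ∩ Metric.ball 0 1) := by
    have : ({w : ℂ | cr w d ≤ 0} ∩ Metric.ball 0 1) =
        -({w : ℂ | 0 ≤ cr w d} ∩ Metric.ball 0 1) := by
      ext w
      simp [cr_neg_left]
    rw [this, measureReal_def, Measure.measure_neg, measureReal_def]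
  rw [hneg] at hsum
  linarith

/-- multiplication by a unit complex number preserves volume -/
lemma vol_rot {u : ℂ} (hu : ‖u‖ = 1) (A : Set ℂ) :
    volume.real ((fun z => u * z) '' A) = volume.real A := by
  have hu0 : u ≠ 0 := by rintro rfl; simp at hu
  let e : ℂ ≃ₗᵢ[ℝ] ℂ := rotation (⟨u, by simp [Submonoid.unitSphere, hu]⟩ : Circle)
  have : (fun z => u * z) '' A = e '' A := rfl
  rw [this, measureReal_def, measureReal_def]
  congr 1
  have h1 := e.measurePreserving.measure_preimage_equiv (f := e.toHomeomorph.toMeasurableEquiv) (e '' A)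
  rw [← h1]
  congr 1
  exact preimage_image_eq _ e.injective

lemma K_mot (g : Mot) (P : Set ℂ) (x : ℂ) : K (g • P) (g • x) = (fun z => rot g * z) '' K P x := by
  ext w
  constructor
  · rintro ⟨t, ht, p, hp, h⟩
    refine ⟨(rot g)⁻¹ * w, ⟨t, ht, ?_⟩, by simp [rot_ne g]⟩
    have : x + t • ((rot g)⁻¹ * w) = p := by
      have h1 : g • p - g • x = t • w := by
        change g • p = _ at h
        rw [h]; ring
      rw [smul_sub'] at h1
      rw [← mul_smul_comm, ← h1, inv_mul_cancel_left₀ (rot_ne g)]; ring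
    rwa [this]
  · rintro ⟨v, ⟨t, ht, hv⟩, rfl⟩
    refine ⟨t, ht, _, hv, ?_⟩
    change g • (x + t • v) = _
    rw [smul_def' g (x + t • v), smul_def' g x]
    simp only [Complex.real_smul]; ring

lemma mu_mot (g : Mot) (P : Set ℂ) (x : ℂ) : mu (g • P) (g • x) = mu P x := by
  unfold mu
  rw [K_mot, ← vol_rot (rot_norm g) (K P x ∩ _)]
  congr 1
  rw [image_inter (mul_right_injective₀ (rot_ne g))]
  congr 1
  ext w
  constructor
  · intro h
    refine ⟨(rot g)⁻¹ * w, ?_, by simp [rot_ne g]⟩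
    simpa [rot_norm] using h
  · rintro ⟨v, h, rfl⟩
    simpa [rot_norm] using h

lemma vol_mot (g : Mot) (P : Set ℂ) : volume.real (g • P) = volume.real P := by
  have : g • P = (g • (0 : ℂ)) +ᵥ ((fun z => rot g * z) '' P) := by
    ext w
    constructor
    · rintro ⟨p, hp, rfl⟩
      refine ⟨rot g * p, ⟨p, hp, rfl⟩, ?_⟩
      change g • (0 : ℂ) + rot g * p = g • p
      rw [smul_def' g p]; ring
    · rintro ⟨_, ⟨p, hp, rfl⟩, rfl⟩
      refine ⟨p, hp, ?_⟩
      change g • p = g • (0 : ℂ) + rot g * p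
      rw [smul_def' g p]; ring
  rw [this, measureReal_def, measure_vadd, ← measureReal_def, vol_rot (rot_norm g)]

namespace Poly
variable {P : Set ℂ} (hP : Poly P)
include hP

lemma mu_straight {x : ℂ} (hx : x ∈ P) (hi : x ∉ interior P) (hne : x ∉ ext P) :
    mu P x = Real.pi / 2 := by
  have ha := hP.nx_spec hi
  have hb := hP.pv_spec hi
  obtain ⟨t, ht, h⟩ := hP.straight hx hne ha hb
  unfold mu
  rw [hP.K_eq hx ha hb, ← half_vol (sub_ne_zero.2 hb.2.1)]
  congr 2
  ext w
  constructor
  · exact fun h => h.2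
  · intro h2
    refine ⟨?_, h2⟩
    simp only [mem_ofPred_eq] at h2
    rw [h, cr_smul_right, cr_swap] at h2
    nlinarith

def N (P : Set ℂ) (x : ℂ) : Set ℂ := {w | ∀ p ∈ P, 0 ≤ cr w (p - x)}

lemma N_eq {x : ℂ} (hx : x ∈ ext P) :
    N P x = {w | 0 ≤ cr w (nx P x - x) ∧ 0 ≤ cr w (pv P x - x)} := by
  ext w
  constructor
  · intro h
    exact ⟨h _ (extremePoints_subset (hP.nx_ext hx)), h _ (extremePoints_subset (hP.pv_ext hx))⟩
  · rintro ⟨h1, h2⟩ p hp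
    obtain ⟨α, β, hα, hβ, e⟩ := hP.in_cone hx (hP.nx_spec (hP.ext_not_int hx))
      (hP.pv_spec (hP.ext_not_int hx)) hp
    rw [e, cr_add_right, cr_smul_right, cr_smul_right]
    exact add_nonneg (mul_nonneg hα h1) (mul_nonneg hβ h2)

omit hP in
lemma N_closed (x : ℂ) : IsClosed (N P x) := by
  have : N P x = ⋂ p ∈ P, {w | 0 ≤ cr w (p - x)} := by ext; simp [N]
  rw [this]
  exact isClosed_biInter fun p _ => isClosed_le continuous_const (cr_cont_left _)

omit hP in
lemma K_null (hP : Convex ℝ P) {x : ℂ} (hx : x ∈ P) : NullMeasurableSet (K P x) volume :=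
  (K_convex hP hx).nullMeasurableSet volume

lemma mu_add_N {x : ℂ} (hx : x ∈ ext P) :
    mu P x + volume.real (N P x ∩ Metric.ball 0 1) = Real.pi / 2 := by
  have hxP := extremePoints_subset hx
  have hd : pv P x - x ≠ 0 := sub_ne_zero.2 (hP.pv_ne hx)
  have hd' : nx P x - x ≠ 0 := sub_ne_zero.2 (hP.nx_ne hx)
  have hi := hP.ext_not_int hx
  have hK := hP.K_eq hxP (hP.nx_spec hi) (hP.pv_spec hi)
  have hN := hP.N_eq hx
  have hinter0 : volume (K P x ∩ N P x) = 0 := by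
    refine measure_mono_null ?_ (line_null hd')
    rintro w ⟨h1, h2⟩
    rw [hK] at h1; rw [hN] at h2
    have := h1.1
    rw [cr_swap] at this
    exact le_antisymm (by linarith) h2.1
  have hsum := sum_cones (Finset.univ : Finset Bool)
    (fun b => if b then K P x else N P x)
    (by
      rintro (_ | _) _
      · exact (N_closed x).measurableSet.nullMeasurableSet
      · exact K_null hP.cvx hxP)
    (by
      rintro (_ | _) _ (_ | _) _ h <;> simp at h ⊢
      · rw [inter_comm]; exact hinter0
      · exact hinter0)
  have hU : (⋃ b ∈ (Finset.univ : Finset Bool), (if b then K P x else N P x)) =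
      {w | 0 ≤ cr w (pv P x - x)} := by
    ext w
    simp only [Finset.mem_univ, iUnion_true, mem_iUnion, Bool.exists_bool]
    simp only [if_true, Bool.false_eq_true, if_false]
    rw [hK, hN]
    constructor
    · rintro (h | h) <;> exact h.2
    · intro h
      rcases le_total 0 (cr w (nx P x - x)) with h1 | h1
      · exact Or.inl ⟨h1, h⟩
      · refine Or.inr ⟨?_, h⟩
        rw [cr_swap]; linarith
  rw [hU, half_vol hd] at hsum
  simp at hsum
  unfold mu
  linarith

lemma sum_N : ∑ x ∈ hP.fin.toFinset, volume.real (N P x ∩ Metric.ball 0 1) = Real.pi := by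
  rw [← sum_cones]
  · have : (⋃ i ∈ hP.fin.toFinset, N P i) = univ := by
      rw [eq_univ_iff_forall]
      intro w
      obtain ⟨v, hv, hmin⟩ := hP.fin.exists_minimalFor (cr w) _ hP.ext_nonempty
      have hmin' : ∀ e ∈ ext P, 0 ≤ 1 * cr w (e - v) := by
        intro e he
        rw [cr_sub_right]
        by_contra hh
        push Not at hh
        have := hmin he (by linarith)
        linarith
      simp only [mem_iUnion, Finite.mem_toFinset]
      refine ⟨v, hv, fun p hp => ?_⟩
      have := hP.half_of_ext 1 hmin' p hp
      linarith
    rw [this, univ_inter, vol_ball1]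
  · intro i _; exact (N_closed i).measurableSet.nullMeasurableSet
  · intro i hi j hj hij
    rw [Finite.mem_toFinset] at hi hj
    refine measure_mono_null ?_ (line_null (sub_ne_zero.2 hij))
    rintro w ⟨h1, h2⟩
    have h3 := h1 j (extremePoints_subset hj)
    have h4 := h2 i (extremePoints_subset hi)
    rw [cr_sub_right] at h3 h4
    change cr w (i - j) = 0
    rw [cr_sub_right]; linarith

lemma sum_mu : ∑ x ∈ hP.fin.toFinset, mu P x = ((ext P).ncard - 2) * (Real.pi / 2) := by
  have h1 : ∑ x ∈ hP.fin.toFinset, (mu P x + volume.real (N P x ∩ Metric.ball 0 1)) =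
      ∑ x ∈ hP.fin.toFinset, Real.pi / 2 :=
    Finset.sum_congr rfl fun x hx => hP.mu_add_N (by simpa using hx)
  rw [Finset.sum_add_distrib, hP.sum_N, Finset.sum_const, nsmul_eq_mul,
    ← ncard_eq_toFinset_card _ hP.fin] at h1
  linarith

lemma mu_pos {x : ℂ} (hx : x ∈ P) : 0 < mu P x := by
  unfold mu
  have hne : (interior P).Nonempty := hP.nei
  have hex : ∃ c ∈ interior P, c ≠ x := by
    obtain ⟨c, hc⟩ := hne
    by_cases h : c = x
    · subst h
      rw [mem_interior_iff_mem_nhds, Metric.mem_nhds_iff] at hc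
      obtain ⟨ε, hε, hb⟩ := hc
      refine ⟨c + (ε / 2 : ℝ), ?_, ?_⟩
      · apply (interior_maximal hb Metric.isOpen_ball)
        simp [abs_of_pos hε, hε]
      · simp [hε.ne']
    · exact ⟨c, hc, h⟩
  obtain ⟨c, hc, hcx⟩ := hex
  -- small scaled copy of interior is in the cone and the ball
  let t : ℝ := 2 * ‖c - x‖
  have ht : 0 < t := by have := norm_pos_iff.2 (sub_ne_zero.2 hcx); positivity
  let U : Set ℂ := (fun w => x + t • w) ⁻¹' interior P ∩ Metric.ball 0 1
  have hU : IsOpen U := (isOpen_interior.preimage (by fun_prop)).inter Metric.isOpen_ball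
  have hmem : (t⁻¹ • (c - x)) ∈ U := by
    constructor
    · change x + t • (t⁻¹ • (c - x)) ∈ interior P
      rw [smul_inv_smul₀ ht.ne']; simpa using hc
    · rw [mem_ball_zero_iff, norm_smul, norm_inv, Real.norm_of_nonneg ht.le]
      have := norm_pos_iff.2 (sub_ne_zero.2 hcx)
      simp only [t]; field_simp; norm_num
  have hsub : U ⊆ K P x ∩ Metric.ball 0 1 :=
    inter_subset_inter_left _ fun w hw => ⟨t, ht, interior_subset hw⟩
  have h1 := hU.measure_pos volume ⟨_, hmem⟩
  rw [measureReal_def]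
  exact ENNReal.toReal_pos (h1.trans_le (measure_mono hsub)).ne' (fin_ball _)

lemma fat : ∃ x ∈ ext P, Real.pi / 6 ≤ mu P x := by
  by_contra hcon
  push Not at hcon
  have h1 : ∑ x ∈ hP.fin.toFinset, mu P x < ∑ x ∈ hP.fin.toFinset, Real.pi / 6 := by
    apply Finset.sum_lt_sum_of_nonempty
    · simpa using hP.ext_nonempty
    · intro i hi; exact hcon i (by simpa using hi)
  rw [hP.sum_mu, Finset.sum_const, nsmul_eq_mul, ← ncard_eq_toFinset_card _ hP.fin] at h1
  have h3 : (3 : ℝ) ≤ (ext P).ncard := by exact_mod_cast hP.three_le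
  nlinarith [Real.pi_pos]

end Poly

lemma inter_null {P Q : Set ℂ} (hP : Poly P) (hQ : Poly Q) (h : Disjoint (interior P) (interior Q)) :
    volume (P ∩ Q) = 0 := by
  refine measure_mono_null ?_ (hP.cvx.addHaar_frontier volume)
  rintro p ⟨h1, h2⟩
  rw [frontier, hP.cpt.isClosed.closure_eq]
  refine ⟨h1, fun hi => ?_⟩
  have hq : p ∈ closure (interior Q) := by
    rw [hQ.cvx.closure_interior_eq_closure_of_nonempty_interior hQ.nei]; exact subset_closure h2
  rw [mem_closure_iff] at hq
  obtain ⟨z, hz1, hz2⟩ := hq _ isOpen_interior hi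
  exact disjoint_left.1 h hz1 hz2

lemma K_inter_null {P Q : Set ℂ} (hP : Poly P) (hQ : Poly Q)
    (h : Disjoint (interior P) (interior Q)) {x : ℂ} (hxP : x ∈ P) (hxQ : x ∈ Q) :
    volume (K P x ∩ K Q x) = 0 := by
  have hsub : K P x ∩ K Q x ⊆ ⋃ n : ℕ, (fun w : ℂ => ((1 : ℝ) / (n + 1)) • w) ⁻¹' ((fun w => x + w) ⁻¹' (P ∩ Q)) := by
    rintro w ⟨⟨t, ht, h1⟩, s, hs, h2⟩
    obtain ⟨n, hn⟩ := exists_nat_one_div_lt (lt_min ht hs)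
    rw [mem_iUnion]
    refine ⟨n, K_small hP.cvx hxP (by positivity) (hn.le.trans (min_le_left _ _)) h1,
      K_small hQ.cvx hxQ (by positivity) (hn.le.trans (min_le_right _ _)) h2⟩
  refine measure_mono_null hsub (measure_iUnion_null fun n => ?_)
  rw [Measure.addHaar_preimage_smul _ (by positivity), measure_preimage_add, inter_null hP hQ h,
    mul_zero]

end MC

namespace MC
open MeasureTheory
open scoped Pointwise

def cor (T : Set (Set ℂ)) (x : ℂ) : Set (Set ℂ) := {P | P ∈ T ∧ x ∈ P}
def V (T : Set (Set ℂ)) : Set ℂ := {x | ∃ P ∈ T, x ∈ ext P}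

structure Til (T : Set (Set ℂ)) : Prop where
  poly : ∀ P ∈ T, Poly P
  cover : ∀ z : ℂ, ∃ P ∈ T, z ∈ P
  disj : ∀ P ∈ T, ∀ Q ∈ T, P ≠ Q → Disjoint (interior P) (interior Q)
  mono : ∀ x ∈ V T, ∀ y ∈ V T, ∃ g : Mot, g • x = y ∧ g • cor T x = cor T y

lemma mem_cor_mot {T : Set (Set ℂ)} {g : Mot} {x y : ℂ} (h : g • cor T x = cor T y) {P : Set ℂ} :
    g • P ∈ cor T y ↔ P ∈ cor T x := by
  rw [← h, smul_mem_smul_set_iff]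

namespace Til
variable {T : Set (Set ℂ)} (hT : Til T)
include hT

lemma vnotint {x : ℂ} (hx : x ∈ V T) {P : Set ℂ} (hP : P ∈ T) : x ∉ interior P := by
  obtain ⟨Q, hQ, hxQ⟩ := hx
  by_cases h : P = Q
  · subst h; exact (hT.poly P hP).ext_not_int hxQ
  · intro hi
    have hq : x ∈ closure (interior Q) := by
      rw [(hT.poly Q hQ).cvx.closure_interior_eq_closure_of_nonempty_interior (hT.poly Q hQ).nei]
      exact subset_closure (extremePoints_subset hxQ)
    rw [mem_closure_iff] at hq
    obtain ⟨z, hz1, hz2⟩ := hq _ isOpen_interior hi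
    exact disjoint_left.1 (hT.disj P hP Q hQ h) hz1 hz2

lemma sum_le {x : ℂ} (s : Finset (Set ℂ)) (hs : ∀ P ∈ s, P ∈ cor T x) : ∑ P ∈ s, mu P x ≤ Real.pi := by
  unfold mu
  rw [← sum_cones s (fun P => K P x), ← vol_ball1]
  · exact measureReal_mono inter_subset_right Metric.isBounded_ball.measure_lt_top.ne
  · intro P hP; exact Poly.K_null (hT.poly P (hs P hP).1).cvx (hs P hP).2
  · intro P hP Q hQ h
    exact K_inter_null (hT.poly P (hs P hP).1) (hT.poly Q (hs Q hQ).1)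
      (hT.disj P (hs P hP).1 Q (hs Q hQ).1 h) (hs P hP).2 (hs Q hQ).2

lemma fat_finite (x : ℂ) : {P ∈ cor T x | Real.pi / 6 ≤ mu P x}.Finite := by
  by_contra hcon
  obtain ⟨s, hs, hc⟩ := Set.Infinite.exists_subset_card_eq hcon 7
  have h1 := hT.sum_le (x := x) s fun P hP => (hs hP).1
  have h2 : ∑ P ∈ s, Real.pi / 6 ≤ ∑ P ∈ s, mu P x := Finset.sum_le_sum fun P hP => (hs hP).2
  rw [Finset.sum_const, hc] at h2
  have := Real.pi_pos
  simp at h2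
  linarith

lemma fat_rep {x0 : ℂ} (h0 : x0 ∈ V T) {P : Set ℂ} (hP : P ∈ T) :
    ∃ Q ∈ {P ∈ cor T x0 | Real.pi / 6 ≤ mu P x0}, ∃ g : Mot, P = g • Q := by
  obtain ⟨x, hx, hmu⟩ := (hT.poly P hP).fat
  obtain ⟨g, hg, hgc⟩ := hT.mono x0 h0 x ⟨P, hP, hx⟩
  refine ⟨g⁻¹ • P, ⟨?_, ?_⟩, g, by simp⟩
  · rw [← mem_cor_mot hgc, smul_inv_smul]; exact ⟨hP, extremePoints_subset hx⟩
  · have := mu_mot g (g⁻¹ • P) x0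
    rw [smul_inv_smul, hg] at this
    rw [← this]; exact hmu

lemma V_nonempty : (V T).Nonempty := by
  obtain ⟨P, hP, _⟩ := hT.cover 0
  obtain ⟨x, hx⟩ := (hT.poly P hP).ext_nonempty
  exact ⟨x, P, hP, hx⟩

lemma bounds : ∃ a D : ℝ, ∃ M : ℕ, 0 < a ∧ 0 < D ∧ ∀ P ∈ T, a ≤ volume.real (interior P) ∧
    (∀ p ∈ P, ∀ q ∈ P, dist p q ≤ D) ∧ (ext P).ncard ≤ M := by
  obtain ⟨x0, h0⟩ := hT.V_nonempty
  have hF := hT.fat_finite x0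
  obtain ⟨B1, hB1⟩ := (hF.image fun P => (volume.real (interior P))⁻¹).bddAbove
  obtain ⟨B2, hB2⟩ := (hF.image fun P => Metric.diam P).bddAbove
  obtain ⟨B3, hB3⟩ := (hF.image fun P => (ext P).ncard).bddAbove
  refine ⟨(max B1 1)⁻¹, max B2 1, B3, by positivity, by positivity, ?_⟩
  intro P hP
  obtain ⟨Q, hQ, g, rfl⟩ := hT.fat_rep h0 hP
  have hQp := hT.poly Q hQ.1.1
  refine ⟨?_, ?_, ?_⟩
  · rw [interior_mot, vol_mot]
    have hpos : 0 < volume.real (interior Q) := by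
      rw [measureReal_def]
      exact ENNReal.toReal_pos (isOpen_interior.measure_pos volume hQp.nei).ne'
        (measure_ne_top_of_subset interior_subset hQp.cpt.measure_lt_top.ne)
    have := hB1 ⟨Q, hQ, rfl⟩
    rw [inv_le_comm₀ (by positivity) hpos]
    exact this.trans (le_max_left _ _)
  · rintro _ ⟨p, hp, rfl⟩ _ ⟨q, hq, rfl⟩
    simp only
    rw [mot_dist]
    exact (Metric.dist_le_diam_of_mem hQp.cpt.isBounded hp hq).trans
      ((hB2 ⟨Q, hQ, rfl⟩).trans (le_max_left _ _))
  · rw [ncard_ext_mot]; exact hB3 ⟨Q, hQ, rfl⟩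

lemma finset_bound {a D : ℝ} (hD : 0 < D) (h : ∀ P ∈ T, a ≤ volume.real (interior P) ∧
    (∀ p ∈ P, ∀ q ∈ P, dist p q ≤ D)) (x : ℂ) {R : ℝ} (hR : 0 ≤ R) (s : Finset (Set ℂ))
    (hs : ∀ P ∈ s, P ∈ T ∧ (P ∩ Metric.closedBall x R).Nonempty) :
    s.card * a ≤ Real.pi * (R + D) ^ 2 := by
  have h1 : ∑ P ∈ s, volume.real (interior P) = volume.real (⋃ P ∈ s, interior P) := by
    symm
    apply measureReal_biUnion_finset
    · intro P hP Q hQ hne; exact hT.disj P (hs P hP).1 Q (hs Q hQ).1 hne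
    · intro P _; exact isOpen_interior.measurableSet
    · intro P hP
      exact measure_ne_top_of_subset interior_subset (hT.poly P (hs P hP).1).cpt.measure_lt_top.ne
  have h2 : (⋃ P ∈ s, interior P) ⊆ Metric.closedBall x (R + D) := by
    intro z hz
    simp only [mem_iUnion] at hz
    obtain ⟨P, hP, hz⟩ := hz
    obtain ⟨hPT, y, hy, hyR⟩ := hs P hP
    have := (h P hPT).2 z (interior_subset hz) y hy
    have h3 := dist_triangle z y x
    rw [Metric.mem_closedBall] at *
    linarith
  have h3 : volume.real (⋃ P ∈ s, interior P) ≤ Real.pi * (R + D) ^ 2 := by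
    have h4 := measureReal_mono h2 (μ := volume) Metric.isBounded_closedBall.measure_lt_top.ne
    have h5 : volume.real (Metric.closedBall x (R + D)) = Real.pi * (R + D) ^ 2 := by
      rw [measureReal_def, Complex.volume_closedBall]
      simp [ENNReal.toReal_ofReal (by linarith : 0 ≤ R + D)]; ring
    rwa [h5] at h4
  have h6 : ∑ P ∈ s, a ≤ ∑ P ∈ s, volume.real (interior P) :=
    Finset.sum_le_sum fun P hP => (h P (hs P hP).1).1
  rw [Finset.sum_const, nsmul_eq_mul] at h6
  linarith

lemma tiles_finite (x : ℂ) {R : ℝ} (hR : 0 ≤ R) :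
    {P ∈ T | (P ∩ Metric.closedBall x R).Nonempty}.Finite := by
  obtain ⟨a, D, M, ha, hD, h⟩ := hT.bounds
  by_contra hcon
  obtain ⟨n, hn⟩ := exists_nat_gt (Real.pi * (R + D) ^ 2 / a)
  obtain ⟨s, hs, hc⟩ := Set.Infinite.exists_subset_card_eq hcon n
  have := hT.finset_bound hD (fun P hP => ⟨(h P hP).1, (h P hP).2.1⟩) x hR s (fun P hP => hs hP)
  rw [hc] at this
  rw [div_lt_iff₀ ha] at hn
  linarith

lemma cor_finite (x : ℂ) : (cor T x).Finite :=
  (hT.tiles_finite x le_rfl).subset fun P hP => ⟨hP.1, x, hP.2, by simp⟩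

/-- polynomial growth of the vertex set -/
lemma V_growth : ∃ A B : ℝ, ∀ R : ℝ, 0 ≤ R → (V T ∩ Metric.closedBall 0 R).Finite ∧
    ((V T ∩ Metric.closedBall 0 R).ncard : ℝ) ≤ A * (R + B) ^ 2 := by
  obtain ⟨a, D, M, ha, hD, h⟩ := hT.bounds
  refine ⟨M * Real.pi / a, D, fun R hR => ?_⟩
  have hfin := hT.tiles_finite 0 hR
  have hsub : V T ∩ Metric.closedBall 0 R ⊆ ⋃ P ∈ hfin.toFinset, ext P := by
    rintro x ⟨⟨P, hP, hx⟩, hxR⟩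
    simp only [mem_iUnion]
    exact ⟨P, hfin.mem_toFinset.2 ⟨hP, x, extremePoints_subset hx, hxR⟩, hx⟩
  have hf2 : (⋃ P ∈ hfin.toFinset, ext P).Finite := by
    apply Finite.biUnion (Finset.finite_toSet _)
    intro P hP
    exact (hT.poly P (hfin.mem_toFinset.1 hP).1).fin
  refine ⟨hf2.subset hsub, ?_⟩
  have h1 := ncard_le_ncard hsub hf2
  have h2 : (⋃ P ∈ hfin.toFinset, ext P).ncard ≤ ∑ P ∈ hfin.toFinset, (ext P).ncard := by
    exact Finset.set_ncard_biUnion_le _ _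
  have h3 : ∑ P ∈ hfin.toFinset, (ext P).ncard ≤ ∑ P ∈ hfin.toFinset, M :=
    Finset.sum_le_sum fun P hP => (h P (hfin.mem_toFinset.1 hP).1).2.2
  rw [Finset.sum_const, smul_eq_mul] at h3
  have h4 := hT.finset_bound hD (fun P hP => ⟨(h P hP).1, (h P hP).2.1⟩) 0 hR hfin.toFinset
    (fun P hP => hfin.mem_toFinset.1 hP)
  have h5 : ((V T ∩ Metric.closedBall 0 R).ncard : ℝ) ≤ hfin.toFinset.card * M := by
    exact_mod_cast h1.trans (h2.trans h3)
  refine h5.trans ?_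
  have h6 : (hfin.toFinset.card : ℝ) ≤ Real.pi * (R + D) ^ 2 / a := by
    rw [le_div_iff₀ ha]; exact h4
  calc (hfin.toFinset.card : ℝ) * M ≤ (Real.pi * (R + D) ^ 2 / a) * M := by gcongr
    _ = _ := by ring

lemma V_countable : (V T).Countable := by
  obtain ⟨A, B, h⟩ := hT.V_growth
  have : V T = ⋃ n : ℕ, V T ∩ Metric.closedBall 0 n := by
    rw [← inter_iUnion, Metric.iUnion_closedBall_nat, inter_univ]
  rw [this]
  exact countable_iUnion fun n => (h n (Nat.cast_nonneg n)).1.countable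

lemma locl (x : ℂ) : ∃ r > 0, ∀ P ∈ T, (P ∩ Metric.ball x r).Nonempty → x ∈ P := by
  have hfin := hT.tiles_finite x zero_le_one
  have hclosed : IsClosed (⋃ P ∈ {P ∈ T | (P ∩ Metric.closedBall x 1).Nonempty ∧ x ∉ P}, P) := by
    apply Finite.isClosed_biUnion (hfin.subset fun P hP => ⟨hP.1, hP.2.1⟩)
    intro P hP; exact (hT.poly P hP.1).cpt.isClosed
  have hx : x ∈ (⋃ P ∈ {P ∈ T | (P ∩ Metric.closedBall x 1).Nonempty ∧ x ∉ P}, P)ᶜ := by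
    simp only [mem_compl_iff, mem_iUnion, not_exists]
    intro P hP h; exact hP.2.2 h
  obtain ⟨r, hr, hb⟩ := Metric.isOpen_iff.1 hclosed.isOpen_compl x hx
  refine ⟨min r 1, by positivity, fun P hP ⟨z, hz1, hz2⟩ => ?_⟩
  by_contra hcon
  have hz3 : z ∈ Metric.ball x r := Metric.ball_subset_ball (min_le_left _ _) hz2
  apply hb hz3
  simp only [mem_iUnion]
  refine ⟨P, ⟨hP, ⟨z, hz1, ?_⟩, hcon⟩, hz1⟩
  exact Metric.ball_subset_closedBall (Metric.ball_subset_ball (min_le_right _ _) hz2)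

lemma K_cover (x w : ℂ) : ∃ P ∈ cor T x, w ∈ K P x := by
  obtain ⟨r, hr, h⟩ := hT.locl x
  let t : ℝ := r / 2 / (‖w‖ + 1)
  have ht : 0 < t := by positivity
  obtain ⟨P, hP, hz⟩ := hT.cover (x + t • w)
  have : x ∈ P := by
    refine h P hP ⟨_, hz, ?_⟩
    simp only [Metric.mem_ball, dist_self_add_left, norm_smul, Real.norm_of_nonneg ht.le, t]
    rw [div_mul_eq_mul_div, div_lt_iff₀ (by positivity)]
    nlinarith [norm_nonneg w]
  exact ⟨P, ⟨hP, this⟩, t, ht, hz⟩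

lemma sum_eq (x : ℂ) : ∑ P ∈ (hT.cor_finite x).toFinset, mu P x = Real.pi := by
  unfold mu
  rw [← sum_cones _ (fun P => K P x), ← vol_ball1]
  · congr 1
    rw [inter_eq_right]
    intro w _
    obtain ⟨P, hP, hw⟩ := hT.K_cover x w
    simp only [mem_iUnion]
    exact ⟨P, by simpa using hP, hw⟩
  · intro P hP
    rw [Finite.mem_toFinset] at hP
    exact Poly.K_null (hT.poly P hP.1).cvx hP.2
  · intro P hP Q hQ h
    rw [Finite.mem_toFinset] at hP hQ
    exact K_inter_null (hT.poly P hP.1) (hT.poly Q hQ.1)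
      (hT.disj P hP.1 Q hQ.1 h) hP.2 hQ.2

lemma overlap {x : ℂ} {P Q : Set ℂ} (hP : P ∈ cor T x) (hQ : Q ∈ cor T x) {d c c' : ℂ} (s : ℝ)
    (hd : d ∈ K P x) (hd' : d ∈ K Q x) (hc : c ∈ K P x) (hc' : c' ∈ K Q x)
    (h : 0 < s * cr d c) (h' : 0 < s * cr d c') : P = Q := by
  by_contra hne
  have hnull := K_inter_null (hT.poly P hP.1) (hT.poly Q hQ.1)
      (hT.disj P hP.1 Q hQ.1 hne) hP.2 hQ.2
  let U : Set ℂ := {w | 0 < s * cr d w} ∩ ({w | 0 < s * cr w c} ∩ {w | 0 < s * cr w c'})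
  have hU : IsOpen U := by
    refine IsOpen.inter ?_ (IsOpen.inter ?_ ?_)
    · exact isOpen_lt continuous_const (continuous_const.mul (cr_cont_right d))
    · exact isOpen_lt continuous_const (continuous_const.mul (cr_cont_left c))
    · exact isOpen_lt continuous_const (continuous_const.mul (cr_cont_left c'))
  have hs : s ≠ 0 := by rintro rfl; simp at h
  have hd0 : d ≠ 0 := by rintro rfl; simp [cr_zero_left] at h
  have hUne : U.Nonempty := by
    have hlim : ∀ e : ℂ, 0 < s * cr d e → ∀ᶠ ε in nhdsWithin (0 : ℝ) (Ioi 0),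
        0 < s * cr (d + (s * ε) • (Complex.I * d)) e := by
      intro e he
      have hcont : Continuous fun ε : ℝ => s * cr (d + (s * ε) • (Complex.I * d)) e :=
        continuous_const.mul ((cr_cont_left e).comp (by fun_prop))
      have := hcont.tendsto 0
      simp only [mul_zero, zero_smul, add_zero] at this
      exact (this.eventually (lt_mem_nhds he)).filter_mono nhdsWithin_le_nhds
    obtain ⟨ε, ⟨h1, h2⟩, h3⟩ := (((hlim c h).and (hlim c' h')).and self_mem_nhdsWithin).exists
    refine ⟨_, ?_, h1, h2⟩
    change 0 < s * cr d (d + (s * ε) • (Complex.I * d))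
    rw [cr_add_right, cr_self, cr_smul_right]
    have h4 : cr d (Complex.I * d) = d.re ^ 2 + d.im ^ 2 := by simp [cr]; ring
    rw [h4]
    have := ne_zero_sq hd0
    have h5 : 0 < s ^ 2 := by positivity
    have h6 : (0 : ℝ) < ε := h3
    have : 0 < s ^ 2 * ε * (d.re ^ 2 + d.im ^ 2) := by positivity
    nlinarith
  have hsub : U ⊆ K P x ∩ K Q x := by
    have key : ∀ (R : Set ℂ) (e w : ℂ), R ∈ cor T x → d ∈ K R x → e ∈ K R x → 0 < s * cr d e →
        0 < s * cr d w → 0 < s * cr w e → w ∈ K R x := by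
      intro R e w hR h1 h2 h3 h4 h5
      have h6 : cr d e ≠ 0 := by intro h; rw [h] at h3; simp at h3
      rw [cramer' w h6]
      refine K_comb (hT.poly R hR.1).cvx hR.2 h1 h2 ?_ ?_
      · rw [← mul_div_mul_left _ _ hs]; positivity
      · rw [← mul_div_mul_left _ _ hs]; positivity
    rintro w ⟨h1, h2, h3⟩
    exact ⟨key P c w hP hd hc h h1 h2, key Q c' w hQ hd' hc' h' h1 h3⟩
  exact (hU.measure_pos volume hUne).ne' (measure_mono_null hsub hnull)

/-- no line: some cone element strictly off the direction, with sign -/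
lemma offdir {x : ℂ} {P : Set ℂ} (hP : P ∈ cor T x) {d : ℂ} (hd : d ≠ 0) :
    (∃ c ∈ K P x, 0 < cr d c) ∨ (∃ c ∈ K P x, cr d c < 0) := by
  by_contra hcon
  push Not at hcon
  exact (hT.poly P hP.1).noline hd (x := x) fun p hp =>
    le_antisymm (hcon.1 _ (K_of_mem hp)) (hcon.2 _ (K_of_mem hp))

end Til
end MC

namespace MC
open MeasureTheory
open scoped Pointwise

lemma cr_pos_mul_left {s : ℝ} (a b : ℂ) (h : 0 < s * cr a b) (hs : 0 < s) : 0 < cr a b :=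
  pos_of_mul_pos_right h hs.le

def Sc (T : Set (Set ℂ)) (x : ℂ) (P Q : Set ℂ) : Prop :=
  P ∈ cor T x ∧ Q ∈ cor T x ∧ ∃ s : ℝ, 0 < s ∧ nx Q x - x = s • (pv P x - x)

namespace Poly
variable {P : Set ℂ} (hP : Poly P)
include hP

lemma K_closed {x : ℂ} (hx : x ∈ P) (hi : x ∉ interior P) : IsClosed (K P x) := by
  rw [hP.K_eq hx (hP.nx_spec hi) (hP.pv_spec hi)]
  exact (isClosed_le continuous_const (cr_cont_right _)).inter
    (isClosed_le continuous_const (cr_cont_left _))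

lemma K_half_nx {x v : ℂ} (hx : x ∈ P) (hi : x ∉ interior P) (hv : v ∈ K P x) :
    0 ≤ cr (nx P x - x) v := by
  rw [hP.K_eq hx (hP.nx_spec hi) (hP.pv_spec hi)] at hv; exact hv.1

lemma K_half_pv {x v : ℂ} (hx : x ∈ P) (hi : x ∉ interior P) (hv : v ∈ K P x) :
    0 ≤ cr v (pv P x - x) := by
  rw [hP.K_eq hx (hP.nx_spec hi) (hP.pv_spec hi)] at hv; exact hv.2

lemma nxK {x : ℂ} (hi : x ∉ interior P) : nx P x - x ∈ K P x :=
  K_of_mem (extremePoints_subset (hP.nx_spec hi).1)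

lemma pvK {x : ℂ} (hi : x ∉ interior P) : pv P x - x ∈ K P x :=
  K_of_mem (extremePoints_subset (hP.pv_spec hi).1)

lemma onRt {x w : ℂ} (hx : x ∈ P) (hi : x ∉ interior P) (hw : w ∈ K P x) (hw0 : w ≠ 0)
    (h : ∀ v ∈ K P x, 0 ≤ cr w v) : ∃ s : ℝ, 0 < s ∧ nx P x - x = s • w := by
  have h1 := h _ (hP.nxK hi)
  have h2 := hP.K_half_nx hx hi hw
  rw [cr_swap] at h2
  obtain ⟨s, hs⟩ := par hw0 (le_antisymm (by linarith) h1)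
  refine ⟨s, ?_, hs⟩
  by_contra hcon
  push Not at hcon
  refine hP.noline hw0 (x := x) fun p hp => le_antisymm ?_ (h _ (K_of_mem hp))
  have h3 := hP.K_half_nx hx hi (K_of_mem hp)
  rw [hs, cr_smul_left] at h3
  rcases hcon.eq_or_lt with h4 | h4
  · rw [h4, zero_smul] at hs; exact absurd (sub_eq_zero.1 hs) (hP.nx_spec hi).2.1
  · by_contra hh; push Not at hh; nlinarith

lemma onLt {x w : ℂ} (hx : x ∈ P) (hi : x ∉ interior P) (hw : w ∈ K P x) (hw0 : w ≠ 0)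
    (h : ∀ v ∈ K P x, cr w v ≤ 0) : ∃ s : ℝ, 0 < s ∧ pv P x - x = s • w := by
  have h1 := h _ (hP.pvK hi)
  have h2 := hP.K_half_pv hx hi hw
  obtain ⟨s, hs⟩ := par hw0 (le_antisymm h1 h2)
  refine ⟨s, ?_, hs⟩
  by_contra hcon
  push Not at hcon
  refine hP.noline hw0 (x := x) fun p hp => le_antisymm (h _ (K_of_mem hp)) ?_
  have h3 := hP.K_half_pv hx hi (K_of_mem hp)
  rw [hs, cr_smul_right, cr_swap] at h3
  rcases hcon.eq_or_lt with h4 | h4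
  · rw [h4, zero_smul] at hs; exact absurd (sub_eq_zero.1 hs) (hP.pv_spec hi).2.1
  · by_contra hh; push Not at hh; nlinarith

lemma off_nx {x : ℂ} (hx : x ∈ P) (hi : x ∉ interior P) : ∃ c ∈ K P x, 0 < cr (nx P x - x) c := by
  by_contra hcon
  push Not at hcon
  exact hP.noline (sub_ne_zero.2 (hP.nx_spec hi).2.1) (x := x) fun p hp =>
    le_antisymm (hcon _ (K_of_mem hp)) (hP.K_half_nx hx hi (K_of_mem hp))

lemma off_pv {x : ℂ} (hx : x ∈ P) (hi : x ∉ interior P) : ∃ c ∈ K P x, cr (pv P x - x) c < 0 := by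
  by_contra hcon
  push Not at hcon
  refine hP.noline (sub_ne_zero.2 (hP.pv_spec hi).2.1) (x := x) fun p hp =>
    le_antisymm ?_ (hcon _ (K_of_mem hp))
  have := hP.K_half_pv hx hi (K_of_mem hp)
  rw [cr_swap] at this; linarith

end Poly

lemma Sc_mot {T : Set (Set ℂ)} (hT : Til T) {x y : ℂ} (hx : x ∈ V T) {g : Mot} (hg : g • x = y)
    (hgc : g • cor T x = cor T y) {P Q : Set ℂ} (h : Sc T x P Q) : Sc T y (g • P) (g • Q) := by
  obtain ⟨h1, h2, s, hs, h3⟩ := h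
  refine ⟨(mem_cor_mot hgc).2 h1, (mem_cor_mot hgc).2 h2, s, hs, ?_⟩
  rw [← hg, (hT.poly Q h2.1).nx_mot g h2.2 (hT.vnotint hx h2.1),
    (hT.poly P h1.1).pv_mot g h1.2 (hT.vnotint hx h1.1), smul_sub', smul_sub', h3, mul_smul_comm]

namespace Til
variable {T : Set (Set ℂ)} (hT : Til T)
include hT

lemma notint2 {x : ℂ} {P Q : Set ℂ} (hP : P ∈ cor T x) (hQ : Q ∈ cor T x) (h : P ≠ Q) :
    x ∉ interior P := by
  intro hi
  have hq : x ∈ closure (interior Q) := by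
    rw [(hT.poly Q hQ.1).cvx.closure_interior_eq_closure_of_nonempty_interior (hT.poly Q hQ.1).nei]
    exact subset_closure hQ.2
  rw [mem_closure_iff] at hq
  obtain ⟨z, hz1, hz2⟩ := hq _ isOpen_interior hi
  exact disjoint_left.1 (hT.disj P hP.1 Q hQ.1 h) hz1 hz2

/-- two different tiles sharing a direction -/
lemma adj {x w : ℂ} {P Q : Set ℂ} (hP : P ∈ cor T x) (hQ : Q ∈ cor T x) (hne : P ≠ Q)
    (hw : w ≠ 0) (h1 : w ∈ K P x) (h2 : w ∈ K Q x) :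
    ((∃ s : ℝ, 0 < s ∧ pv P x - x = s • w) ∧ (∃ s : ℝ, 0 < s ∧ nx Q x - x = s • w)) ∨
    ((∃ s : ℝ, 0 < s ∧ nx P x - x = s • w) ∧ (∃ s : ℝ, 0 < s ∧ pv Q x - x = s • w)) := by
  have iP := hT.notint2 hP hQ hne
  have iQ := hT.notint2 hQ hP hne.symm
  have hov : ∀ s : ℝ, ∀ c ∈ K P x, ∀ c' ∈ K Q x, 0 < s * cr w c → 0 < s * cr w c' → False :=
    fun s c hc c' hc' h h' => hne (hT.overlap hP hQ s h1 h2 hc hc' h h')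
  rcases hT.offdir hP hw with ⟨c, hc, hcp⟩ | ⟨c, hc, hcn⟩
  · right
    have hQn : ∀ v ∈ K Q x, cr w v ≤ 0 := by
      intro v hv; by_contra hh; push Not at hh
      exact hov 1 c hc v hv (by linarith) (by linarith)
    obtain ⟨c', hc', hcn'⟩ : ∃ c ∈ K Q x, cr w c < 0 := by
      rcases hT.offdir hQ hw with ⟨c', hc', h⟩ | h
      · exact absurd (hQn c' hc') (not_le.2 h)
      · exact h
    have hPn : ∀ v ∈ K P x, 0 ≤ cr w v := by
      intro v hv; by_contra hh; push Not at hh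
      exact hov (-1) v hv c' hc' (by linarith) (by linarith)
    exact ⟨(hT.poly P hP.1).onRt hP.2 iP h1 hw hPn, (hT.poly Q hQ.1).onLt hQ.2 iQ h2 hw hQn⟩
  · left
    have hQn : ∀ v ∈ K Q x, 0 ≤ cr w v := by
      intro v hv; by_contra hh; push Not at hh
      exact hov (-1) c hc v hv (by linarith) (by linarith)
    obtain ⟨c', hc', hcn'⟩ : ∃ c ∈ K Q x, 0 < cr w c := by
      rcases hT.offdir hQ hw with h | ⟨c', hc', h⟩
      · exact h
      · exact absurd (hQn c' hc') (not_le.2 h)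
    have hPn : ∀ v ∈ K P x, cr w v ≤ 0 := by
      intro v hv; by_contra hh; push Not at hh
      exact hov 1 v hv c' hc' (by linarith) (by linarith)
    exact ⟨(hT.poly P hP.1).onLt hP.2 iP h1 hw hPn, (hT.poly Q hQ.1).onRt hQ.2 iQ h2 hw hQn⟩

lemma Rt_ray_unique {x : ℂ} {P Q : Set ℂ} (hP : P ∈ cor T x) (hQ : Q ∈ cor T x)
    (iP : x ∉ interior P) (iQ : x ∉ interior Q)
    {s : ℝ} (hs : 0 < s) (h : nx Q x - x = s • (nx P x - x)) : P = Q := by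
  obtain ⟨c, hc, hc'⟩ := (hT.poly P hP.1).off_nx hP.2 iP
  obtain ⟨e, he, he'⟩ := (hT.poly Q hQ.1).off_nx hQ.2 iQ
  have hd : nx P x - x ∈ K Q x := by
    have := K_smul ((hT.poly Q hQ.1).nxK iQ) (inv_pos.2 hs)
    rwa [h, inv_smul_smul₀ hs.ne'] at this
  rw [h, cr_smul_left] at he'
  exact hT.overlap hP hQ 1 ((hT.poly P hP.1).nxK iP) hd hc he (by linarith) 
    (by linarith [pos_of_mul_pos_right he' hs.le])

lemma Lt_ray_unique {x : ℂ} {P Q : Set ℂ} (hP : P ∈ cor T x) (hQ : Q ∈ cor T x)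
    (iP : x ∉ interior P) (iQ : x ∉ interior Q)
    {s : ℝ} (hs : 0 < s) (h : pv Q x - x = s • (pv P x - x)) : P = Q := by
  obtain ⟨c, hc, hc'⟩ := (hT.poly P hP.1).off_pv hP.2 iP
  obtain ⟨e, he, he'⟩ := (hT.poly Q hQ.1).off_pv hQ.2 iQ
  have hd : pv P x - x ∈ K Q x := by
    have := K_smul ((hT.poly Q hQ.1).pvK iQ) (inv_pos.2 hs)
    rwa [h, inv_smul_smul₀ hs.ne'] at this
  rw [h, cr_smul_left] at he'
  refine hT.overlap hP hQ (-1) ((hT.poly P hP.1).pvK iP) hd hc he (by linarith) ?_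
  have : 0 < s * (-1 * cr (pv P x - x) e) := by linarith
  exact pos_of_mul_pos_right this hs.le

lemma Sc_unique {x : ℂ} (hx : x ∈ V T) {P Q R : Set ℂ} (h1 : Sc T x P Q) (h2 : Sc T x P R) : Q = R := by
  obtain ⟨_, hQ, s, hs, h⟩ := h1
  obtain ⟨_, hR, t, ht, h'⟩ := h2
  refine hT.Rt_ray_unique hQ hR (hT.vnotint hx hQ.1) (hT.vnotint hx hR.1) (s := t / s)
    (by positivity) ?_
  rw [h, h', smul_smul, div_mul_cancel₀ _ hs.ne']

lemma Sc_inj {x : ℂ} (hx : x ∈ V T) {P Q R : Set ℂ} (h1 : Sc T x P R) (h2 : Sc T x Q R) : P = Q := by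
  obtain ⟨hP, _, s, hs, h⟩ := h1
  obtain ⟨hQ, _, t, ht, h'⟩ := h2
  refine hT.Lt_ray_unique hP hQ (hT.vnotint hx hP.1) (hT.vnotint hx hQ.1) (s := s / t)
    (by positivity) ?_
  have : t • (pv Q x - x) = s • (pv P x - x) := by rw [← h, ← h']
  rw [div_eq_inv_mul, ← smul_smul, ← this, inv_smul_smul₀ ht.ne']

lemma Sc_exists {x : ℂ} (hx : x ∈ V T) {P : Set ℂ} (hP : P ∈ cor T x) : ∃ Q, Sc T x P Q := by
  have iP := hT.vnotint hx hP.1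
  set d := pv P x - x with hd
  have hd0 : d ≠ 0 := sub_ne_zero.2 ((hT.poly P hP.1).pv_spec iP).2.1
  choose Q hQ hwQ using fun n : ℕ => hT.K_cover x (d + ((1 : ℝ) / (n + 1)) • (Complex.I * d))
  have hfin := hT.cor_finite x
  have : ∃ R ∈ cor T x, ∃ᶠ n in Filter.atTop, Q n = R := by
    have h1 : ∃ᶠ n in Filter.atTop, ∃ R ∈ cor T x, Q n = R :=
      (Filter.Eventually.of_forall fun n => ⟨Q n, hQ n, rfl⟩).frequently
    by_contra hcon
    push Not at hcon
    have h2 : ∀ᶠ n in Filter.atTop, ∀ R ∈ cor T x, Q n ≠ R := by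
      rw [Filter.eventually_all_finite hfin]
      intro R hR
      exact Filter.not_frequently.1 (by simpa using hcon R hR)
    obtain ⟨n, ⟨R, hR, h3⟩, h4⟩ := (h1.and_eventually h2).exists
    exact h4 R hR h3
  obtain ⟨R, hR, hfr⟩ := this
  have iR := hT.vnotint hx hR.1
  have hdR : d ∈ K R x := by
    have hcl := (hT.poly R hR.1).K_closed hR.2 iR
    have hlim : Filter.Tendsto (fun n : ℕ => d + ((1 : ℝ) / (n + 1)) • (Complex.I * d)) Filter.atTop
        (nhds d) := by
      have := (tendsto_one_div_add_atTop_nhds_zero_nat (𝕜 := ℝ)).smul_const (Complex.I * d)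
      have := this.const_add d
      simpa using this
    refine hcl.mem_of_frequently_of_tendsto (hfr.mono fun n hn => ?_) hlim
    rw [← hn]; exact hwQ n
  obtain ⟨n, hn⟩ := hfr.exists
  have hc := hwQ n
  rw [hn] at hc
  have hI : cr d (Complex.I * d) = d.re ^ 2 + d.im ^ 2 := by simp [cr]; ring
  have hcp : 0 < cr d (d + ((1 : ℝ) / (n + 1)) • (Complex.I * d)) := by
    rw [cr_add_right, cr_self, cr_smul_right, hI, zero_add]
    have := ne_zero_sq hd0
    positivity
  have hne : P ≠ R := by
    rintro rfl
    have := (hT.poly P hP.1).K_half_pv hP.2 iP hc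
    rw [cr_swap] at this
    linarith
  rcases hT.adj hP hR hne hd0 ((hT.poly P hP.1).pvK iP) hdR with ⟨_, s, hs, h⟩ | ⟨_, s, hs, h⟩
  · exact ⟨R, hP, hR, s, hs, h⟩
  · exfalso
    have := (hT.poly R hR.1).K_half_pv hR.2 iR hc
    rw [h, cr_smul_right, cr_swap] at this
    nlinarith

open Classical in
omit hT in
def _root_.MC.sc (T : Set (Set ℂ)) (x : ℂ) (P : Set ℂ) : Set ℂ :=
  if h : ∃ Q, Sc T x P Q then h.choose else P

lemma sc_spec {x : ℂ} (hx : x ∈ V T) {P : Set ℂ} (hP : P ∈ cor T x) : Sc T x P (sc T x P) := by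
  have h := hT.Sc_exists hx hP
  unfold sc; rw [dif_pos h]; exact h.choose_spec

lemma sc_eq {x : ℂ} (hx : x ∈ V T) {P Q : Set ℂ} (h : Sc T x P Q) : sc T x P = Q :=
  hT.Sc_unique hx (hT.sc_spec hx h.1) h

lemma sc_mot {x y : ℂ} (hx : x ∈ V T) (hy : y ∈ V T) {g : Mot} (hg : g • x = y)
    (hgc : g • cor T x = cor T y) {P : Set ℂ} (hP : P ∈ cor T x) :
    sc T y (g • P) = g • sc T x P :=
  hT.sc_eq hy (Sc_mot hT hx hg hgc (hT.sc_spec hx hP))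

lemma sc_bij {x : ℂ} (hx : x ∈ V T) : BijOn (sc T x) (cor T x) (cor T x) := by
  have hm : MapsTo (sc T x) (cor T x) (cor T x) := fun P hP => (hT.sc_spec hx hP).2.1
  rw [← (hT.cor_finite x).injOn_iff_bijOn_of_mapsTo hm]
  intro P hP Q hQ h
  have h1 := hT.sc_spec hx hP
  have h2 := hT.sc_spec hx hQ
  rw [← h] at h2
  exact hT.Sc_inj hx h1 h2

lemma sc_ne {x : ℂ} (hx : x ∈ V T) {P : Set ℂ} (hP : P ∈ cor T x) : sc T x P ≠ P := by
  intro h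
  have h1 := hT.sc_spec hx hP
  rw [h] at h1
  obtain ⟨_, _, s, hs, h2⟩ := h1
  have iP := hT.vnotint hx hP.1
  obtain ⟨c, hc, h3⟩ := (hT.poly P hP.1).off_pv hP.2 iP
  have h4 := (hT.poly P hP.1).K_half_nx hP.2 iP hc
  rw [h2, cr_smul_left] at h4
  nlinarith

/-- the successor map acts as a single cycle -/
lemma sc_cycle {x : ℂ} (hx : x ∈ V T) {O : Set (Set ℂ)} (hO : O ⊆ cor T x) (hne : O.Nonempty)
    (h : ∀ P ∈ O, sc T x P ∈ O) : O = cor T x := by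
  by_contra hcon
  have hfin := hT.cor_finite x
  have hB : (cor T x \ O).Nonempty := by
    rw [sdiff_nonempty]; intro h2; exact hcon (Subset.antisymm hO h2)
  have hsurj : SurjOn (sc T x) O O := by
    have hinj : InjOn (sc T x) O := (hT.sc_bij hx).injOn.mono hO
    exact (((hfin.subset hO).injOn_iff_bijOn_of_mapsTo h).1 hinj).surjOn
  have hcl : ∀ Q ∈ cor T x, sc T x Q ∈ O → Q ∈ O := by
    intro Q hQ hs
    obtain ⟨Q', hQ', e⟩ := hsurj hs
    rwa [← (hT.sc_bij hx).injOn (hO hQ') hQ e]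
  have hconn : IsPreconnected ({0}ᶜ : Set ℂ) := by
    refine (isPathConnected_compl_singleton_of_one_lt_rank ?_ 0).isConnected.isPreconnected
    rw [Complex.rank_real_complex]; norm_num
  have hclosed : ∀ S : Set (Set ℂ), S ⊆ cor T x → IsClosed (⋃ P ∈ S, K P x) := by
    intro S hS
    apply (hfin.subset hS).isClosed_biUnion
    intro P hP
    exact (hT.poly P (hS hP).1).K_closed (hS hP).2 (hT.vnotint hx (hS hP).1)
  have hpt : ∀ S : Set (Set ℂ), S ⊆ cor T x → S.Nonempty → (({0}ᶜ : Set ℂ) ∩ ⋃ P ∈ S, K P x).Nonempty := by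
    rintro S hS ⟨P, hP⟩
    have iP := hT.vnotint hx (hS hP).1
    refine ⟨nx P x - x, sub_ne_zero.2 ((hT.poly P (hS hP).1).nx_spec iP).2.1, ?_⟩
    simp only [mem_iUnion]
    exact ⟨P, hP, (hT.poly P (hS hP).1).nxK iP⟩
  obtain ⟨w, hw0, hwA, hwB⟩ := isPreconnected_closed_iff.1 hconn _ _ (hclosed O hO)
    (hclosed _ sdiff_subset) (by
      intro w _
      obtain ⟨P, hP, hw⟩ := hT.K_cover x w
      by_cases hPO : P ∈ O
      · left; simp only [mem_iUnion]; exact ⟨P, hPO, hw⟩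
      · right; simp only [mem_iUnion]; exact ⟨P, ⟨hP, hPO⟩, hw⟩)
    (hpt O hO hne) (hpt _ sdiff_subset hB)
  simp only [mem_iUnion] at hwA hwB
  obtain ⟨P, hP, hwP⟩ := hwA
  obtain ⟨Q, ⟨hQ, hQO⟩, hwQ⟩ := hwB
  have hPQ : P ≠ Q := by rintro rfl; exact hQO hP
  have mk : ∀ {P Q : Set ℂ}, P ∈ cor T x → Q ∈ cor T x → (∃ s : ℝ, 0 < s ∧ pv P x - x = s • w) →
      (∃ s : ℝ, 0 < s ∧ nx Q x - x = s • w) → sc T x P = Q := by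
    rintro P Q hP hQ ⟨s, hs, h1⟩ ⟨t, ht, h2⟩
    refine hT.sc_eq hx ⟨hP, hQ, t / s, by positivity, ?_⟩
    rw [h1, h2, smul_smul, div_mul_cancel₀ _ hs.ne']
  rcases hT.adj (hO hP) hQ hPQ hw0 hwP hwQ with ⟨h1, h2⟩ | ⟨h1, h2⟩
  · have := mk (hO hP) hQ h1 h2
    exact hQO (this ▸ h P hP)
  · have := mk hQ (hO hP) h2 h1
    exact hQO (hcl Q hQ (this ▸ hP))

end Til
end MC

namespace MC
open MeasureTheory
open scoped Pointwise

/-- tiles having `x` as a corner -/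
def corE (T : Set (Set ℂ)) (x : ℂ) : Set (Set ℂ) := {P | P ∈ T ∧ x ∈ ext P}

lemma corE_sub {T : Set (Set ℂ)} {x : ℂ} : corE T x ⊆ cor T x :=
  fun _ h => ⟨h.1, extremePoints_subset h.2⟩

lemma growth_aux {f : ℕ → ℝ} {q A B : ℝ} (hq0 : 0 ≤ q) (hq : q < 1) (h1 : 1 ≤ f 0)
    (h : ∀ n, f n ≤ q * f (n + 1)) (hB : ∀ n : ℕ, f n ≤ A * (n + B) ^ 2) : False := by
  have h2 : ∀ n, f 0 ≤ q ^ n * f n := by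
    intro n
    induction n with
    | zero => simp
    | succ n ih =>
      refine ih.trans ?_
      rw [pow_succ, mul_assoc]
      exact mul_le_mul_of_nonneg_left (h n) (by positivity)
  have t0 := tendsto_pow_const_mul_const_pow_of_abs_lt_one 0 (r := q) (by rwa [abs_of_nonneg hq0])
  have t1 := tendsto_pow_const_mul_const_pow_of_abs_lt_one 1 (r := q) (by rwa [abs_of_nonneg hq0])
  have t2 := tendsto_pow_const_mul_const_pow_of_abs_lt_one 2 (r := q) (by rwa [abs_of_nonneg hq0])
  have t : Filter.Tendsto (fun n : ℕ => q ^ n * (A * (n + B) ^ 2)) Filter.atTop (nhds 0) := by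
    have := ((t2.const_mul A).add (t1.const_mul (2 * A * B))).add (t0.const_mul (A * B ^ 2))
    simp only [mul_zero, add_zero] at this
    refine this.congr fun n => ?_
    ring
  obtain ⟨n, hn⟩ := (t.eventually (gt_mem_nhds (show (0 : ℝ) < 1 by norm_num))).exists
  have := h2 n
  have h3 := mul_le_mul_of_nonneg_left (hB n) (show 0 ≤ q ^ n by positivity)
  linarith

namespace Til
variable {T : Set (Set ℂ)} (hT : Til T)
include hT

lemma corE_finite (x : ℂ) : (corE T x).Finite := (hT.cor_finite x).subset corE_sub

lemma mem_corE_mot {g : Mot} {x y : ℂ} (hg : g • x = y) (h : g • cor T x = cor T y) {P : Set ℂ} :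
    g • P ∈ corE T y ↔ P ∈ corE T x := by
  have h1 := mem_cor_mot h (P := P)
  constructor
  · intro hP
    have := (mem_ext_mot g P x).1 (hg ▸ hP.2)
    exact ⟨(h1.1 (corE_sub hP)).1, this⟩
  · intro hP
    exact ⟨(h1.2 (corE_sub hP)).1, hg ▸ (mem_ext_mot g P x).2 hP.2⟩

lemma sum_mot {g : Mot} {x y : ℂ} (hg : g • x = y) (h : g • cor T x = cor T y)
    {w : Set ℂ → ℂ → ℝ} (hw : ∀ (g : Mot) P x, w (g • P) (g • x) = w P x) :
    ∑ P ∈ (hT.corE_finite y).toFinset, w P y = ∑ P ∈ (hT.corE_finite x).toFinset, w P x := by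
  symm
  refine Finset.sum_bij' (fun P _ => g • P) (fun P _ => g⁻¹ • P) ?_ ?_ ?_ ?_ ?_
  · intro P hP
    simp only [Finite.mem_toFinset] at hP ⊢
    exact (hT.mem_corE_mot hg h).2 hP
  · intro P hP
    simp only [Finite.mem_toFinset] at hP ⊢
    rw [← hT.mem_corE_mot hg h, smul_inv_smul]; exact hP
  · intro P _; simp
  · intro P _; simp
  · intro P _; rw [← hg, hw]

lemma mtp_step {x0 : ℂ} (h0 : x0 ∈ V T) {w : Set ℂ → ℂ → ℝ}
    (hw : ∀ (g : Mot) P x, w (g • P) (g • x) = w P x)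
    (hs : ∀ P (hP : P ∈ T), ∑ x ∈ (hT.poly P hP).fin.toFinset, w P x = 0)
    {D : ℝ} (hD0 : 0 < D) (hD : ∀ P ∈ T, ∀ p ∈ P, ∀ q ∈ P, dist p q ≤ D) {R : ℝ} (hR : 0 ≤ R)
    (hfin : (V T ∩ Metric.closedBall 0 R).Finite) (hfin' : (V T ∩ Metric.closedBall 0 (R + D)).Finite) :
    |∑ P ∈ (hT.corE_finite x0).toFinset, w P x0| * ((V T ∩ Metric.closedBall 0 (R + D)).ncard : ℝ) ≤
    (∑ P ∈ (hT.corE_finite x0).toFinset, |w P x0|) *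
      (((V T ∩ Metric.closedBall 0 (R + D)).ncard : ℝ) - (V T ∩ Metric.closedBall 0 R).ncard) := by
  classical
  have hRD : 0 ≤ R + D := by linarith
  set S := hfin'.toFinset with hS
  set S0 := hfin.toFinset with hS0
  set F := (hT.tiles_finite 0 hRD).toFinset with hF
  have hsub : S0 ⊆ S := by
    intro x hx
    simp only [hS0, hS, Finite.mem_toFinset, mem_inter_iff, Metric.mem_closedBall] at hx ⊢
    exact ⟨hx.1, by linarith [hx.2]⟩
  have key : ∀ x ∈ S, (hT.corE_finite x).toFinset = F.filter fun P => x ∈ ext P := by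
    intro x hx
    ext P
    simp only [hS, hF, Finite.mem_toFinset, Finset.mem_filter] at hx ⊢
    constructor
    · intro h; exact ⟨⟨h.1, x, extremePoints_subset h.2, hx.2⟩, h.2⟩
    · intro h; exact ⟨h.1.1, h.2⟩
  have inv : ∀ {w : Set ℂ → ℂ → ℝ}, (∀ (g : Mot) P x, w (g • P) (g • x) = w P x) → ∀ x ∈ S,
      ∑ P ∈ (hT.corE_finite x).toFinset, w P x = ∑ P ∈ (hT.corE_finite x0).toFinset, w P x0 := by
    intro w hw x hx
    simp only [hS, Finite.mem_toFinset] at hx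
    obtain ⟨g, hg, hgc⟩ := hT.mono x0 h0 x hx.1
    exact hT.sum_mot hg hgc hw
  have sw : ∀ (w : Set ℂ → ℂ → ℝ) (A : Finset ℂ), A ⊆ S →
      ∑ x ∈ A, ∑ P ∈ (hT.corE_finite x).toFinset, w P x =
      ∑ P ∈ F, ∑ x ∈ A, if x ∈ ext P then w P x else 0 := by
    intro w A hA
    rw [Finset.sum_comm]
    refine Finset.sum_congr rfl fun x hx => ?_
    rw [key x (hA hx), Finset.sum_filter]
  rw [ncard_eq_toFinset_card _ hfin', ncard_eq_toFinset_card _ hfin]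
  change _ * (S.card : ℝ) ≤ _ * ((S.card : ℝ) - S0.card)
  have e1 : ∑ x ∈ S, ∑ P ∈ (hT.corE_finite x).toFinset, w P x =
      S.card * ∑ P ∈ (hT.corE_finite x0).toFinset, w P x0 := by
    rw [Finset.sum_congr rfl (inv hw), Finset.sum_const, nsmul_eq_mul]
  have hwa : ∀ (g : Mot) P x, |w (g • P) (g • x)| = |w P x| := fun g P x => by rw [hw]
  have e2 : ∑ x ∈ S \ S0, ∑ P ∈ (hT.corE_finite x).toFinset, |w P x| =
      (S \ S0).card * ∑ P ∈ (hT.corE_finite x0).toFinset, |w P x0| := by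
    rw [Finset.sum_congr rfl fun x hx => inv (w := fun P x => |w P x|) hwa x
      (Finset.sdiff_subset hx), Finset.sum_const, nsmul_eq_mul]
  have e3 : ((S \ S0).card : ℝ) = S.card - S0.card := by
    rw [Finset.card_sdiff_of_subset hsub, Nat.cast_sub (Finset.card_le_card hsub)]
  rw [← e3, mul_comm _ ((S \ S0).card : ℝ), ← e2, mul_comm, ← abs_of_nonneg (Nat.cast_nonneg S.card (α := ℝ)),
    ← abs_mul, ← e1, sw _ _ subset_rfl, sw (fun P x => |w P x|) _ Finset.sdiff_subset]
  refine (Finset.abs_sum_le_sum_abs _ _).trans (Finset.sum_le_sum fun P hP => ?_)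
  have hPT : P ∈ T := by
    simp only [hF, Finite.mem_toFinset] at hP; exact hP.1
  by_cases hsubs : ∀ x ∈ ext P, x ∈ S
  · have : ∑ x ∈ S, (if x ∈ ext P then w P x else 0) = 0 := by
      rw [← Finset.sum_filter, ← hs P hPT]
      refine Finset.sum_congr ?_ fun _ _ => rfl
      ext x
      simp only [Finset.mem_filter, Finite.mem_toFinset]
      exact ⟨fun h => h.2, fun h => ⟨hsubs x h, h⟩⟩
    rw [this, abs_zero]
    exact Finset.sum_nonneg fun x _ => by split_ifs <;> positivity
  · push Not at hsubs
    obtain ⟨y, hy, hyS⟩ := hsubs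
    have hy' : R + D < dist y 0 := by
      by_contra hcon
      push Not at hcon
      apply hyS
      simp only [hS, Finite.mem_toFinset]
      exact ⟨⟨P, hPT, hy⟩, hcon⟩
    have : ∑ x ∈ S, (if x ∈ ext P then w P x else 0) = ∑ x ∈ S \ S0, (if x ∈ ext P then w P x else 0) := by
      symm
      refine Finset.sum_subset Finset.sdiff_subset fun x hx hx' => ?_
      rw [if_neg]
      intro hxP
      have h1 := hD P hPT y (extremePoints_subset hy) x (extremePoints_subset hxP)
      have hx0 : x ∈ S0 := by
        by_contra h; exact hx' (Finset.mem_sdiff.2 ⟨hx, h⟩)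
      simp only [hS0, Finite.mem_toFinset, mem_inter_iff, Metric.mem_closedBall] at hx0
      have := dist_triangle y x 0
      linarith [hx0.2]
    rw [this]
    refine (Finset.abs_sum_le_sum_abs _ _).trans (Finset.sum_le_sum fun x _ => ?_)
    split_ifs <;> simp

theorem mtp {x0 : ℂ} (h0 : x0 ∈ V T) {w : Set ℂ → ℂ → ℝ}
    (hw : ∀ (g : Mot) P x, w (g • P) (g • x) = w P x)
    (hs : ∀ P (hP : P ∈ T), ∑ x ∈ (hT.poly P hP).fin.toFinset, w P x = 0) :
    ∑ P ∈ (hT.corE_finite x0).toFinset, w P x0 = 0 := by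
  by_contra hne
  obtain ⟨a, D, M, ha, hD, hb⟩ := hT.bounds
  obtain ⟨A, B, hV⟩ := hT.V_growth
  set W := ∑ P ∈ (hT.corE_finite x0).toFinset, w P x0
  set C := ∑ P ∈ (hT.corE_finite x0).toFinset, |w P x0|
  have hWC : |W| ≤ C := Finset.abs_sum_le_sum_abs _ _
  have hWp : 0 < |W| := abs_pos.2 hne
  have hC : 0 < C := by linarith
  have hpos : ∀ n : ℕ, 0 ≤ ‖x0‖ + n * D := fun n => by positivity
  refine growth_aux (f := fun n : ℕ => ((V T ∩ Metric.closedBall 0 (‖x0‖ + n * D)).ncard : ℝ))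
    (q := 1 - |W| / C) (A := A * D ^ 2) (B := (‖x0‖ + B) / D) ?_ ?_ ?_ ?_ ?_
  · have := (div_le_one hC).2 hWC; linarith
  · have : 0 < |W| / C := by positivity
    linarith
  · have : 0 < (V T ∩ Metric.closedBall 0 (‖x0‖ + (0 : ℕ) * D)).ncard := by
      rw [ncard_pos (hV _ (hpos 0)).1]
      exact ⟨x0, h0, by simp⟩
    exact_mod_cast this
  · intro n
    have e : ‖x0‖ + (n : ℝ) * D + D = ‖x0‖ + ((n + 1 : ℕ) : ℝ) * D := by push_cast; ring
    have := hT.mtp_step h0 hw hs hD (fun P hP => (hb P hP).2.1) (hpos n) (hV _ (hpos n)).1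
      (e ▸ (hV _ (hpos (n + 1))).1)
    rw [e] at this
    change |W| * _ ≤ C * _ at this
    set N := ((V T ∩ Metric.closedBall 0 (‖x0‖ + ((n + 1 : ℕ) : ℝ) * D)).ncard : ℝ)
    have h2 : |W| / C * N ≤ N - (V T ∩ Metric.closedBall 0 (‖x0‖ + (n : ℝ) * D)).ncard := by
      rw [div_mul_eq_mul_div, div_le_iff₀ hC]; linarith
    linarith
  · intro n
    refine (hV _ (hpos n)).2.trans (le_of_eq ?_)
    field_simp
    ring

end Til
end MC

namespace MC
open MeasureTheory
open scoped Pointwise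

/-- pointed equivalence of tiles -/
def peq (P : Set ℂ) (x : ℂ) (Q : Set ℂ) (y : ℂ) : Prop := ∃ g : Mot, g • P = Q ∧ g • x = y
def cong (P Q : Set ℂ) : Prop := ∃ g : Mot, g • P = Q

lemma peq.refl (P : Set ℂ) (x : ℂ) : peq P x P x := ⟨1, by simp⟩
lemma peq.symm {P Q : Set ℂ} {x y : ℂ} (h : peq P x Q y) : peq Q y P x := by
  obtain ⟨g, rfl, rfl⟩ := h
  exact ⟨g⁻¹, by simp⟩
lemma peq.trans {P Q R : Set ℂ} {x y z : ℂ} (h : peq P x Q y) (h' : peq Q y R z) : peq P x R z := by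
  obtain ⟨g, rfl, rfl⟩ := h
  obtain ⟨g', rfl, rfl⟩ := h'
  exact ⟨g' * g, by simp [mul_smul]⟩
lemma peq.cong {P Q : Set ℂ} {x y : ℂ} (h : peq P x Q y) : cong P Q := ⟨h.choose, h.choose_spec.1⟩
lemma peq.mot (g : Mot) (P : Set ℂ) (x : ℂ) : peq P x (g • P) (g • x) := ⟨g, rfl, rfl⟩
lemma cong.refl (P : Set ℂ) : cong P P := ⟨1, by simp⟩
lemma cong.symm {P Q : Set ℂ} (h : cong P Q) : cong Q P := by
  obtain ⟨g, rfl⟩ := h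
  exact ⟨g⁻¹, by simp⟩
lemma cong.trans {P Q R : Set ℂ} (h : cong P Q) (h' : cong Q R) : cong P R := by
  obtain ⟨g, rfl⟩ := h
  obtain ⟨g', rfl⟩ := h'
  exact ⟨g' * g, by simp [mul_smul]⟩
lemma cong.mot (g : Mot) (P : Set ℂ) : cong P (g • P) := ⟨g, rfl⟩
lemma cong.ncard {P Q : Set ℂ} (h : cong P Q) : (ext P).ncard = (ext Q).ncard := by
  obtain ⟨g, rfl⟩ := h; rw [ncard_ext_mot]
lemma peq.ext {P Q : Set ℂ} {x y : ℂ} (h : peq P x Q y) : x ∈ ext P ↔ y ∈ ext Q := by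
  obtain ⟨g, rfl, rfl⟩ := h; rw [mem_ext_mot]
lemma peq.nx {P Q : Set ℂ} {x y : ℂ} (hP : Poly P) (hx : x ∈ MC.ext P) (h : peq P x Q y) :
    peq P (nx P x) Q (nx Q y) := by
  obtain ⟨g, rfl, rfl⟩ := h
  exact ⟨g, rfl, (hP.nx_mot g (extremePoints_subset hx) (hP.ext_not_int hx)).symm⟩
lemma peq.pv {P Q : Set ℂ} {x y : ℂ} (hP : Poly P) (hx : x ∈ MC.ext P) (h : peq P x Q y) :
    peq P (pv P x) Q (pv Q y) := by
  obtain ⟨g, rfl, rfl⟩ := h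
  exact ⟨g, rfl, (hP.pv_mot g (extremePoints_subset hx) (hP.ext_not_int hx)).symm⟩

/-- all corners are equivalent -/
def Rg (P : Set ℂ) : Prop := ∀ y ∈ ext P, ∀ z ∈ ext P, peq P y P z

lemma Rg.mot {P : Set ℂ} (h : Rg P) (g : Mot) : Rg (g • P) := by
  intro y hy z hz
  have hy' : g⁻¹ • y ∈ ext P := by rw [← mem_ext_mot g, smul_inv_smul]; exact hy
  have hz' : g⁻¹ • z ∈ ext P := by rw [← mem_ext_mot g, smul_inv_smul]; exact hz
  have h1 := peq.mot g P (g⁻¹ • y)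
  have h2 := peq.mot g P (g⁻¹ • z)
  rw [smul_inv_smul] at h1 h2
  exact h1.symm.trans ((h _ hy' _ hz').trans h2)

lemma cong.Rg {P Q : Set ℂ} (h : cong P Q) : Rg P ↔ Rg Q := by
  constructor
  · intro hP; obtain ⟨g, rfl⟩ := h; exact hP.mot g
  · intro hP; obtain ⟨g, rfl⟩ := h.symm; exact hP.mot g

def oo (P : Set ℂ) (x : ℂ) : ℕ := {y ∈ ext P | peq P y P x}.ncard

namespace Poly
variable {P : Set ℂ} (hP : Poly P)
include hP

lemma Rg_of_nx {y : ℂ} (hy : y ∈ ext P) (h : peq P y P (nx P y)) : Rg P := by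
  have : {z ∈ ext P | peq P y P z} = ext P := by
    refine hP.ext_closed' (O := {z ∈ ext P | peq P y P z}) (fun z hz => hz.1)
      ⟨y, hy, peq.refl _ _⟩ fun z hz => ?_
    exact ⟨hP.nx_ext hz.1, h.trans (peq.nx hP hy hz.2)⟩
  intro a ha b hb
  rw [← this] at ha hb
  exact ha.2.symm.trans hb.2

lemma oo_Rg {x : ℂ} (hx : x ∈ ext P) (h : Rg P) : oo P x = (ext P).ncard := by
  unfold oo; congr 1; ext y
  exact ⟨fun h => h.1, fun hy => ⟨hy, h y hy x hx⟩⟩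

lemma oo_pos {x : ℂ} (hx : x ∈ ext P) : 1 ≤ oo P x := by
  unfold oo
  rw [Nat.one_le_iff_ne_zero, ← Nat.pos_iff_ne_zero, ncard_pos (hP.fin.subset fun y hy => hy.1)]
  exact ⟨x, hx, peq.refl _ _⟩

lemma oo_le {x : ℂ} (hx : x ∈ ext P) (h : ¬ Rg P) : oo P x + 2 ≤ (ext P).ncard := by
  have h1 : {y ∈ ext P | peq P y P x} ⊆ ext P \ {nx P x, pv P x} := by
    rintro y ⟨hy, hp⟩
    refine ⟨hy, ?_⟩
    rintro (rfl | rfl)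
    · exact h (hP.Rg_of_nx hx hp.symm)
    · refine h (hP.Rg_of_nx hy ?_)
      rw [hP.nx_pv hx]; exact hp
  have h2 := ncard_le_ncard h1 (hP.fin.subset sdiff_subset)
  have h3 : ({nx P x, pv P x} : Set ℂ) ⊆ ext P := by
    rintro y (rfl | rfl)
    exacts [hP.nx_ext hx, hP.pv_ext hx]
  rw [ncard_sdiff h3 (toFinite _), ncard_pair (hP.nx_ne_pv hx)] at h2
  have := hP.three_le
  unfold oo
  omega

end Poly

open Classical in
def wt (P : Set ℂ) (x : ℂ) : ℝ := if x ∈ ext P then 1 / ((ext P).ncard : ℝ) else 0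

namespace Til
variable {T : Set (Set ℂ)} (hT : Til T)
include hT

open Classical in
lemma sum_corE (x : ℂ) (f : Set ℂ → ℝ) : ∑ P ∈ (hT.corE_finite x).toFinset, f P =
    ∑ P ∈ (hT.cor_finite x).toFinset, if x ∈ ext P then f P else 0 := by
  rw [← Finset.sum_filter]
  refine Finset.sum_congr ?_ fun _ _ => rfl
  ext P
  simp only [Finite.mem_toFinset, Finset.mem_filter]
  exact ⟨fun h => ⟨corE_sub h, h.2⟩, fun h => ⟨h.1.1, h.2⟩⟩

theorem N1 {x : ℂ} (hx : x ∈ V T) :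
    ∑ P ∈ (hT.cor_finite x).toFinset, wt P x = ((cor T x).ncard : ℝ) / 2 - 1 := by
  classical
  have h := hT.mtp hx (w := fun P x => mu P x - (Real.pi / 2 - Real.pi / (ext P).ncard))
    (fun g P x => by rw [mu_mot, ncard_ext_mot]) (by
      intro P hP
      rw [Finset.sum_sub_distrib, (hT.poly P hP).sum_mu, Finset.sum_const, nsmul_eq_mul,
        ← ncard_eq_toFinset_card _ (hT.poly P hP).fin]
      have h3 := (hT.poly P hP).three_le
      have : ((ext P).ncard : ℝ) ≠ 0 := by
        have : 0 < (ext P).ncard := by omega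
        positivity
      field_simp
      ring)
  rw [hT.sum_corE] at h
  have h2 := hT.sum_eq x
  have h3 : ∀ P ∈ (hT.cor_finite x).toFinset,
      (if x ∈ ext P then mu P x - (Real.pi / 2 - Real.pi / (ext P).ncard) else 0) =
      mu P x - Real.pi / 2 + Real.pi * wt P x := by
    intro P hP
    simp only [Finite.mem_toFinset] at hP
    unfold wt
    split_ifs with h
    · ring
    · rw [(hT.poly P hP.1).mu_straight hP.2 (hT.vnotint hx hP.1) h]; ring
  rw [Finset.sum_congr rfl h3, Finset.sum_add_distrib, Finset.sum_sub_distrib, h2, Finset.sum_const,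
    nsmul_eq_mul, ← ncard_eq_toFinset_card _ (hT.cor_finite x), ← Finset.mul_sum] at h
  have : Real.pi * (∑ P ∈ (hT.cor_finite x).toFinset, wt P x - (((cor T x).ncard : ℝ) / 2 - 1)) = 0 := by
    linarith
  have := (mul_eq_zero.1 this).resolve_left Real.pi_ne_zero
  linarith

lemma one_straight {x : ℂ} (hx : x ∈ V T) {P Q : Set ℂ} (hP : P ∈ cor T x) (hQ : Q ∈ cor T x)
    (hne : P ≠ Q) : x ∈ ext P ∨ x ∈ ext Q := by
  classical
  by_contra hcon
  push Not at hcon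
  obtain ⟨R, hR, hxR⟩ := hx
  have hx : x ∈ V T := ⟨R, hR, hxR⟩
  have h := hT.sum_le (x := x) {P, Q, R} (by
    intro S hS
    simp only [Finset.mem_insert, Finset.mem_singleton] at hS
    rcases hS with rfl | rfl | rfl
    exacts [hP, hQ, ⟨hR, extremePoints_subset hxR⟩])
  have hPR : P ≠ R := by rintro rfl; exact hcon.1 hxR
  have hQR : Q ≠ R := by rintro rfl; exact hcon.2 hxR
  rw [Finset.sum_insert (by simp [hne, hPR]), Finset.sum_insert (by simp [hQR]),
    Finset.sum_singleton, (hT.poly P hP.1).mu_straight hP.2 (hT.vnotint hx hP.1) hcon.1,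
    (hT.poly Q hQ.1).mu_straight hQ.2 (hT.vnotint hx hQ.1) hcon.2] at h
  have := (hT.poly R hR).mu_pos (extremePoints_subset hxR)
  linarith

open Classical in
theorem N2 {x : ℂ} {Q : Set ℂ} (hQ : Q ∈ corE T x) :
    (ext Q).ncard * (∑ P ∈ (hT.cor_finite x).toFinset, if peq P x Q x then 1 else 0) =
    oo Q x * ∑ P ∈ (hT.cor_finite x).toFinset, if x ∈ ext P ∧ cong P Q then 1 else 0 := by
  have hx : x ∈ V T := ⟨Q, hQ.1, hQ.2⟩
  have inv1 : ∀ (g : Mot) P y, peq (g • P) (g • y) Q x ↔ peq P y Q x := fun g P y =>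
    ⟨fun h => (peq.mot g P y).trans h, fun h => (peq.mot g P y).symm.trans h⟩
  have inv2 : ∀ (g : Mot) P, cong (g • P) Q ↔ cong P Q := fun g P =>
    ⟨fun h => (cong.mot g P).trans h, fun h => (cong.mot g P).symm.trans h⟩
  have h := hT.mtp hx (w := fun P y => ((ext Q).ncard : ℝ) * (if peq P y Q x then 1 else 0) -
      (oo Q x) * (if cong P Q then 1 else 0))
    (fun g P y => by simp only [inv1, inv2]) (by
      intro P hP
      rw [Finset.sum_sub_distrib, ← Finset.mul_sum, Finset.sum_const, nsmul_eq_mul,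
        ← ncard_eq_toFinset_card _ (hT.poly P hP).fin]
      by_cases hc : cong P Q
      · have e : ∑ y ∈ (hT.poly P hP).fin.toFinset, (if peq P y Q x then (1 : ℝ) else 0) = oo Q x := by
          rw [Finset.sum_boole, oo]
          congr 1
          rw [← ncard_coe_finset]
          obtain ⟨g, hg⟩ := hc
          rw [← ncard_image_of_injective _ (MulAction.injective g)]
          congr 1
          ext z
          simp only [Finset.coe_filter, Finite.mem_toFinset, mem_image, mem_ofPred_eq]
          constructor
          · rintro ⟨y, ⟨hy, hp⟩, rfl⟩
            have hm := peq.mot g P y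
            rw [hg] at hm
            refine ⟨?_, hm.symm.trans hp⟩
            have := (mem_ext_mot g P y).2 hy
            rwa [hg] at this
          · rintro ⟨hz, hp⟩
            refine ⟨g⁻¹ • z, ⟨?_, ?_⟩, by simp⟩
            · change g⁻¹ • z ∈ ext P
              rw [← mem_ext_mot g, hg, smul_inv_smul]; exact hz
            · have hm := peq.mot g P (g⁻¹ • z)
              rw [hg, smul_inv_smul] at hm
              exact hm.trans hp
        rw [e, if_pos hc, ← hc.ncard]
        simp only [ext]; ring
      · have e : ∀ y ∈ (hT.poly P hP).fin.toFinset, (if peq P y Q x then (1 : ℝ) else 0) = 0 :=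
          fun y _ => if_neg fun h => hc h.cong
        rw [Finset.sum_congr rfl e, if_neg hc]; simp)
  rw [hT.sum_corE] at h
  have h3 : ∀ P ∈ (hT.cor_finite x).toFinset, (if x ∈ ext P then
      ((ext Q).ncard : ℝ) * (if peq P x Q x then 1 else 0) -
      (oo Q x) * (if cong P Q then 1 else 0) else 0) =
      ((ext Q).ncard : ℝ) * (if peq P x Q x then 1 else 0) -
        oo Q x * (if x ∈ ext P ∧ cong P Q then 1 else 0) := by
    intro P _
    by_cases h : x ∈ ext P
    · simp [h]
    · have : ¬ peq P x Q x := fun hp => h (hp.ext.2 hQ.2)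
      simp [h, this]
  rw [Finset.sum_congr rfl h3, Finset.sum_sub_distrib, ← Finset.mul_sum, ← Finset.mul_sum, sub_eq_zero] at h
  exact_mod_cast h

end Til
end MC

namespace MC
open MeasureTheory
open scoped Pointwise

lemma cyc {α : Type*} {f : α → α} {S : Set α} (hfin : S.Finite) (hb : BijOn f S S)
    (hc : ∀ O ⊆ S, O.Nonempty → (∀ a ∈ O, f a ∈ O) → O = S) {x : α} (hx : x ∈ S) :
    Function.minimalPeriod f x = S.ncard ∧ S = (fun n => f^[n] x) '' (Iio S.ncard) := by
  have hit : ∀ n, f^[n] x ∈ S := by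
    intro n
    induction n with
    | zero => exact hx
    | succ n ih => rw [Function.iterate_succ_apply']; exact hb.mapsTo ih
  have horb : {y | ∃ n, f^[n] x = y} = S := by
    apply hc
    · rintro y ⟨n, rfl⟩; exact hit n
    · exact ⟨x, 0, rfl⟩
    · rintro y ⟨n, rfl⟩; exact ⟨n + 1, Function.iterate_succ_apply' _ _ _⟩
  have hper : x ∈ Function.periodicPts f := by
    have : ¬ InjOn (fun n => f^[n] x) (univ : Set ℕ) := by
      intro h
      exact infinite_univ (hfin.of_injOn (f := fun n => f^[n] x) (fun n _ => hit n) h)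
    simp only [InjOn, not_forall, mem_univ] at this
    obtain ⟨i, _, j, _, hij, hne⟩ := this
    have key : ∀ i j : ℕ, i < j → f^[i] x = f^[j] x → x ∈ Function.periodicPts f := by
      intro i
      induction i with
      | zero => intro j hj h; exact ⟨j, hj, h.symm⟩
      | succ i ih =>
        intro j hj h
        obtain ⟨j, rfl⟩ : ∃ l, j = l + 1 := ⟨j - 1, by omega⟩
        rw [Function.iterate_succ_apply', Function.iterate_succ_apply'] at h
        exact ih j (by omega) (hb.injOn (hit _) (hit _) h)
    rcases lt_or_gt_of_ne hne with h | h
    · exact key i j h hij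
    · exact key j i h hij.symm
  have e : S = (fun n => f^[n] x) '' (Iio (Function.minimalPeriod f x)) := by
    rw [← horb]
    ext y
    constructor
    · rintro ⟨n, rfl⟩
      exact ⟨n % Function.minimalPeriod f x,
        Nat.mod_lt _ (Function.minimalPeriod_pos_of_mem_periodicPts hper),
        Function.iterate_mod_minimalPeriod_eq⟩
    · rintro ⟨n, _, rfl⟩; exact ⟨n, rfl⟩
  have e2 : S.ncard = Function.minimalPeriod f x := by
    conv_lhs => rw [e, ncard_image_of_injOn Function.iterate_injOn_Iio_minimalPeriod]
    rw [ncard_eq_toFinset_card']; simp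
  refine ⟨e2.symm, ?_⟩
  rw [e2]; exact e

def sq (T : Set (Set ℂ)) (x : ℂ) (P : Set ℂ) (i : ℕ) : Set ℂ := (sc T x)^[i] P

lemma sq_zero (T : Set (Set ℂ)) (x : ℂ) (P : Set ℂ) : sq T x P 0 = P := rfl
lemma sq_succ (T : Set (Set ℂ)) (x : ℂ) (P : Set ℂ) (i : ℕ) : sq T x P (i + 1) = sc T x (sq T x P i) :=
  Function.iterate_succ_apply' _ _ _
lemma sq_add (T : Set (Set ℂ)) (x : ℂ) (P : Set ℂ) (i j : ℕ) :
    sq T x P (i + j) = sq T x (sq T x P j) i := Function.iterate_add_apply _ _ _ _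

lemma rot_mul (g h : Mot) : rot (g * h) = rot g * rot h := by
  have : rot (g * h) = g • (h • (1 : ℂ)) - g • (h • (0 : ℂ)) := by rw [rot, mul_smul, mul_smul]
  rw [this, smul_sub']; rfl

lemma rot_one : rot 1 = 1 := by simp [rot]

lemma rot_inv (g : Mot) : rot g⁻¹ = (rot g)⁻¹ := by
  have := rot_mul g⁻¹ g
  rw [inv_mul_cancel, rot_one] at this
  exact eq_inv_of_mul_eq_one_left this.symm

lemma rot_pow (g : Mot) (n : ℕ) : rot (g ^ n) = rot g ^ n := by
  induction n with
  | zero => simp [rot_one]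
  | succ n ih => rw [pow_succ, rot_mul, ih, pow_succ]

lemma mot_eq_of_rot {g h : Mot} {x : ℂ} (hr : rot g = rot h) (hx : g • x = h • x) : g = h := by
  refine mot_ext (x := x) (y := x + 1) (by simp) hx ?_
  have h1 := smul_sub' g (x + 1) x
  have h2 := smul_sub' h (x + 1) x
  rw [hr, ← h2, hx] at h1
  exact sub_left_injective h1

/-- fixing a point and a pointed tile determines the motion -/
lemma mot_one_of_fix {P : Set ℂ} (hP : Poly P) {x : ℂ} (hx : x ∈ P) (hi : x ∉ interior P) {g : Mot}
    (hg : g • x = x) (hgP : g • P = P) : g = 1 := by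
  have h := hP.nx_mot g hx hi
  rw [hg, hgP] at h
  exact mot_ext (hP.nx_spec hi).2.1 (by rw [one_smul]; exact h.symm) (by rw [one_smul]; exact hg)

lemma root_unique {u w : ℂ} {m : ℕ} (hm : m = 3 ∨ m = 4) (hu : u ^ m = 1) (hw : w ^ m = 1)
    (iu : 0 < u.im) (iw : 0 < w.im) : u = w := by
  rcases hm with rfl | rfl
  · have key : ∀ u : ℂ, u ^ 3 = 1 → 0 < u.im → u.re = -1/2 ∧ u.im ^ 2 = 3/4 := by
      intro u hu iu
      have h1 : (u - 1) * (u ^ 2 + u + 1) = 0 := by linear_combination hu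
      have h2 : u - 1 ≠ 0 := by
        intro h
        have := congrArg Complex.im h
        simp at this; linarith
      have h3 := (mul_eq_zero.1 h1).resolve_left h2
      have e1 := congrArg Complex.re h3
      have e2 := congrArg Complex.im h3
      simp [pow_two] at e1 e2
      have h4 : u.im * (2 * u.re + 1) = 0 := by linarith
      have h5 := (mul_eq_zero.1 h4).resolve_left iu.ne'
      have h6 : u.re = -1/2 := by linarith
      rw [h6] at e1
      exact ⟨h6, by linarith⟩
    obtain ⟨a, b⟩ := key u hu iu
    obtain ⟨c, d⟩ := key w hw iw
    apply Complex.ext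
    · rw [a, c]
    · nlinarith
  · have key : ∀ u : ℂ, u ^ 4 = 1 → 0 < u.im → u = Complex.I := by
      intro u hu iu
      have h1 : (u - 1) * ((u + 1) * ((u + Complex.I) * (u - Complex.I))) = 0 := by
        linear_combination hu + (1 - u ^ 2) * Complex.I_sq
      rcases mul_eq_zero.1 h1 with h | h
      · have := congrArg Complex.im h
        simp at this; linarith
      rcases mul_eq_zero.1 h with h | h
      · have := congrArg Complex.im h
        simp at this; linarith
      rcases mul_eq_zero.1 h with h | h
      · have := congrArg Complex.im h
        simp at this; linarith
      · exact sub_eq_zero.1 h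
    rw [key u hu iu, key w hw iw]

/-- the generating rotation of a regular tile -/
lemma Poly.Rg_gen {P : Set ℂ} (hP : Poly P) (hR : Rg P) {x : ℂ} (hx : x ∈ ext P) :
    ∃ g : Mot, (∀ n, (nx P)^[n] x = g ^ n • x) ∧ rot g ^ (ext P).ncard = 1 ∧ 0 < (rot g).im ∧
      g • x = nx P x ∧ g • pv P x = x := by
  obtain ⟨g, hgP, hgx⟩ := hR x hx _ (hP.nx_ext hx)
  have hst : ∀ y ∈ ext P, nx P (g • y) = g • nx P y := by
    intro y hy
    have := hP.nx_mot g (extremePoints_subset hy) (hP.ext_not_int hy)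
    rwa [hgP] at this
  have hge : ∀ y ∈ ext P, g • y ∈ ext P := by
    intro y hy
    have := (mem_ext_mot g P y).2 hy
    rwa [hgP] at this
  have hcomm : ∀ y ∈ ext P, g • y = nx P y := by
    have : {y ∈ ext P | g • y = nx P y} = ext P := by
      refine hP.ext_closed' (O := {y ∈ ext P | g • y = nx P y}) (fun z hz => hz.1) ⟨x, hx, hgx⟩ ?_
      intro z hz
      refine ⟨hP.nx_ext hz.1, ?_⟩
      rw [← hst z hz.1, hz.2]
    intro y hy
    rw [← this] at hy
    exact hy.2
  have hit : ∀ y ∈ ext P, ∀ n, (nx P)^[n] y = g ^ n • y := by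
    intro y hy n
    induction n with
    | zero => simp
    | succ n ih =>
      rw [Function.iterate_succ_apply', ← hcomm _ (hP.iter_ext hy n), ih, pow_succ', mul_smul]
  have hpow : g ^ (ext P).ncard = 1 := by
    refine mot_ext (hP.nx_ne hx) ?_ ?_
    · rw [← hit _ (hP.nx_ext hx), hP.iter_card (hP.nx_ext hx), one_smul]
    · rw [← hit _ hx, hP.iter_card hx, one_smul]
  refine ⟨g, hit x hx, ?_, ?_, hgx, ?_⟩
  · rw [← rot_pow, hpow, rot_one]
  · have h1 := hP.pos (hP.nx_ext hx)
    rw [hP.pv_nx hx, ← hcomm _ (hP.nx_ext hx)] at h1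
    nth_rw 2 [← hgx] at h1
    rw [smul_sub'] at h1
    have e : cr (rot g * (nx P x - x)) (x - nx P x) = (rot g).im * ((nx P x - x).re ^ 2 + (nx P x - x).im ^ 2) := by
      simp only [cr, Complex.mul_re, Complex.mul_im, Complex.sub_re, Complex.sub_im]; ring
    rw [e] at h1
    exact pos_of_mul_pos_left h1 (by positivity)
  · rw [hcomm _ (hP.pv_ext hx), hP.nx_pv hx]

lemma Poly.Rg_dist {P : Set ℂ} (hP : Poly P) (hR : Rg P) {x : ℂ} (hx : x ∈ ext P) :
    dist (pv P x) x = dist (nx P x) x := by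
  obtain ⟨g, _, _, _, h1, h2⟩ := hP.Rg_gen hR hx
  rw [← mot_dist g (pv P x) x, h1, h2, dist_comm]

lemma REG {P Q : Set ℂ} (hP : Poly P) (hQ : Poly Q) (rP : Rg P) (rQ : Rg Q)
    (hm : (ext P).ncard = (ext Q).ncard) (h34 : (ext P).ncard = 3 ∨ (ext P).ncard = 4) {x : ℂ}
    (hxP : x ∈ ext P) (hxQ : x ∈ ext Q) (h : pv P x = nx Q x) : peq P x Q x := by
  obtain ⟨g, g1, g2, g3, g4, g5⟩ := hP.Rg_gen rP hxP
  obtain ⟨k, k1, k2, k3, k4, k5⟩ := hQ.Rg_gen rQ hxQ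
  have hu : rot g = rot k := root_unique h34 g2 (by rw [hm]; exact k2) g3 k3
  have hd : dist (nx P x) x = dist (nx Q x) x := by rw [← hP.Rg_dist rP hxP, h]
  have ha : nx P x - x ≠ 0 := sub_ne_zero.2 (hP.nx_ne hxP)
  have hn : ‖(nx Q x - x) / (nx P x - x)‖ = 1 := by
    rw [norm_div, ← dist_eq_norm, ← dist_eq_norm, hd, div_self]
    rw [dist_ne_zero]; exact hQ.nx_ne hxQ
  set u := (nx Q x - x) / (nx P x - x) with hu'
  set r := mkMot u (x - u * x) hn
  have hrx : r • x = x := by rw [mkMot_smul]; ring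
  have hra : r • nx P x = nx Q x := by
    rw [mkMot_smul]
    have : u * (nx P x - x) = nx Q x - x := div_mul_cancel₀ _ ha
    linear_combination this
  have hrx' : r⁻¹ • x = x := by rw [inv_smul_eq_iff, hrx]
  have hconj : r * g * r⁻¹ = k := by
    refine mot_eq_of_rot (x := x) ?_ ?_
    · rw [rot_mul, rot_mul, rot_inv, hu, mul_comm (rot r), mul_assoc, mul_inv_cancel₀ (rot_ne r), mul_one]
    · rw [mul_smul, mul_smul, hrx', g4, hra, k4]
  have hext : ext Q = r • ext P := by
    rw [← hQ.orbit hxQ, ← hP.orbit hxP]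
    have key : ∀ n, (nx Q)^[n] x = r • (nx P)^[n] x := by
      intro n
      rw [k1, g1, ← hconj, conj_pow, mul_smul, mul_smul, hrx']
    ext y
    constructor
    · rintro ⟨n, rfl⟩
      rw [key]
      exact smul_mem_smul_set ⟨n, rfl⟩
    · rintro ⟨_, ⟨n, rfl⟩, rfl⟩
      exact ⟨n, key n⟩
  refine ⟨r, ?_, hrx⟩
  have h1 := (hP.mot r).hull
  have h2 := hQ.hull
  have h3 := ext_mot r P
  unfold ext at *
  rw [h3, ← hext, h2] at h1
  exact h1.symm

namespace Til
variable {T : Set (Set ℂ)} (hT : Til T)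
include hT

lemma sq_mem {x : ℂ} (hx : x ∈ V T) {P : Set ℂ} (hP : P ∈ cor T x) (i : ℕ) : sq T x P i ∈ cor T x := by
  induction i with
  | zero => exact hP
  | succ i ih => rw [sq_succ]; exact (hT.sc_bij hx).mapsTo ih

lemma sq_cyc {x : ℂ} (hx : x ∈ V T) {P : Set ℂ} (hP : P ∈ cor T x) :
    Function.minimalPeriod (sc T x) P = (cor T x).ncard ∧
    cor T x = (fun n => sq T x P n) '' (Iio (cor T x).ncard) :=
  cyc (hT.cor_finite x) (hT.sc_bij hx) (fun _ h1 h2 h3 => hT.sc_cycle hx h1 h2 h3) hP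

lemma sq_per {x : ℂ} (hx : x ∈ V T) {P : Set ℂ} (hP : P ∈ cor T x) (i : ℕ) :
    sq T x P (i + (cor T x).ncard) = sq T x P i := by
  rw [sq_add]; congr 1
  rw [← (hT.sq_cyc hx hP).1]
  exact Function.isPeriodicPt_minimalPeriod _ _

lemma sq_inj {x : ℂ} (hx : x ∈ V T) {P : Set ℂ} (hP : P ∈ cor T x) {i j : ℕ}
    (hi : i < (cor T x).ncard) (hj : j < (cor T x).ncard) (h : sq T x P i = sq T x P j) : i = j := by
  rw [← (hT.sq_cyc hx hP).1] at hi hj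
  exact Function.iterate_injOn_Iio_minimalPeriod hi hj h

lemma sq_ex {x : ℂ} (hx : x ∈ V T) {P Q : Set ℂ} (hP : P ∈ cor T x) (hQ : Q ∈ cor T x) :
    ∃ i < (cor T x).ncard, sq T x P i = Q := by
  rw [(hT.sq_cyc hx hP).2] at hQ
  exact hQ

lemma sum_sq {M : Type*} [AddCommMonoid M] {x : ℂ} (hx : x ∈ V T) {P : Set ℂ} (hP : P ∈ cor T x)
    (f : Set ℂ → M) :
    ∑ Q ∈ (hT.cor_finite x).toFinset, f Q = ∑ i ∈ Finset.range (cor T x).ncard, f (sq T x P i) := by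
  symm
  refine Finset.sum_bij (fun i _ => sq T x P i) ?_ ?_ ?_ ?_
  · intro i _; simp only [Finite.mem_toFinset]; exact hT.sq_mem hx hP i
  · intro i hi j hj h
    exact hT.sq_inj hx hP (Finset.mem_range.1 hi) (Finset.mem_range.1 hj) h
  · intro Q hQ
    simp only [Finite.mem_toFinset] at hQ
    obtain ⟨i, hi, h⟩ := hT.sq_ex hx hP hQ
    exact ⟨i, Finset.mem_range.2 hi, h⟩
  · intro i _; rfl

/-- all edges are full when there is no straight corner -/
lemma full (hns : ∀ x ∈ V T, ∀ P ∈ cor T x, x ∈ ext P) {x : ℂ} (hx : x ∈ V T) {P Q : Set ℂ}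
    (h : Sc T x P Q) : pv P x = nx Q x := by
  obtain ⟨hP, hQ, s, hs, e⟩ := h
  have pP := hT.poly P hP.1
  have pQ := hT.poly Q hQ.1
  have xP := hns x hx P hP
  have xQ := hns x hx Q hQ
  rcases lt_trichotomy s 1 with h | h | h
  · exfalso
    have ha : nx Q x ∈ P := by
      have : nx Q x = (1 - s) • x + s • pv P x := by
        rw [← sub_add_cancel (nx Q x) x, e]; module
      rw [this]
      exact pP.cvx hP.2 (extremePoints_subset (pP.pv_ext xP)) (by linarith) hs.le (by ring)
    have hav : nx Q x ∈ ext P := hns _ ⟨Q, hQ.1, pQ.nx_ext xQ⟩ P ⟨hP.1, ha⟩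
    have h1s : 1 - s ≠ 0 := by linarith
    have := Poly.ext_not_seg hav hP.2 (extremePoints_subset (pP.pv_ext xP)) (t := s / (1 - s))
      (div_pos hs (by linarith)) (by
        have : nx Q x = x + s • (pv P x - x) := by rw [← e]; ring
        rw [this]
        match_scalars <;> field_simp <;> ring)
    exact pQ.nx_ne xQ this.1.symm
  · rw [h, one_smul] at e
    exact (sub_left_injective e).symm
  · exfalso
    have ha : pv P x ∈ Q := by
      have : pv P x = (1 - s⁻¹) • x + s⁻¹ • nx Q x := by
        rw [← sub_add_cancel (nx Q x) x, e, smul_add, smul_smul, inv_mul_cancel₀ hs.ne']; module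
      rw [this]
      have := inv_lt_one_of_one_lt₀ h
      exact pQ.cvx hQ.2 (extremePoints_subset (pQ.nx_ext xQ)) (by linarith) (by positivity) (by ring)
    have hav : pv P x ∈ ext Q := hns _ ⟨P, hP.1, pP.pv_ext xP⟩ Q ⟨hQ.1, ha⟩
    have h1s : s - 1 ≠ 0 := by linarith
    have := Poly.ext_not_seg hav hQ.2 (extremePoints_subset (pQ.nx_ext xQ)) (t := 1 / (s - 1))
      (div_pos one_pos (by linarith)) (by
        have : nx Q x = x + s • (pv P x - x) := by rw [← e]; ring
        rw [this]
        match_scalars <;> field_simp <;> ring)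
    exact pP.pv_ne xP this.1.symm

/-- equivalent regular neighbours share a full edge -/
lemma full_reg {x : ℂ} {P Q : Set ℂ} (h : Sc T x P Q) (hx : x ∈ ext P) (hR : Rg P)
    (hpq : peq P x Q x) : pv P x = nx Q x := by
  obtain ⟨hP, hQ, s, hs, e⟩ := h
  have pP := hT.poly P hP.1
  have hd := pP.Rg_dist hR hx
  have hd2 : dist (nx Q x) x = dist (nx P x) x := by
    obtain ⟨g, rfl, hg⟩ := hpq
    have := pP.nx_mot g hP.2 (pP.ext_not_int hx)
    rw [hg] at this
    rw [this]
    nth_rw 2 [← hg]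
    exact mot_dist _ _ _
  rw [← hd, dist_eq_norm, e, norm_smul, dist_eq_norm, Real.norm_of_nonneg hs.le] at hd2
  have hn : ‖pv P x - x‖ ≠ 0 := norm_ne_zero_iff.2 (sub_ne_zero.2 (pP.pv_ne hx))
  have : s = 1 := by
    field_simp at hd2; exact hd2
  rw [this, one_smul] at e
  exact (sub_left_injective e).symm

/-- reversing a full edge -/
lemma rev {x : ℂ} {P Q : Set ℂ} (h : Sc T x P Q) (hP : x ∈ ext P) (hQ : x ∈ ext Q)
    (he : pv P x = nx Q x) : nx Q x ∈ V T ∧ Sc T (nx Q x) Q P ∧ nx P (nx Q x) = x := by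
  have pP := hT.poly P h.1.1
  have pQ := hT.poly Q h.2.1.1
  refine ⟨⟨Q, h.2.1.1, pQ.nx_ext hQ⟩, ⟨⟨h.2.1.1, extremePoints_subset (pQ.nx_ext hQ)⟩,
    ⟨h.1.1, he ▸ extremePoints_subset (pP.pv_ext hP)⟩, 1, one_pos, ?_⟩, ?_⟩
  · rw [pQ.pv_nx hQ, ← he, pP.nx_pv hP, one_smul]
  · rw [← he, pP.nx_pv hP]

lemma same_r {x : ℂ} (hx : x ∈ V T) {P Q Q' : Set ℂ} {r : Mot} (hr : r • x = x)
    (h : Sc T x P Q) (h' : Sc T x (r • P) Q') (hp : peq Q x Q' x) : r • Q = Q' := by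
  obtain ⟨r', hr', hr'x⟩ := hp
  obtain ⟨hP, hQ, s, hs, e⟩ := h
  obtain ⟨hP', hQ', s', hs', e'⟩ := h'
  have iP := hT.vnotint hx hP.1
  have iQ := hT.vnotint hx hQ.1
  have h1 := (hT.poly P hP.1).pv_mot r hP.2 iP
  have h2 := (hT.poly Q hQ.1).nx_mot r' hQ.2 iQ
  rw [hr] at h1
  rw [hr'x, hr'] at h2
  have h3 : r • pv P x - x = rot r * (pv P x - x) := by rw [← smul_sub', hr]
  have h4 : r' • nx Q x - x = rot r' * (nx Q x - x) := by rw [← smul_sub', hr'x]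
  rw [h1, h2, h3, h4, e] at e'
  have hv : pv P x - x ≠ 0 := sub_ne_zero.2 ((hT.poly P hP.1).pv_spec iP).2.1
  have h5 : (rot r' * s : ℂ) = s' * rot r := by
    apply mul_right_cancel₀ hv
    simp only [Complex.real_smul] at e'
    linear_combination e'
  have h6 : s = s' := by
    have := congrArg norm h5
    rw [norm_mul, norm_mul, rot_norm, rot_norm, one_mul, mul_one, Complex.norm_real,
      Complex.norm_real, Real.norm_of_nonneg hs.le, Real.norm_of_nonneg hs'.le] at this
    exact this
  have h7 : rot r = rot r' := by
    rw [← h6, mul_comm] at h5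
    exact (mul_left_cancel₀ (by exact_mod_cast hs.ne') h5).symm
  rw [mot_eq_of_rot (x := x) h7 (by rw [hr, hr'x]), hr']

lemma shift_all {x : ℂ} (hx : x ∈ V T) {P : Set ℂ} (hP : P ∈ cor T x) {r : Mot} (hr : r • x = x)
    {j : ℕ} (hj : r • P = sq T x P j)
    (h : ∀ i < (cor T x).ncard, peq (sq T x P i) x (sq T x P (i + j)) x) :
    r • cor T x = cor T x := by
  have key : ∀ i < (cor T x).ncard, r • sq T x P i = sq T x P (i + j) := by
    intro i
    induction i with
    | zero => intro _; rw [zero_add]; exact hj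
    | succ i ih =>
      intro hi
      have ih := ih (by omega)
      refine hT.same_r hx hr (P := sq T x P i) ?_ ?_ (h _ hi)
      · rw [sq_succ]; exact hT.sc_spec hx (hT.sq_mem hx hP i)
      · rw [ih, show i + 1 + j = (i + j) + 1 by ring, sq_succ]
        exact hT.sc_spec hx (hT.sq_mem hx hP _)
  have hsub : r • cor T x ⊆ cor T x := by
    rintro _ ⟨Q, hQ, rfl⟩
    obtain ⟨i, hi, rfl⟩ := hT.sq_ex hx hP hQ
    change r • _ ∈ _
    rw [key i hi]; exact hT.sq_mem hx hP _
  refine eq_of_subset_of_ncard_le hsub ?_ (hT.cor_finite x)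
  exact (ncard_image_of_injective _ (MulAction.injective r)).ge

end Til
end MC

namespace MC
open MeasureTheory
open scoped Pointwise

open Classical in
/-- combinatorial shadow of a vertex corona -/
structure Wd (k : ℕ) (e R : ℕ → Prop) (m : ℕ → ℕ) (S C : ℕ → ℕ → Prop) : Prop where
  srefl : ∀ i, S i i
  ssymm : ∀ i j, S i j → S j i
  strans : ∀ i j l, S i j → S j l → S i l
  csymm : ∀ i j, C i j → C j i
  ctrans : ∀ i j l, C i j → C j l → C i l
  sc : ∀ i j, S i j → C i j
  se : ∀ i j, S i j → e i → e j
  cm : ∀ i j, C i j → m i = m j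
  cR : ∀ i j, C i j → R i → R j
  rs : ∀ i j, e i → e j → R i → C i j → S i j
  m3 : ∀ i, 3 ≤ m i
  one : ∀ i < k, ∀ j < k, i ≠ j → e i ∨ e j
  n1 : ∑ i ∈ Finset.range k, (if e i then 1 / (m i : ℝ) else 0) = (k : ℝ) / 2 - 1
  n2 : ∀ i, e i → ∃ o, 1 ≤ o ∧ (R i → o = m i) ∧ (¬ R i → o + 2 ≤ m i) ∧
    m i * (∑ l ∈ Finset.range k, if S l i then 1 else 0) =
    o * ∑ l ∈ Finset.range k, if e l ∧ C l i then 1 else 0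
  reg : (∀ i < k, e i) → ∀ i, R i → R (i + 1) → m i = m (i + 1) → (m i = 3 ∨ m i = 4) → S i (i + 1)
  per : ∀ i, S (i + k) i

namespace Wd
variable {k : ℕ} {e R : ℕ → Prop} {m : ℕ → ℕ} {S C : ℕ → ℕ → Prop} (w : Wd k e R m S C)
include w

open Classical in
lemma wle (i : ℕ) : (if e i then 1 / (m i : ℝ) else 0) ≤ 1 / 3 := by
  split_ifs
  · have : (3 : ℝ) ≤ m i := by exact_mod_cast w.m3 i
    exact one_div_le_one_div_of_le (by norm_num) this
  · norm_num

open Classical in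
lemma k_le : k ≤ 6 := by
  have h := Finset.sum_le_sum (s := Finset.range k) fun i _ => w.wle i
  rw [w.n1] at h
  simp only [Finset.sum_const, Finset.card_range, nsmul_eq_mul] at h
  have : (k : ℝ) ≤ 6 := by linarith
  exact_mod_cast this

open Classical in
lemma all_e (hk : 5 ≤ k) : ∀ i < k, e i := by
  intro i hi
  by_contra hcon
  have h := Finset.sum_le_sum (s := (Finset.range k).erase i) fun i _ => w.wle i
  have h2 := Finset.add_sum_erase (Finset.range k) (fun i => if e i then 1 / (m i : ℝ) else 0)
    (Finset.mem_range.2 hi)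
  rw [w.n1] at h2
  simp only [hcon, if_false, zero_add] at h2
  rw [h2] at h
  simp only [Finset.sum_const, nsmul_eq_mul, Finset.card_erase_of_mem (Finset.mem_range.2 hi),
    Finset.card_range] at h
  rw [Nat.cast_sub (by omega)] at h
  have : (5 : ℝ) ≤ k := by exact_mod_cast hk
  push_cast at h
  linarith

open Classical in
lemma tri {i : ℕ} (he : e i) (hm : m i = 3) :
    (R i ∧ (∑ l ∈ Finset.range k, if e l ∧ C l i then 1 else 0) =
        (∑ l ∈ Finset.range k, if S l i then 1 else 0)) ∨
    (¬ R i ∧ (∑ l ∈ Finset.range k, if e l ∧ C l i then 1 else 0) =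
        3 * (∑ l ∈ Finset.range k, if S l i then 1 else 0)) := by
  obtain ⟨o, h1, h2, h3, h4⟩ := w.n2 i he
  rw [hm] at h2 h3 h4
  by_cases hR : R i
  · left; rw [h2 hR] at h4
    exact ⟨hR, by omega⟩
  · right; have := h3 hR
    have ho : o = 1 := by omega
    rw [ho] at h4
    exact ⟨hR, by omega⟩

end Wd

def F1 (k : ℕ) (R : ℕ → Prop) (m : ℕ → ℕ) (S : ℕ → ℕ → Prop) (e : ℕ → Prop) : Prop :=
  4 ≤ k ∧ S 0 1 ∧ S 0 2 ∧ R 0 ∧ m 0 = 3 ∧ e 0 ∧ ∀ i, 3 ≤ i → i < k → ¬ S 0 i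
def F2 (k : ℕ) (R : ℕ → Prop) (m : ℕ → ℕ) (S : ℕ → ℕ → Prop) (e : ℕ → Prop) : Prop :=
  k = 5 ∧ (∀ i < k, e i) ∧ ∃ a, S a (a + 1) ∧ S a (a + 2) ∧ S a (a + 3) ∧ ¬ S a (a + 4) ∧ R a ∧ m a = 3
def F3 (k : ℕ) (R : ℕ → Prop) (m : ℕ → ℕ) (S : ℕ → ℕ → Prop) (e : ℕ → Prop) : Prop :=
  k = 5 ∧ (∀ i < k, e i) ∧ ∃ a, S a (a + 1) ∧ ¬ S a (a + 2) ∧ S a (a + 3) ∧ ¬ S a (a + 4) ∧ R a ∧ m a = 3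
    ∧ m (a + 2) = 4 ∧ m (a + 4) = 4
def F4 (k : ℕ) (R : ℕ → Prop) (m : ℕ → ℕ) (S C : ℕ → ℕ → Prop) (e : ℕ → Prop) : Prop :=
  k = 6 ∧ (∀ i < k, e i) ∧ S 0 2 ∧ S 1 3 ∧ S 4 5 ∧ ¬ S 0 1 ∧ ¬ S 0 4 ∧ ¬ S 1 4 ∧ ¬ R 0 ∧
    (∀ i < k, m i = 3) ∧ ∀ i < k, C 0 i

namespace Wd
variable {e R : ℕ → Prop} {m : ℕ → ℕ} {S C : ℕ → ℕ → Prop} 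

open Classical in
lemma c4 (w : Wd 4 e R m S C) (h0 : S 0 1) (h1 : S 1 2) :
    (∀ i < 4, S i (i + 1)) ∨ F1 4 R m S e := by
  have h02 := w.strans _ _ _ h0 h1
  have e0 : e 0 := by
    rcases w.one 0 (by norm_num) 1 (by norm_num) (by norm_num) with h | h
    · exact h
    · exact w.se _ _ (w.ssymm _ _ h0) h
  have e1 := w.se _ _ h0 e0
  have e2 := w.se _ _ h1 e1
  have m1 := w.cm _ _ (w.sc _ _ h0)
  have m2 := w.cm _ _ (w.sc _ _ h02)
  have n1 := w.n1
  simp only [Finset.sum_range_succ, Finset.sum_range_zero, zero_add, e0, e1, e2, if_true, ← m1, ← m2] at n1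
  have hm0 := w.m3 0
  have hm0' : (3 : ℝ) ≤ m 0 := by exact_mod_cast hm0
  by_cases h3 : S 0 3
  · left
    intro i hi
    have := w.per 0
    interval_cases i
    · exact h0
    · exact h1
    · exact w.strans _ _ _ (w.ssymm _ _ h02) h3
    · exact w.strans _ _ _ (w.ssymm _ _ h3) (w.ssymm _ _ this)
  have h30 : ¬ S 3 0 := fun h => h3 (w.ssymm _ _ h)
  right
  obtain ⟨o, ho1, hoR, hoN, hn⟩ := w.n2 0 e0
  simp only [Finset.sum_range_succ, Finset.sum_range_zero, zero_add, e0, e1, e2, w.srefl, w.ssymm _ _ h0,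
    w.ssymm _ _ h02, h30, w.sc _ _ (w.srefl 0), w.sc _ _ (w.ssymm _ _ h0), w.sc _ _ (w.ssymm _ _ h02),
    and_self, true_and, if_true, if_false] at hn
  by_cases e3 : e 3
  · exfalso
    have hm3 := w.m3 3
    have hm3' : (3 : ℝ) ≤ m 3 := by exact_mod_cast hm3
    simp only [e3, if_true] at n1
    have h5 : (m 0 : ℝ) * m 3 = 3 * m 3 + m 0 := by
      field_simp at n1; push_cast at n1; linarith
    have h6 : m 0 * m 3 = 3 * m 3 + m 0 := by exact_mod_cast h5
    have h7 : m 0 = 4 := by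
      have : m 0 ≤ 4 := by nlinarith
      have : m 0 ≠ 3 := by intro h; rw [h] at h6; omega
      omega
    have h8 : m 3 = 4 := by rw [h7] at h6; omega
    rw [h7] at hoR hoN hn
    simp only [e3, true_and] at hn
    have hR0 : R 0 ∧ ¬ C 3 0 := by
      split_ifs at hn with hc
      · exfalso
        have : o = 3 := by omega
        by_cases hR : R 0
        · have := hoR hR; omega
        · have := hoN hR; omega
      · refine ⟨?_, hc⟩
        by_contra hR
        have := hoN hR; omega
    obtain ⟨hR0, hc⟩ := hR0
    obtain ⟨o', ho1', hoR', hoN', hn'⟩ := w.n2 3 e3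
    have c0 : ¬ C 0 3 := fun h => hc (w.csymm _ _ h)
    have c1 : ¬ C 1 3 := fun h => c0 (w.ctrans _ _ _ (w.sc _ _ h0) h)
    have c2 : ¬ C 2 3 := fun h => c0 (w.ctrans _ _ _ (w.sc _ _ h02) h)
    have s0 : ¬ S 0 3 := fun h => c0 (w.sc _ _ h)
    have s1 : ¬ S 1 3 := fun h => c1 (w.sc _ _ h)
    have s2 : ¬ S 2 3 := fun h => c2 (w.sc _ _ h)
    simp only [Finset.sum_range_succ, Finset.sum_range_zero, zero_add, e3, w.srefl, w.sc _ _ (w.srefl 3),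
      c0, c1, c2, s0, s1, s2, and_false, and_self, if_true, if_false, h8] at hn'
    rw [h8] at hoR' hoN'
    have hR3 : R 3 := by
      by_contra hR
      have := hoN' hR; omega
    refine s2 (w.reg ?_ 2 (w.cR _ _ (w.sc _ _ h02) hR0) hR3 (by rw [← m2, h7, h8]) (Or.inr (by omega)))
    intro i hi
    interval_cases i <;> assumption
  · simp only [e3, if_false] at n1
    have h7 : m 0 = 3 := by
      have : (m 0 : ℝ) = 3 := by field_simp at n1; push_cast at n1; linarith
      exact_mod_cast this
    simp only [e3, false_and, if_false, h7] at hn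
    refine ⟨le_rfl, h0, h02, ?_, h7, e0, ?_⟩
    · by_contra hR
      have := hoN hR; omega
    · intro i hi hi'
      have : i = 3 := by omega
      rw [this]; exact h3


lemma rec_le {n a : ℕ} (ha : 0 < a) (h : a ≤ n) : 1 / (n : ℝ) ≤ 1 / (a : ℝ) :=
  one_div_le_one_div_of_le (by exact_mod_cast ha) (by exact_mod_cast h)

lemma rec_lt {n a : ℕ} (ha : 0 < a) (h : 1 / (a : ℝ) ≤ 1 / (n : ℝ)) (hn : 0 < n) : n ≤ a := by
  have := (one_div_le_one_div (by exact_mod_cast ha) (by exact_mod_cast hn)).1 h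
  exact_mod_cast this

lemma rec_eq {n a : ℕ} (hn : 0 < n) (ha : 0 < a) (h : 1 / (n : ℝ) = 1 / (a : ℝ)) : n = a :=
  le_antisymm (rec_lt ha h.ge hn) (rec_lt hn h.le ha)

lemma ar1 {a b c : ℕ} (ha : 3 ≤ a) (hb : 3 ≤ b) (hc : 3 ≤ c)
    (h : 1 / (a : ℝ) + 1 / (a : ℝ) + 1 / (a : ℝ) + 1 / (b : ℝ) + 1 / (c : ℝ) = 3 / 2) :
    a = 3 ∧ ((b = 4 ∧ c = 4) ∨ (b = 3 ∧ c = 6) ∨ (b = 6 ∧ c = 3)) := by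
  have hb' := rec_le (by norm_num) hb
  have hc' := rec_le (by norm_num) hc
  have h3 : a = 3 := by
    by_contra hne
    have ha' := rec_le (a := 4) (by norm_num) (show 4 ≤ a by omega)
    norm_num at ha' hb' hc' h
    linarith
  refine ⟨h3, ?_⟩
  subst h3
  have hb6 : b ≤ 6 := by
    refine rec_lt (by norm_num) ?_ (by omega)
    norm_num at hc' h ⊢
    linarith
  interval_cases b
  · right; left
    refine ⟨rfl, rec_eq (by omega) (by norm_num) ?_⟩
    norm_num at h ⊢
    linarith
  · left
    refine ⟨rfl, rec_eq (by omega) (by norm_num) ?_⟩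
    norm_num at h ⊢
    linarith
  · exfalso
    have : c ≤ 4 := rec_lt (by norm_num) (by norm_num at h ⊢; linarith) (by omega)
    interval_cases c <;> norm_num at h
  · right; right
    refine ⟨rfl, rec_eq (by omega) (by norm_num) ?_⟩
    norm_num at h ⊢
    linarith

lemma ar2 {a b c : ℕ} (ha : 3 ≤ a) (hb : 3 ≤ b) (hc : 3 ≤ c)
    (h : 1 / (a : ℝ) + 1 / (b : ℝ) + 1 / (a : ℝ) + 1 / (b : ℝ) + 1 / (c : ℝ) = 3 / 2) :
    (a = 3 ∧ b = 3 ∧ c = 6) ∨ (a = 3 ∧ b = 4 ∧ c = 3) ∨ (a = 4 ∧ b = 3 ∧ c = 3) := by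
  have ha' := rec_le (by norm_num) ha
  have hb' := rec_le (by norm_num) hb
  have hc' := rec_le (by norm_num) hc
  have ha4 : a ≤ 4 := by
    by_contra hne
    have ha' := rec_le (a := 5) (by norm_num) (show 5 ≤ a by omega)
    norm_num at ha' hb' hc' h
    linarith
  have hb4 : b ≤ 4 := by
    by_contra hne
    have hb5 := rec_le (a := 5) (by norm_num) (show 5 ≤ b by omega)
    norm_num at ha' hb5 hc' h
    linarith
  interval_cases a <;> interval_cases b
  · left
    refine ⟨rfl, rfl, rec_eq (by omega) (by norm_num) ?_⟩
    norm_num at h ⊢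
    linarith
  · right; left
    refine ⟨rfl, rfl, rec_eq (by omega) (by norm_num) ?_⟩
    norm_num at h ⊢
    linarith
  · right; right
    refine ⟨rfl, rfl, rec_eq (by omega) (by norm_num) ?_⟩
    norm_num at h ⊢
    linarith
  · exfalso
    norm_num at h hc'
    linarith

open Classical in
lemma c51 (w : Wd 5 e R m S C) (h0 : S 0 1) (h1 : S 1 2) :
    F1 5 R m S e ∨ F2 5 R m S e := by
  have he := w.all_e le_rfl
  have h02 := w.strans _ _ _ h0 h1
  have m1 := w.cm _ _ (w.sc _ _ h0)
  have m2 := w.cm _ _ (w.sc _ _ h02)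
  have e0 := he 0 (by norm_num)
  have e1 := he 1 (by norm_num)
  have e2 := he 2 (by norm_num)
  have e3 := he 3 (by norm_num)
  have e4 := he 4 (by norm_num)
  have n1 := w.n1
  simp only [Finset.sum_range_succ, Finset.sum_range_zero, zero_add, e0, e1, e2, e3, e4, if_true,
    ← m1, ← m2] at n1
  obtain ⟨hm, hcase⟩ := ar1 (w.m3 0) (w.m3 3) (w.m3 4) (by rw [n1]; norm_num)
  have t0 := w.tri e0 hm
  simp only [Finset.sum_range_succ, Finset.sum_range_zero, zero_add, e0, e1, e2, e3, e4, w.srefl,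
    w.ssymm _ _ h0, w.ssymm _ _ h02, w.sc _ _ (w.srefl 0), w.sc _ _ (w.ssymm _ _ h0),
    w.sc _ _ (w.ssymm _ _ h02), true_and, if_true] at t0
  have R0 : R 0 := by
    rcases t0 with h | ⟨_, h⟩
    · exact h.1
    · exfalso; split_ifs at h <;> omega
  have R2 := w.cR _ _ (w.sc _ _ h02) R0
  rcases hcase with ⟨h3, h4⟩ | ⟨h3, h4⟩ | ⟨h3, h4⟩
  · left
    refine ⟨by norm_num, h0, h02, R0, hm, e0, ?_⟩
    intro i hi hi' hs
    have := w.cm _ _ (w.sc _ _ hs)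
    interval_cases i <;> omega
  · right
    have c4 : ¬ S 0 4 := fun h => by have := w.cm _ _ (w.sc _ _ h); omega
    have R3 : R 3 := by
      by_cases hc : C 0 3
      · exact w.cR _ _ hc R0
      have c1 : ¬ C 1 3 := fun h => hc (w.ctrans _ _ _ (w.sc _ _ h0) h)
      have c2 : ¬ C 2 3 := fun h => hc (w.ctrans _ _ _ (w.sc _ _ h02) h)
      have t := w.tri e3 h3
      have c43 : ¬ C 4 3 := fun h => by have := w.cm _ _ h; omega
      simp only [Finset.sum_range_succ, Finset.sum_range_zero, zero_add, w.srefl, hc, c1, c2, c43, e3,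
        w.sc _ _ (w.srefl 3), and_false, and_self, if_true, if_false] at t
      rcases t with h | ⟨_, h⟩
      · exact h.1
      · exfalso; split_ifs at h <;> omega
    have s23 := w.reg he 2 R2 R3 (by (try simp only [Nat.reduceAdd]); omega) (by (try simp only [Nat.reduceAdd]); omega)
    exact ⟨rfl, he, 0, h0, h02, w.strans _ _ _ h02 s23, c4, R0, hm⟩
  · right
    have p0 := w.per 0
    have p1 := w.per 1
    have p2 := w.per 2
    have p3 := w.per 3
    have m5 := w.cm _ _ (w.sc _ _ p0)
    norm_num at p0 p1 p2 p3 m5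
    have R4 : R 4 := by
      by_cases hc : C 0 4
      · exact w.cR _ _ hc R0
      have c1 : ¬ C 1 4 := fun h => hc (w.ctrans _ _ _ (w.sc _ _ h0) h)
      have c2 : ¬ C 2 4 := fun h => hc (w.ctrans _ _ _ (w.sc _ _ h02) h)
      have t := w.tri e4 h4
      have c43 : ¬ C 3 4 := fun h => by have := w.cm _ _ h; omega
      simp only [Finset.sum_range_succ, Finset.sum_range_zero, zero_add, w.srefl, hc, c1, c2, c43, e4,
        w.sc _ _ (w.srefl 4), and_false, and_self, if_true, if_false] at t
      rcases t with h | ⟨_, h⟩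
      · exact h.1
      · exfalso; split_ifs at h <;> omega
    have s45 := w.reg he 4 R4 (w.cR _ _ (w.sc _ _ (w.ssymm _ _ p0)) R0) (by (try simp only [Nat.reduceAdd]); omega) (by (try simp only [Nat.reduceAdd]); omega)
    have s40 := w.strans _ _ _ s45 p0
    refine ⟨rfl, he, 4, s45, w.strans _ _ _ (w.strans _ _ _ s40 h0) (w.ssymm _ _ p1),
      w.strans _ _ _ (w.strans _ _ _ s40 h02) (w.ssymm _ _ p2), ?_, R4, h4⟩
    intro h
    have := w.cm _ _ (w.sc _ _ (w.strans _ _ _ h p3))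
    omega

open Classical in
lemma c52 (w : Wd 5 e R m S C) (h0 : S 0 2) (h1 : S 1 3) :
    F2 5 R m S e ∨ F3 5 R m S e := by
  have he := w.all_e le_rfl
  have m2 := w.cm _ _ (w.sc _ _ h0)
  have m3 := w.cm _ _ (w.sc _ _ h1)
  have e0 := he 0 (by norm_num)
  have e1 := he 1 (by norm_num)
  have e2 := he 2 (by norm_num)
  have e3 := he 3 (by norm_num)
  have e4 := he 4 (by norm_num)
  have n1 := w.n1
  simp only [Finset.sum_range_succ, Finset.sum_range_zero, zero_add, e0, e1, e2, e3, e4, if_true,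
    ← m2, ← m3] at n1
  have hcase := ar2 (w.m3 0) (w.m3 1) (w.m3 4) (by rw [n1]; norm_num)
  rcases hcase with ⟨k0, k1, k4⟩ | ⟨k0, k1, k4⟩ | ⟨k0, k1, k4⟩
  · left
    have R0 : R 0 := by
      have t := w.tri e0 k0
      have c4 : ¬ C 4 0 := fun h => by have := w.cm _ _ h; omega
      simp only [Finset.sum_range_succ, Finset.sum_range_zero, zero_add, w.srefl, c4, e0, e2,
        w.sc _ _ (w.srefl 0), w.ssymm _ _ h0, w.sc _ _ (w.ssymm _ _ h0), and_false, and_self, if_true, if_false] at t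
      rcases t with h | ⟨_, h⟩
      · exact h.1
      · exfalso; split_ifs at h <;> omega
    have R1 : R 1 := by
      have t := w.tri e1 k1
      have c4 : ¬ C 4 1 := fun h => by have := w.cm _ _ h; omega
      simp only [Finset.sum_range_succ, Finset.sum_range_zero, zero_add, w.srefl, c4, e1, e3,
        w.sc _ _ (w.srefl 1), w.ssymm _ _ h1, w.sc _ _ (w.ssymm _ _ h1), and_false, and_self, if_true, if_false] at t
      rcases t with h | ⟨_, h⟩
      · exact h.1
      · exfalso; split_ifs at h <;> omega
    have s01 := w.reg he 0 R0 R1 (by (try simp only [Nat.reduceAdd]); omega) (by (try simp only [Nat.reduceAdd]); omega)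
    refine ⟨rfl, he, 0, s01, h0, w.strans _ _ _ s01 h1, ?_, R0, k0⟩
    intro h
    have := w.cm _ _ (w.sc _ _ h)
    (simp only [Nat.reduceAdd, zero_add] at this; omega)
  · right
    have R0 : R 0 := by
      have t := w.tri e0 k0
      have c1 : ¬ C 1 0 := fun h => by have := w.cm _ _ h; omega
      have c3 : ¬ C 3 0 := fun h => by have := w.cm _ _ h; omega
      simp only [Finset.sum_range_succ, Finset.sum_range_zero, zero_add, w.srefl, c1, c3, e0, e2,
        w.sc _ _ (w.srefl 0), w.ssymm _ _ h0, w.sc _ _ (w.ssymm _ _ h0), and_false, and_self, if_true, if_false] at t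
      rcases t with h | ⟨_, h⟩
      · exact h.1
      · exfalso; split_ifs at h <;> omega
    have p0 := w.per 0
    have p1 := w.per 1
    have p2 := w.per 2
    have p3 := w.per 3
    have m5 := w.cm _ _ (w.sc _ _ p0)
    have m6 := w.cm _ _ (w.sc _ _ p1)
    have m8 := w.cm _ _ (w.sc _ _ p3)
    norm_num at p0 p1 p2 p3 m5 m6 m8
    have R4 : R 4 := by
      by_cases hc : C 0 4
      · exact w.cR _ _ hc R0
      have c2 : ¬ C 2 4 := fun h => hc (w.ctrans _ _ _ (w.sc _ _ h0) h)
      have t := w.tri e4 k4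
      have c1 : ¬ C 1 4 := fun h => by have := w.cm _ _ h; omega
      have c43 : ¬ C 3 4 := fun h => by have := w.cm _ _ h; omega
      simp only [Finset.sum_range_succ, Finset.sum_range_zero, zero_add, w.srefl, hc, c1, c2, c43, e4,
        w.sc _ _ (w.srefl 4), and_false, and_self, if_true, if_false] at t
      rcases t with h | ⟨_, h⟩
      · exact h.1
      · exfalso; split_ifs at h <;> omega
    have s45 := w.reg he 4 R4 (w.cR _ _ (w.sc _ _ (w.ssymm _ _ p0)) R0) (by (try simp only [Nat.reduceAdd]); omega) (by (try simp only [Nat.reduceAdd]); omega)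
    have s40 := w.strans _ _ _ s45 p0
    refine ⟨rfl, he, 4, s45, ?_, w.strans _ _ _ (w.strans _ _ _ s40 h0) (w.ssymm _ _ p2), ?_, R4, k4,
      by (try simp only [Nat.reduceAdd]); omega, by (try simp only [Nat.reduceAdd]); omega⟩
    · intro h
      have := w.cm _ _ (w.sc _ _ h)
      (simp only [Nat.reduceAdd, zero_add] at this; omega)
    · intro h
      have := w.cm _ _ (w.sc _ _ h)
      (simp only [Nat.reduceAdd, zero_add] at this; omega)
  · right
    have R1 : R 1 := by
      have t := w.tri e1 k1
      have c0 : ¬ C 0 1 := fun h => by have := w.cm _ _ h; omega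
      have c2 : ¬ C 2 1 := fun h => by have := w.cm _ _ h; omega
      simp only [Finset.sum_range_succ, Finset.sum_range_zero, zero_add, w.srefl, c0, c2, e1, e3,
        w.sc _ _ (w.srefl 1), w.ssymm _ _ h1, w.sc _ _ (w.ssymm _ _ h1), and_false, and_self, if_true, if_false] at t
      rcases t with h | ⟨_, h⟩
      · exact h.1
      · exfalso; split_ifs at h <;> omega
    have p0 := w.per 0
    have p1 := w.per 1
    have p2 := w.per 2
    have m5 := w.cm _ _ (w.sc _ _ p0)
    have m7 := w.cm _ _ (w.sc _ _ p2)
    norm_num at p0 p1 p2 m5 m7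
    have R3 := w.cR _ _ (w.sc _ _ h1) R1
    have R4 : R 4 := by
      by_cases hc : C 1 4
      · exact w.cR _ _ hc R1
      have c3 : ¬ C 3 4 := fun h => hc (w.ctrans _ _ _ (w.sc _ _ h1) h)
      have t := w.tri e4 k4
      have c0 : ¬ C 0 4 := fun h => by have := w.cm _ _ h; omega
      have c2 : ¬ C 2 4 := fun h => by have := w.cm _ _ h; omega
      simp only [Finset.sum_range_succ, Finset.sum_range_zero, zero_add, w.srefl, hc, c0, c2, c3, e4,
        w.sc _ _ (w.srefl 4), and_false, and_self, if_true, if_false] at t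
      rcases t with h | ⟨_, h⟩
      · exact h.1
      · exfalso; split_ifs at h <;> omega
    have s34 := w.reg he 3 R3 R4 (by (try simp only [Nat.reduceAdd]); omega) (by (try simp only [Nat.reduceAdd]); omega)
    refine ⟨rfl, he, 3, s34, ?_, w.strans _ _ _ (w.ssymm _ _ h1) (w.ssymm _ _ p1), ?_, R3, by (try simp only [Nat.reduceAdd]); omega,
      by (try simp only [Nat.reduceAdd]); omega, by (try simp only [Nat.reduceAdd]); omega⟩
    · intro h
      have := w.cm _ _ (w.sc _ _ h)
      (simp only [Nat.reduceAdd, zero_add] at this; omega)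
    · intro h
      have := w.cm _ _ (w.sc _ _ h)
      (simp only [Nat.reduceAdd, zero_add] at this; omega)

end Wd
end MC

namespace MC
open MeasureTheory
open scoped Pointwise

namespace Wd
variable {e R : ℕ → Prop} {m : ℕ → ℕ} {S C : ℕ → ℕ → Prop} 

open Classical in
lemma m6 (w : Wd 6 e R m S C) : ∀ i < 6, m i = 3 := by
  have he := w.all_e (by norm_num)
  have n1 := w.n1
  have h := fun i => w.wle i
  intro i hi
  have e0 := he 0 (by norm_num)
  have e1 := he 1 (by norm_num)
  have e2 := he 2 (by norm_num)
  have e3 := he 3 (by norm_num)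
  have e4 := he 4 (by norm_num)
  have e5 := he 5 (by norm_num)
  have h0 := h 0
  have h1 := h 1
  have h2 := h 2
  have h3 := h 3
  have h4 := h 4
  have h5 := h 5
  simp only [Finset.sum_range_succ, Finset.sum_range_zero, zero_add, e0, e1, e2, e3, e4, e5,
    if_true] at n1 h0 h1 h2 h3 h4 h5
  push_cast at n1
  have hm := w.m3 i
  refine rec_eq (by omega) (by norm_num) ?_
  push_cast
  interval_cases i <;> linarith

lemma ext6 (w : Wd 6 e R m S C) (h : ∀ i < 5, S i (i + 1)) : ∀ i j, S i j := by
  have h5 : S 5 6 := by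
    have := w.per 0
    norm_num at this
    refine w.ssymm _ _ (w.strans _ _ _ this ?_)
    exact w.strans _ _ _ (h 0 (by norm_num)) (w.strans _ _ _ (h 1 (by norm_num)) (w.strans _ _ _ (h 2 (by norm_num))
      (w.strans _ _ _ (h 3 (by norm_num)) (h 4 (by norm_num)))))
  have key : ∀ i, S 0 i := by
    intro i
    induction i using Nat.strong_induction_on with
    | _ i ih =>
      by_cases hi : i = 0
      · rw [hi]; exact w.srefl _
      by_cases hi' : i < 6
      · have := ih (i - 1) (by omega)
        have h2 := h (i - 1) (by omega)
        rw [show i - 1 + 1 = i by omega] at h2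
        exact w.strans _ _ _ this h2
      · have := ih (i - 6) (by omega)
        have h2 := w.per (i - 6)
        rw [show i - 6 + 6 = i by omega] at h2
        exact w.strans _ _ _ this (w.ssymm _ _ h2)
  exact fun i j => w.strans _ _ _ (w.ssymm _ _ (key i)) (key j)

lemma allR (w : Wd 6 e R m S C) (h : ∀ i < 6, R i) : ∀ i j, S i j := by
  have m6 := w.m6
  refine w.ext6 fun i hi => w.reg (w.all_e (by norm_num)) i (h _ (by omega)) (h _ (by omega))
    (by rw [m6 _ (by omega), m6 _ (by omega)]) (by rw [m6 _ (by omega)]; simp)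

open Classical in
/-- if a class has at least four members then everything is regular and equivalent -/
lemma four (w : Wd 6 e R m S C) {i : ℕ} (hi : i < 6)
    (h : 4 ≤ ∑ l ∈ Finset.range 6, if S l i then 1 else 0) : ∀ i j, S i j := by
  have he := w.all_e (by norm_num)
  have m6 := w.m6
  have bnd : ∀ l, (∑ j ∈ Finset.range 6, if e j ∧ C j l then 1 else 0) ≤ 6 := by
    intro l
    calc _ ≤ ∑ j ∈ Finset.range 6, 1 := Finset.sum_le_sum fun j _ => by split_ifs <;> omega
      _ = 6 := by simp
  have Ri : R i := by
    rcases w.tri (he i hi) (m6 i hi) with h1 | ⟨_, h1⟩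
    · exact h1.1
    · have := bnd i; omega
  refine w.allR fun l hl => ?_
  by_contra hR
  have hC : ¬ C i l := fun hc => hR (w.cR _ _ hc Ri)
  rcases w.tri (he l hl) (m6 l hl) with h1 | ⟨_, h1⟩
  · exact hR h1.1
  have hpos : 1 ≤ ∑ j ∈ Finset.range 6, if S j l then 1 else 0 := by
    have := Finset.single_le_sum (s := Finset.range 6) (f := fun j => if S j l then 1 else 0)
      (fun _ _ => Nat.zero_le _) (Finset.mem_range.2 hl)
    simp only [w.srefl, if_true] at this
    exact this
  have hdis : (∑ j ∈ Finset.range 6, if e j ∧ C j l then 1 else 0) +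
      (∑ j ∈ Finset.range 6, if S j i then 1 else 0) ≤ 6 := by
    rw [← Finset.sum_add_distrib]
    calc _ ≤ ∑ j ∈ Finset.range 6, 1 := Finset.sum_le_sum fun j _ => by
          split_ifs with h1 h2
          · exact absurd (w.ctrans _ _ _ (w.csymm _ _ (w.sc _ _ h2)) h1.2) hC
          · omega
          · omega
          · omega
      _ = 6 := by simp
  omega

open Classical in
/-- a nonregular tile whose class has at least two members -/
lemma nonreg (w : Wd 6 e R m S C) {i : ℕ} (hi : i < 6) (hR : ¬ R i)
    (h : 2 ≤ ∑ l ∈ Finset.range 6, if S l i then 1 else 0) :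
    (∀ j < 6, C j i) ∧ ∀ j < 6, ¬ R j ∧ (∑ l ∈ Finset.range 6, if S l j then 1 else 0) = 2 := by
  have he := w.all_e (by norm_num)
  have m6 := w.m6
  have hC : ∀ j < 6, C j i := by
    rcases w.tri (he i hi) (m6 i hi) with h1 | ⟨_, h1⟩
    · exact absurd h1.1 hR
    intro j hj
    by_contra hc
    have h2 := Finset.add_sum_erase (Finset.range 6) (fun j => if e j ∧ C j i then 1 else 0)
      (Finset.mem_range.2 hj)
    have h3 : ∑ j ∈ (Finset.range 6).erase j, (if e j ∧ C j i then 1 else 0) ≤ 5 := by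
      calc _ ≤ ∑ j ∈ (Finset.range 6).erase j, 1 := Finset.sum_le_sum fun j _ => by split_ifs <;> omega
        _ = 5 := by simp [Finset.card_erase_of_mem (Finset.mem_range.2 hj)]
    simp only [hc, and_false, if_false, zero_add] at h2
    omega
  refine ⟨hC, fun j hj => ?_⟩
  have hRj : ¬ R j := fun h => hR (w.cR _ _ (hC j hj) h)
  refine ⟨hRj, ?_⟩
  rcases w.tri (he j hj) (m6 j hj) with h1 | ⟨_, h1⟩
  · exact absurd h1.1 hRj
  have : ∑ l ∈ Finset.range 6, (if e l ∧ C l j then 1 else 0) = 6 := by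
    rw [Finset.sum_congr rfl (g := fun _ => 1)]
    · simp
    · intro l hl
      have hl := Finset.mem_range.1 hl
      rw [if_pos ⟨he l hl, w.ctrans _ _ _ (hC l hl) (w.csymm _ _ (hC j hj))⟩]
  omega

open Classical in
lemma c61 (w : Wd 6 e R m S C) (h0 : S 0 1) (h1 : S 1 2) :
    (∀ i < 6, S i (i + 1)) ∨ F1 6 R m S e := by
  have h02 := w.strans _ _ _ h0 h1
  have he := w.all_e (by norm_num)
  by_cases h4 : 4 ≤ ∑ l ∈ Finset.range 6, if S l 0 then 1 else 0
  · left; intro i _; exact w.four (by norm_num) h4 _ _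
  right
  simp only [Finset.sum_range_succ, Finset.sum_range_zero, zero_add, w.srefl, w.ssymm _ _ h0,
    w.ssymm _ _ h02, if_true] at h4
  have R0 : R 0 := by
    by_contra hR
    have := ((w.nonreg (i := 0) (by norm_num) hR (by
      simp only [Finset.sum_range_succ, Finset.sum_range_zero, zero_add, w.srefl, w.ssymm _ _ h0,
      w.ssymm _ _ h02, if_true]; omega)).2 0 (by norm_num)).2
    simp only [Finset.sum_range_succ, Finset.sum_range_zero, zero_add, w.srefl, w.ssymm _ _ h0,
      w.ssymm _ _ h02, if_true] at this
    omega
  refine ⟨by norm_num, h0, h02, R0, w.m6 _ (by norm_num), he _ (by norm_num), ?_⟩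
  intro i hi hi' hs
  apply h4
  have := w.ssymm _ _ hs
  interval_cases i <;> simp only [this, if_true] <;> omega

open Classical in
lemma c62 (w : Wd 6 e R m S C) (h0 : S 0 2) (h1 : S 1 3) :
    (∀ i < 6, S i (i + 2)) ∨ F4 6 R m S C e := by
  have he := w.all_e (by norm_num)
  have m6 := w.m6
  by_cases h01 : S 0 1
  · left
    have h03 := w.strans _ _ _ h01 h1
    intro i _; refine w.four (i := 0) (by norm_num) ?_ _ _
    simp only [Finset.sum_range_succ, Finset.sum_range_zero, zero_add, w.srefl, w.ssymm _ _ h0,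
      w.ssymm _ _ h01, w.ssymm _ _ h03, if_true]; omega
  right
  have g0 : 2 ≤ ∑ l ∈ Finset.range 6, if S l 0 then 1 else 0 := by
    simp only [Finset.sum_range_succ, Finset.sum_range_zero, zero_add, w.srefl, w.ssymm _ _ h0, if_true]
    omega
  have g1 : 2 ≤ ∑ l ∈ Finset.range 6, if S l 1 then 1 else 0 := by
    simp only [Finset.sum_range_succ, Finset.sum_range_zero, zero_add, w.srefl, w.ssymm _ _ h1, if_true]
    omega
  have R0 : ¬ R 0 := by
    intro R0
    by_cases R1 : R 1
    · exact h01 (w.reg he 0 R0 R1 (by rw [m6 _ (by norm_num), m6 _ (by norm_num)])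
        (by rw [m6 _ (by norm_num)]; simp))
    · exact ((w.nonreg (i := 1) (by norm_num) R1 g1).2 0 (by norm_num)).1 R0
  obtain ⟨hC, hn⟩ := w.nonreg (i := 0) (by norm_num) R0 g0
  have n0 := (hn 0 (by norm_num)).2
  have n1 := (hn 1 (by norm_num)).2
  have n4 := (hn 4 (by norm_num)).2
  simp only [Finset.sum_range_succ, Finset.sum_range_zero, zero_add, w.srefl, w.ssymm _ _ h0,
    w.ssymm _ _ h1, if_true] at n0 n1 n4
  have h40 : ¬ S 4 0 := by intro h; simp only [h, if_true] at n0; omega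
  have h41 : ¬ S 4 1 := by intro h; simp only [h, if_true] at n1; omega
  have h04 : ¬ S 0 4 := fun h => h40 (w.ssymm _ _ h)
  have h14 : ¬ S 1 4 := fun h => h41 (w.ssymm _ _ h)
  have h24 : ¬ S 2 4 := fun h => h04 (w.strans _ _ _ h0 h)
  have h34 : ¬ S 3 4 := fun h => h14 (w.strans _ _ _ h1 h)
  simp only [h04, h14, h24, h34, if_false] at n4
  have h54 : S 5 4 := by
    by_contra h
    simp only [h, if_false] at n4; omega
  exact ⟨rfl, he, h0, h1, w.ssymm _ _ h54, h01, h04, h14, R0, m6, fun i hi => w.csymm _ _ (hC i hi)⟩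

open Classical in
lemma c63 (w : Wd 6 e R m S C) (h0 : S 0 3) (h1 : S 1 4) : ∀ i < 6, S i (i + 3) := by
  have he := w.all_e (by norm_num)
  have m6 := w.m6
  by_cases h01 : S 0 1
  · have h03 := w.strans _ _ _ h01 h1
    intro i _; refine w.four (i := 0) (by norm_num) ?_ _ _
    simp only [Finset.sum_range_succ, Finset.sum_range_zero, zero_add, w.srefl, w.ssymm _ _ h0,
      w.ssymm _ _ h01, w.ssymm _ _ h03, if_true]; omega
  have g0 : 2 ≤ ∑ l ∈ Finset.range 6, if S l 0 then 1 else 0 := by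
    simp only [Finset.sum_range_succ, Finset.sum_range_zero, zero_add, w.srefl, w.ssymm _ _ h0, if_true]
    omega
  have g1 : 2 ≤ ∑ l ∈ Finset.range 6, if S l 1 then 1 else 0 := by
    simp only [Finset.sum_range_succ, Finset.sum_range_zero, zero_add, w.srefl, w.ssymm _ _ h1, if_true]
    omega
  have R0 : ¬ R 0 := by
    intro R0
    by_cases R1 : R 1
    · exact h01 (w.reg he 0 R0 R1 (by rw [m6 _ (by norm_num), m6 _ (by norm_num)])
        (by rw [m6 _ (by norm_num)]; simp))
    · exact ((w.nonreg (i := 1) (by norm_num) R1 g1).2 0 (by norm_num)).1 R0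
  obtain ⟨hC, hn⟩ := w.nonreg (i := 0) (by norm_num) R0 g0
  have n0 := (hn 0 (by norm_num)).2
  have n1 := (hn 1 (by norm_num)).2
  have n2 := (hn 2 (by norm_num)).2
  simp only [Finset.sum_range_succ, Finset.sum_range_zero, zero_add, w.srefl, w.ssymm _ _ h0,
    w.ssymm _ _ h1, if_true] at n0 n1 n2
  have h40 : ¬ S 2 0 := by intro h; simp only [h, if_true] at n0; omega
  have h41 : ¬ S 2 1 := by intro h; simp only [h, if_true] at n1; omega
  have h04 : ¬ S 0 2 := fun h => h40 (w.ssymm _ _ h)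
  have h14 : ¬ S 1 2 := fun h => h41 (w.ssymm _ _ h)
  have h24 : ¬ S 3 2 := fun h => h04 (w.strans _ _ _ h0 h)
  have h34 : ¬ S 4 2 := fun h => h14 (w.strans _ _ _ h1 h)
  simp only [h04, h14, h24, h34, if_false] at n2
  have h25 : S 2 5 := by
    apply w.ssymm
    by_contra h
    simp only [h, if_false] at n2; omega
  have p0 := w.per 0
  have p1 := w.per 1
  have p2 := w.per 2
  intro i hi
  interval_cases i
  · exact h0
  · exact h1
  · exact h25
  · exact w.strans _ _ _ (w.ssymm _ _ h0) (w.ssymm _ _ p0)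
  · exact w.strans _ _ _ (w.ssymm _ _ h1) (w.ssymm _ _ p1)
  · exact w.strans _ _ _ (w.ssymm _ _ h25) (w.ssymm _ _ p2)

end Wd
end MC

namespace MC
open MeasureTheory
open scoped Pointwise

open Classical in
lemma Wd.main {k : ℕ} {e R : ℕ → Prop} {m : ℕ → ℕ} {S C : ℕ → ℕ → Prop} (w : Wd k e R m S C)
    (hex : ∃ i < k, e i) {j : ℕ} (hj : 1 ≤ j) (hjk : 2 * j ≤ k) (h0 : S 0 j) (h1 : S 1 (j + 1)) :
    (∀ i < k, S i (i + j)) ∨ (F1 k R m S e ∨ F2 k R m S e ∨ F3 k R m S e ∨ F4 k R m S C e) := by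
  have k6 := w.k_le
  have k3 : 3 ≤ k := by
    obtain ⟨i, hi, he⟩ := hex
    have h := Finset.single_le_sum (s := Finset.range k) (f := fun i => if e i then 1 / (m i : ℝ) else 0)
      (fun i _ => by split_ifs <;> positivity) (Finset.mem_range.2 hi)
    rw [w.n1] at h
    simp only [he, if_true] at h
    have := w.m3 i
    have h2 : (0 : ℝ) < 1 / m i := by
      have : (0 : ℝ) < m i := by exact_mod_cast (by omega : 0 < m i)
      positivity
    have : (2 : ℝ) < k := by linarith
    exact_mod_cast this
  have hj3 : j ≤ 3 := by omega
  interval_cases k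
  · have : j = 1 := by omega
    subst this
    left
    have := w.per 0
    intro i hi
    interval_cases i
    · exact h0
    · exact h1
    · exact w.strans _ _ _ (w.ssymm _ _ (w.strans _ _ _ h0 h1)) (w.ssymm _ _ this)
  · interval_cases j
    · rcases w.c4 h0 h1 with h | h
      · left; exact h
      · right; left; exact h
    · left
      have p0 := w.per 0
      have p1 := w.per 1
      intro i hi
      interval_cases i
      · exact h0
      · exact h1
      · exact w.strans _ _ _ (w.ssymm _ _ h0) (w.ssymm _ _ p0)
      · exact w.strans _ _ _ (w.ssymm _ _ h1) (w.ssymm _ _ p1)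
    · omega
  · right
    interval_cases j
    · rcases w.c51 h0 h1 with h | h
      · left; exact h
      · right; left; exact h
    · rcases w.c52 h0 h1 with h | h
      · right; left; exact h
      · right; right; left; exact h
    · omega
  · interval_cases j
    · rcases w.c61 h0 h1 with h | h
      · left; exact h
      · right; left; exact h
    · rcases w.c62 h0 h1 with h | h
      · left; exact h
      · right; right; right; right; exact h
    · left; exact w.c63 h0 h1

/-- the four exceptional coronae, read from the tile `Q` -/
def Ex1 (T : Set (Set ℂ)) (x : ℂ) (Q : Set ℂ) : Prop :=
  F1 (cor T x).ncard (fun i => Rg (sq T x Q i)) (fun i => (ext (sq T x Q i)).ncard)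
    (fun i j => peq (sq T x Q i) x (sq T x Q j) x) (fun i => x ∈ ext (sq T x Q i))
def Ex2 (T : Set (Set ℂ)) (x : ℂ) (Q : Set ℂ) : Prop :=
  F2 (cor T x).ncard (fun i => Rg (sq T x Q i)) (fun i => (ext (sq T x Q i)).ncard)
    (fun i j => peq (sq T x Q i) x (sq T x Q j) x) (fun i => x ∈ ext (sq T x Q i))
def Ex3 (T : Set (Set ℂ)) (x : ℂ) (Q : Set ℂ) : Prop :=
  F3 (cor T x).ncard (fun i => Rg (sq T x Q i)) (fun i => (ext (sq T x Q i)).ncard)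
    (fun i j => peq (sq T x Q i) x (sq T x Q j) x) (fun i => x ∈ ext (sq T x Q i))
def Ex4 (T : Set (Set ℂ)) (x : ℂ) (Q : Set ℂ) : Prop :=
  F4 (cor T x).ncard (fun i => Rg (sq T x Q i)) (fun i => (ext (sq T x Q i)).ncard)
    (fun i j => peq (sq T x Q i) x (sq T x Q j) x) (fun i j => cong (sq T x Q i) (sq T x Q j))
    (fun i => x ∈ ext (sq T x Q i))

namespace Til
variable {T : Set (Set ℂ)} (hT : Til T)
include hT

/-- no straight corners at one vertex implies none anywhere -/
lemma ns_all {x : ℂ} (hx : x ∈ V T) (h : ∀ P ∈ cor T x, x ∈ ext P) :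
    ∀ y ∈ V T, ∀ P ∈ cor T y, y ∈ ext P := by
  intro y hy P hP
  obtain ⟨g, hg, hgc⟩ := hT.mono x hx y hy
  rw [← hgc] at hP
  obtain ⟨Q, hQ, rfl⟩ := hP
  change y ∈ ext (g • Q)
  rw [← hg, mem_ext_mot]
  exact h Q hQ

open Classical in
lemma wd {x : ℂ} (hx : x ∈ V T) {P : Set ℂ} (hP : P ∈ cor T x) :
    Wd (cor T x).ncard (fun i => x ∈ ext (sq T x P i)) (fun i => Rg (sq T x P i))
      (fun i => (ext (sq T x P i)).ncard) (fun i j => peq (sq T x P i) x (sq T x P j) x)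
      (fun i j => cong (sq T x P i) (sq T x P j)) := by
  have hm := hT.sq_mem hx hP
  have pl := fun i => hT.poly _ (hm i).1
  refine ⟨fun i => peq.refl _ _, fun i j h => h.symm, fun i j l h h' => h.trans h', fun i j h => h.symm,
    fun i j l h h' => h.trans h', fun i j h => h.cong, fun i j h => h.ext.1, fun i j h => h.ncard,
    fun i j h => h.Rg.1, ?_, fun i => (pl i).three_le, ?_, ?_, ?_, ?_, ?_⟩
  · intro i j ei ej hR hc
    have hR' := hc.Rg.1 hR
    obtain ⟨g, hg⟩ := hc
    have h1 : peq (sq T x P i) x (sq T x P j) (g • x) := ⟨g, hg, rfl⟩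
    exact h1.trans (hR' _ (h1.ext.1 ei) _ ej)
  · intro i hi j hj hij
    exact hT.one_straight hx (hm i) (hm j) (fun h => hij (hT.sq_inj hx hP hi hj h))
  · rw [← hT.N1 hx, hT.sum_sq hx hP (fun Q => wt Q x)]
    rfl
  · intro i ei
    refine ⟨oo (sq T x P i) x, (pl i).oo_pos ei, (pl i).oo_Rg ei, (pl i).oo_le ei, ?_⟩
    have := hT.N2 (Q := sq T x P i) ⟨(hm i).1, ei⟩
    rw [hT.sum_sq hx hP (fun Q => if peq Q x (sq T x P i) x then 1 else 0),
      hT.sum_sq hx hP (fun Q => if x ∈ ext Q ∧ cong Q (sq T x P i) then 1 else 0)] at this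
    exact this
  · intro he i R1 R2 hmm h34
    have hns := hT.ns_all hx (by
      intro Q hQ
      obtain ⟨i, hi, rfl⟩ := hT.sq_ex hx hP hQ
      exact he i hi)
    have hsc : Sc T x (sq T x P i) (sq T x P (i + 1)) := by rw [sq_succ]; exact hT.sc_spec hx (hm i)
    exact REG (pl i) (pl _) R1 R2 hmm h34 (hns x hx _ (hm i)) (hns x hx _ (hm _)) (hT.full hns hx hsc)
  · intro i
    change peq _ _ _ _
    rw [hT.sq_per hx hP]; exact peq.refl _ _

lemma Sc_r {x : ℂ} (hx : x ∈ V T) {P Q : Set ℂ} {r : Mot} (hr : r • x = x) (h : Sc T x P Q)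
    (hP : r • P ∈ cor T x) (hQ : r • Q ∈ cor T x) : Sc T x (r • P) (r • Q) := by
  obtain ⟨h1, h2, s, hs, h3⟩ := h
  refine ⟨hP, hQ, s, hs, ?_⟩
  have e1 := (hT.poly P h1.1).pv_mot r h1.2 (hT.vnotint hx h1.1)
  have e2 := (hT.poly Q h2.1).nx_mot r h2.2 (hT.vnotint hx h2.1)
  rw [hr] at e1 e2
  have : ∀ z, r • z - x = rot r * (z - x) := fun z => by rw [← smul_sub', hr]
  rw [e1, e2, this, this, h3, mul_smul_comm]

lemma bad1 {x : ℂ} (hx : x ∈ V T) {P : Set ℂ} (hP : P ∈ cor T x) {r : Mot} (hr : r • x = x)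
    (h2 : r • sc T x P ∈ cor T x) (hb : r • cor T x ≠ cor T x)
    {j : ℕ} (hj : 1 ≤ j) (hjk : 2 * j ≤ (cor T x).ncard) (hjr : r • P = sq T x P j) :
    Ex1 T x P ∨ Ex2 T x P ∨ Ex3 T x P ∨ Ex4 T x P := by
  have hm := hT.sq_mem hx hP
  have w := hT.wd hx hP
  have hs := hT.Sc_r hx hr (hT.sc_spec hx hP) (hjr ▸ hm j) h2
  have h1 : r • sc T x P = sq T x P (j + 1) := by
    rw [sq_succ, ← hjr]; exact (hT.sc_eq hx hs).symm
  have hex : ∃ i < (cor T x).ncard, x ∈ ext (sq T x P i) := by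
    obtain ⟨Q, hQ, hxQ⟩ := hx
    obtain ⟨i, hi, rfl⟩ := hT.sq_ex ⟨Q, hQ, hxQ⟩ hP (Q := Q) ⟨hQ, extremePoints_subset hxQ⟩
    exact ⟨i, hi, hxQ⟩
  have := w.main hex hj hjk (by rw [← hjr, sq_zero]; exact ⟨r, rfl, hr⟩)
    (by rw [← h1, sq_succ, sq_zero]; exact ⟨r, rfl, hr⟩)
  rcases this with h | h
  · exact absurd (hT.shift_all hx hP hr hjr h) hb
  · exact h

theorem bad {x : ℂ} (hx : x ∈ V T) {P : Set ℂ} (hP : P ∈ cor T x) {r : Mot} (hr : r • x = x)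
    (h1 : r • P ∈ cor T x) (h2 : r • sc T x P ∈ cor T x) (hb : r • cor T x ≠ cor T x) :
    ∃ Q ∈ cor T x, peq P x Q x ∧ peq (sc T x P) x (sc T x Q) x ∧
      (Ex1 T x Q ∨ Ex2 T x Q ∨ Ex3 T x Q ∨ Ex4 T x Q) := by
  obtain ⟨j, hj, hjr⟩ := hT.sq_ex hx hP h1
  have hj0 : j ≠ 0 := by
    rintro rfl
    rw [sq_zero] at hjr
    have := mot_one_of_fix (hT.poly P hP.1) hP.2 (hT.vnotint hx hP.1) hr hjr.symm
    exact hb (by rw [this, one_smul])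
  have hs := hT.sc_eq hx (hT.Sc_r hx hr (hT.sc_spec hx hP) h1 h2)
  by_cases hjk : 2 * j ≤ (cor T x).ncard
  · exact ⟨P, hP, peq.refl _ _, peq.refl _ _, hT.bad1 hx hP hr h2 hb (by omega) hjk hjr.symm⟩
  · refine ⟨r • P, h1, ⟨r, rfl, hr⟩, ⟨r, hs.symm, hr⟩, ?_⟩
    refine hT.bad1 hx h1 (r := r⁻¹) (by rw [inv_smul_eq_iff, hr]) ?_ ?_ (j := (cor T x).ncard - j) (by omega) (by omega) ?_
    · rw [hs, inv_smul_smul]; exact (hT.sc_spec hx hP).2.1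
    · intro h
      apply hb
      nth_rw 1 [← h]
      rw [smul_inv_smul]
    · rw [inv_smul_smul, ← hjr, ← sq_add, show (cor T x).ncard - j + j = 0 + (cor T x).ncard by omega,
        hT.sq_per hx hP, sq_zero]

end Til
end MC

namespace MC
open MeasureTheory
open scoped Pointwise

namespace Poly
variable {P : Set ℂ} (hP : Poly P)
include hP

lemma back_aux {x a z : ℂ} (hx : x ∈ P) (ha : a ∈ P) (hxa : x ≠ a) (hz : z ∈ ext P) {s : ℝ} (hs : 0 < s)
    (h : z - a = s • (x - a)) : 1 ≤ s := by
  by_contra hlt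
  push Not at hlt
  have h1 : 1 - s ≠ 0 := by linarith
  have hz' : z = a + s • (x - a) := by rw [← h]; ring
  have := Poly.ext_not_seg hz hx ha (t := (1 - s) / s) (div_pos (by linarith) hs) (by
    rw [hz']
    match_scalars <;> field_simp <;> ring)
  exact hxa (this.1.trans this.2.symm)

lemma back_Lt {x a : ℂ} (hx : x ∈ P) (ha : a ∈ P) (hi : a ∉ interior P) (hxa : x ≠ a)
    (h : ∀ p ∈ P, 0 ≤ cr (a - x) (p - x)) : ∃ c : ℝ, 1 ≤ c ∧ pv P a - a = c • (x - a) := by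
  obtain ⟨s, hs, h1⟩ := hP.onLt ha hi (K_of_mem hx) (sub_ne_zero.2 hxa) (by
    rintro v ⟨t, ht, hv⟩
    have h2 := h _ hv
    have h3 : cr (a - x) (a + t • v - x) = t * cr (a - x) v := by
      rw [show a + t • v - x = (a - x) + t • v by ring, cr_add_right, cr_self, cr_smul_right, zero_add]
    rw [h3] at h2
    have h4 := nonneg_of_mul_nonneg_right h2 ht
    rw [show x - a = -(a - x) by ring, cr_neg_left]; linarith)
  exact ⟨s, hP.back_aux hx ha hxa (hP.pv_spec hi).1 hs h1, h1⟩

lemma back_Rt {x a : ℂ} (hx : x ∈ P) (ha : a ∈ P) (hi : a ∉ interior P) (hxa : x ≠ a)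
    (h : ∀ p ∈ P, 0 ≤ cr (p - x) (a - x)) : ∃ c : ℝ, 1 ≤ c ∧ nx P a - a = c • (x - a) := by
  obtain ⟨s, hs, h1⟩ := hP.onRt ha hi (K_of_mem hx) (sub_ne_zero.2 hxa) (by
    rintro v ⟨t, ht, hv⟩
    have h2 := h _ hv
    have h3 : cr (a + t • v - x) (a - x) = t * cr v (a - x) := by
      rw [show a + t • v - x = (a - x) + t • v by ring, cr_add_left, cr_self, cr_smul_left, zero_add]
    rw [h3] at h2
    have h4 := nonneg_of_mul_nonneg_right h2 ht
    rw [show x - a = -(a - x) by ring, cr_neg_left, ← cr_swap]; exact h4)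
  exact ⟨s, hP.back_aux hx ha hxa (hP.nx_spec hi).1 hs h1, h1⟩

end Poly

/-- elementary edges -/
def El (T : Set (Set ℂ)) (x x' : ℂ) (P P' : Set ℂ) : Prop :=
  x ∈ V T ∧ x' ∈ V T ∧ x ≠ x' ∧ Sc T x P' P ∧ Sc T x' P P' ∧ (x' ∈ ext P ∨ x' ∈ ext P') ∧
  (∃ c : ℝ, 1 ≤ c ∧ pv P x' - x' = c • (x - x')) ∧ (∃ c : ℝ, 1 ≤ c ∧ nx P' x' - x' = c • (x - x'))

namespace Til
variable {T : Set (Set ℂ)} (hT : Til T)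
include hT

lemma El_of {x x' : ℂ} {P P' : Set ℂ} (hx : x ∈ V T) (h : Sc T x P' P) (hP : x' ∈ P) (hP' : x' ∈ P')
    {s s' : ℝ} (hs : 0 < s) (hs' : 0 < s') (e : x' - x = s • (nx P x - x)) (e' : x' - x = s' • (pv P' x - x))
    (hext : x' ∈ ext P ∨ x' ∈ ext P') : El T x x' P P' := by
  have hc := h.2.1
  have hc' := h.1
  have pP := hT.poly P hc.1
  have pP' := hT.poly P' hc'.1
  have hx' : x' ∈ V T := by
    rcases hext with h | h
    · exact ⟨P, hc.1, h⟩
    · exact ⟨P', hc'.1, h⟩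
  have hne : x ≠ x' := by
    intro h
    rw [← h, sub_self] at e
    have := (smul_eq_zero.1 e.symm).resolve_left hs.ne'
    exact (pP.nx_spec (hT.vnotint hx hc.1)).2.1 (sub_eq_zero.1 this)
  have b1 := pP.back_Lt hc.2 hP (hT.vnotint hx' hc.1) hne (by
    intro p hp
    rw [e, cr_smul_left]
    exact mul_nonneg hs.le ((pP.nx_spec (hT.vnotint hx hc.1)).2.2 p hp))
  have b2 := pP'.back_Rt hc'.2 hP' (hT.vnotint hx' hc'.1) hne (by
    intro p hp
    rw [e', cr_smul_right]
    exact mul_nonneg hs'.le ((pP'.pv_spec (hT.vnotint hx hc'.1)).2.2 p hp))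
  refine ⟨hx, hx', hne, h, ⟨⟨hc.1, hP⟩, ⟨hc'.1, hP'⟩, ?_⟩, hext, b1, b2⟩
  obtain ⟨c, h1, h2⟩ := b1
  obtain ⟨c', h1', h2'⟩ := b2
  refine ⟨c' / c, by positivity, ?_⟩
  rw [h2', h2, smul_smul, div_mul_cancel₀ _ (by linarith)]

lemma El_exists {x : ℂ} {P : Set ℂ} (hx : x ∈ V T) (hc : P ∈ cor T x) :
    ∃ x' P', El T x x' P P' ∧ ∃ s : ℝ, 0 < s ∧ s ≤ 1 ∧ x' - x = s • (nx P x - x) := by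
  obtain ⟨P', hc', hsc⟩ := (hT.sc_bij hx).surjOn hc
  have h := hT.sc_spec hx hc'
  rw [hsc] at h
  obtain ⟨_, _, s, hs, e⟩ := id h
  have pP := hT.poly P hc.1
  have pP' := hT.poly P' hc'.1
  have hn := (pP.nx_spec (hT.vnotint hx hc.1)).1
  have hv := (pP'.pv_spec (hT.vnotint hx hc'.1)).1
  by_cases h1 : s ≤ 1
  · refine ⟨nx P x, P', hT.El_of hx h (extremePoints_subset hn) ?_ one_pos hs (by rw [one_smul]) e (Or.inl hn),
      1, one_pos, le_rfl, by rw [one_smul]⟩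
    have : nx P x = (1 - s) • x + s • pv P' x := by
      rw [← sub_add_cancel (nx P x) x, e]; module
    rw [this]
    exact pP'.cvx hc'.2 (extremePoints_subset hv) (by linarith) hs.le (by ring)
  · have e' : pv P' x - x = s⁻¹ • (nx P x - x) := by rw [e, inv_smul_smul₀ hs.ne']
    have h2 : s⁻¹ ≤ 1 := inv_le_one_of_one_le₀ (by linarith)
    refine ⟨pv P' x, P', hT.El_of hx h ?_ (extremePoints_subset hv) (inv_pos.2 hs) one_pos e'
      (by rw [one_smul]) (Or.inr hv), s⁻¹, inv_pos.2 hs, h2, e'⟩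
    have : pv P' x = (1 - s⁻¹) • x + s⁻¹ • nx P x := by
      rw [← sub_add_cancel (pv P' x) x, e']; module
    rw [this]
    exact pP.cvx hc.2 (extremePoints_subset hn) (by linarith) (by positivity) (by ring)

lemma V_fin (x : ℂ) (R : ℝ) : (V T ∩ Metric.closedBall x R).Finite := by
  obtain ⟨A, B, h⟩ := hT.V_growth
  refine ((h (max 0 (R + ‖x‖)) (le_max_left _ _)).1).subset ?_
  rintro z ⟨hz, hz'⟩
  refine ⟨hz, ?_⟩
  rw [Metric.mem_closedBall] at hz' ⊢
  refine le_trans ?_ (le_max_right _ _)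
  calc dist z 0 ≤ dist z x + dist x 0 := dist_triangle _ _ _
    _ ≤ R + ‖x‖ := by rw [dist_zero_right]; linarith

/-- walking along an edge -/
lemma walk {A : Set ℂ} (hA : A ⊆ V T) (hcl : ∀ x x' P P', El T x x' P P' → x ∈ A → x' ∈ A)
    {x : ℂ} (hx : x ∈ A) {P : Set ℂ} (hc : P ∈ cor T x) {t : ℝ} (ht0 : 0 ≤ t) (ht1 : t ≤ 1) :
    x + t • (nx P x - x) ∈ A ∨ ∃ z z' P', El T z z' P P' ∧ z ∈ A ∧
      (∃ s s' : ℝ, z = x + s • (nx P x - x) ∧ z' = x + s' • (nx P x - x) ∧ s ≤ t ∧ t ≤ s' ∧ s' ≤ 1) := by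
  have pP := hT.poly P hc.1
  set d := nx P x - x with hd
  have iP := hT.vnotint (hA hx) hc.1
  have hd0 : d ≠ 0 := sub_ne_zero.2 (pP.nx_spec iP).2.1
  let S : Set ℝ := {s | 0 ≤ s ∧ s ≤ t ∧ x + s • d ∈ A}
  have hinj : Function.Injective (fun s : ℝ => x + s • d) := by
    intro s s' h
    simp only [add_right_inj] at h
    exact smul_left_injective ℝ hd0 h
  have hfin : S.Finite := by
    refine Finite.of_finite_image ((hT.V_fin x ‖d‖).subset ?_) (f := fun s : ℝ => x + s • d) hinj.injOn
    rintro _ ⟨s, ⟨h1, h2, h3⟩, rfl⟩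
    refine ⟨hA h3, ?_⟩
    simp only [Metric.mem_closedBall, dist_eq_norm, add_sub_cancel_left, norm_smul, Real.norm_of_nonneg h1]
    nlinarith [norm_nonneg d]
  obtain ⟨s, ⟨s0, s1, s2⟩, hmax⟩ := hfin.exists_maximal ⟨0, le_rfl, ht0, by simpa using hx⟩
  by_cases hst : s = t
  · left; rw [← hst]; exact s2
  right
  have hlt : s < t := lt_of_le_of_ne s1 hst
  set z := x + s • d with hz
  have hn := (pP.nx_spec iP)
  have zP : z ∈ P := by
    have : z = (1 - s) • x + s • nx P x := by rw [hz, hd]; module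
    rw [this]
    exact pP.cvx hc.2 (extremePoints_subset hn.1) (by linarith) s0 (by ring)
  have hnz : nx P x - z = (1 - s) • d := by rw [hz, hd]; module
  have nxz : nx P z = nx P x := by
    refine pP.nx_eq zP ⟨hn.1, ?_, ?_⟩
    · rw [← sub_ne_zero, hnz]
      exact smul_ne_zero (by linarith) hd0
    · intro p hp
      rw [hnz, cr_smul_left, hz, show p - (x + s • d) = (p - x) - s • d by ring, cr_sub_right, cr_smul_right,
        cr_self, mul_zero, sub_zero]
      exact mul_nonneg (by linarith) (hn.2.2 p hp)
  obtain ⟨z', P', hE, u, u0, u1, hu⟩ := hT.El_exists (hA s2) ⟨hc.1, zP⟩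
  have hz'A := hcl _ _ _ _ hE s2
  have hz'e : z' = x + (s + u * (1 - s)) • d := by
    rw [nxz, hnz, smul_smul] at hu
    rw [← sub_add_cancel z' z, hu, hz]; module
  have hle : s < s + u * (1 - s) := by
    have : 0 < u * (1 - s) := mul_pos u0 (by linarith)
    linarith
  refine ⟨z, z', P', hE, s2, s, s + u * (1 - s), rfl, hz'e, s1, ?_, by nlinarith⟩
  by_contra hcon
  have := hmax (y := s + u * (1 - s)) ⟨by linarith, by linarith, hz'e ▸ hz'A⟩ hle.le
  linarith

lemma walk_nx {A : Set ℂ} (hA : A ⊆ V T) (hcl : ∀ x x' P P', El T x x' P P' → x ∈ A → x' ∈ A)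
    {x : ℂ} (hx : x ∈ A) {P : Set ℂ} (hc : P ∈ cor T x) : nx P x ∈ A := by
  rcases hT.walk hA hcl hx hc zero_le_one le_rfl with h | ⟨z, z', P', hE, hz, s, s', _, h2, _, h3, h4⟩
  · simpa using h
  · have : s' = 1 := le_antisymm h4 h3
    rw [this] at h2
    have := hcl _ _ _ _ hE hz
    rw [h2] at this
    simpa using this

lemma closed_sub {S : Set (Set ℂ)} (hS : S ⊆ T) : IsClosed (⋃₀ S) := by
  rw [← isOpen_compl_iff, Metric.isOpen_iff]
  intro x hx
  obtain ⟨r, hr, h⟩ := hT.locl x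
  refine ⟨r, hr, ?_⟩
  rintro z hz ⟨P, hP, hzP⟩
  exact hx ⟨P, hP, h P (hS hP) ⟨z, hzP, hz⟩⟩

theorem conn {A : Set ℂ} (hA : A ⊆ V T) (hne : A.Nonempty)
    (hcl : ∀ x x' P P', El T x x' P P' → x ∈ A → x' ∈ A) : V T ⊆ A := by
  have hext : ∀ P ∈ T, (P ∩ A).Nonempty → ext P ⊆ A := by
    rintro P hP ⟨x, hxP, hxA⟩
    have pP := hT.poly P hP
    have h1 := hT.walk_nx hA hcl hxA (P := P) ⟨hP, hxP⟩
    have h2 := (pP.nx_spec (hT.vnotint (hA hxA) hP)).1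
    have := pP.ext_closed' (O := ext P ∩ A) inter_subset_left ⟨_, h2, h1⟩ (by
      rintro y ⟨hy, hyA⟩
      exact ⟨pP.nx_ext hy, hT.walk_nx hA hcl hyA ⟨hP, extremePoints_subset hy⟩⟩)
    rw [← this]; exact inter_subset_right
  by_contra hcon
  obtain ⟨v, hv, hvA⟩ := not_subset.1 hcon
  have hpre : IsPreconnected (V T)ᶜ :=
    (hT.V_countable.isPathConnected_compl_of_one_lt_rank (by rw [Complex.rank_real_complex]; norm_num)).isConnected.isPreconnected
  rw [isPreconnected_closed_iff] at hpre
  have hin : ∀ P ∈ T, ((V T)ᶜ ∩ P).Nonempty := by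
    intro P hP
    obtain ⟨c, hc⟩ := (hT.poly P hP).nei
    exact ⟨c, fun h => hT.vnotint h hP hc, interior_subset hc⟩
  obtain ⟨p, hpV, ⟨P, ⟨hP, hPA⟩, hpP⟩, ⟨Q, ⟨hQ, hQA⟩, hpQ⟩⟩ := hpre (⋃₀ {P ∈ T | (P ∩ A).Nonempty}) (⋃₀ {P ∈ T | ¬ (P ∩ A).Nonempty})
    (hT.closed_sub fun P h => h.1) (hT.closed_sub fun P h => h.1) (by
      intro z _
      obtain ⟨P, hP, hz⟩ := hT.cover z
      by_cases h : (P ∩ A).Nonempty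
      · left; exact ⟨P, ⟨hP, h⟩, hz⟩
      · right; exact ⟨P, ⟨hP, h⟩, hz⟩) (by
      obtain ⟨a, ha⟩ := hne
      obtain ⟨P, hP, haP⟩ := hA ha
      obtain ⟨c, h1, h2⟩ := hin P hP
      exact ⟨c, h1, P, ⟨hP, a, extremePoints_subset haP, ha⟩, h2⟩) (by
      obtain ⟨P, hP, hvP⟩ := hv
      obtain ⟨c, h1, h2⟩ := hin P hP
      exact ⟨c, h1, P, ⟨hP, fun h => hvA (hext P hP h hvP)⟩, h2⟩)
  have hPQ : P ≠ Q := by rintro rfl; exact hQA hPA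
  have pP := hT.poly P hP
  have iP := hT.notint2 ⟨hP, hpP⟩ ⟨hQ, hpQ⟩ hPQ
  have iQ := hT.notint2 ⟨hQ, hpQ⟩ ⟨hP, hpP⟩ hPQ.symm
  have nP : p ∉ ext P := fun h => hpV ⟨P, hP, h⟩
  have ha := pP.nx_spec iP
  have hb := pP.pv_spec iP
  obtain ⟨t, ht, hstr⟩ := pP.straight hpP nP ha hb
  set a := nx P p
  set b := pv P p
  have hbA : b ∈ A := hext P hP hPA hb.1
  have hab : a - b = (1 + t) • (a - p) := by
    rw [show a - b = (a - p) - (b - p) by ring, hstr]; module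
  have hnb : nx P b = a := by
    refine pP.nx_eq (extremePoints_subset hb.1) ⟨ha.1, ?_, ?_⟩
    · rw [← sub_ne_zero, hab]
      exact smul_ne_zero (by linarith) (sub_ne_zero.2 ha.2.1)
    · intro q hq
      rw [hab, cr_smul_left, show q - b = (q - p) - (b - p) by ring, hstr, cr_sub_right, cr_smul_right, cr_self,
        mul_zero, sub_zero]
      exact mul_nonneg (by linarith) (ha.2.2 q hq)
  have hp : p = b + (t / (1 + t)) • (nx P b - b) := by
    have : b = p + (b - p) := by ring
    rw [hnb, hab, smul_smul, div_mul_cancel₀ _ (by linarith), this, hstr]; module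
  have hw := hT.walk hA hcl hbA (P := P) ⟨hP, extremePoints_subset hb.1⟩ (t := t / (1 + t)) (by positivity)
    (by rw [div_le_one (by linarith)]; linarith)
  rw [← hp] at hw
  rcases hw with h | ⟨z, z', R, hE, hz, s, s', e1, e2, h1, h2, h3⟩
  · exact hpV (hA h)
  obtain ⟨_, _, hzz, hsc, hsc', _⟩ := hE
  have hRP : P ≠ R := by
    have := hT.sc_ne (hA hz) hsc.1
    rw [hT.sc_eq (hA hz) hsc] at this
    exact this
  have hRQ : R ≠ Q := by
    rintro rfl
    exact hQA ⟨z, hsc.1.2, hz⟩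
  have hR := hsc.1.1
  have hpR : p ∈ R := by
    have hss : s ≠ s' := by
      rintro rfl
      exact hzz (e1.trans e2.symm)
    have hss' : s < s' := lt_of_le_of_ne (h1.trans h2) hss
    set τ := t / (1 + t)
    have : p = ((s' - τ) / (s' - s)) • z + ((τ - s) / (s' - s)) • z' := by
      rw [hp, e1, e2]
      have : s' - s ≠ 0 := by linarith
      match_scalars <;> field_simp <;> ring
    rw [this]
    exact (hT.poly R hR).cvx hsc.1.2 hsc'.2.1.2 (div_nonneg (by linarith) (by linarith))
      (div_nonneg (by linarith) (by linarith)) (by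
        have : s' - s ≠ 0 := by linarith
        field_simp; ring)
  have hs := hT.sum_le (x := p) {P, R, Q} (by
    intro X hX
    simp only [Finset.mem_insert, Finset.mem_singleton] at hX
    rcases hX with rfl | rfl | rfl
    · exact ⟨hP, hpP⟩
    · exact ⟨hR, hpR⟩
    · exact ⟨hQ, hpQ⟩)
  rw [Finset.sum_insert (by simp [hRP, hPQ]), Finset.sum_insert (by simp [hRQ]), Finset.sum_singleton,
    pP.mu_straight hpP iP nP, (hT.poly R hR).mu_straight hpR (hT.notint2 ⟨hR, hpR⟩ ⟨hQ, hpQ⟩ hRQ) (fun h => hpV ⟨R, hR, h⟩)] at hs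
  have := (hT.poly Q hQ).mu_pos hpQ
  linarith

end Til
end MC

namespace MC
open MeasureTheory
open scoped Pointwise

/-- a labelling of all coronae compatible with the base corona at `x0` started at `Q` -/
structure Fr (T : Set (Set ℂ)) (k : ℕ) (x0 : ℂ) (Q : Set ℂ) (p : ℂ → ℕ → Set ℂ) : Prop where
  hx0 : x0 ∈ V T
  hQ : Q ∈ cor T x0
  kpos : 0 < k
  mem : ∀ x ∈ V T, ∀ i, p x i ∈ cor T x
  succ : ∀ x ∈ V T, ∀ i, sc T x (p x i) = p x (i + 1)
  per : ∀ x ∈ V T, ∀ i, p x (i + k) = p x i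
  ex : ∀ x ∈ V T, ∀ P ∈ cor T x, ∃ i < k, p x i = P
  inj : ∀ x ∈ V T, ∀ i < k, ∀ j < k, p x i = p x j → i = j
  pq : ∀ x ∈ V T, ∀ i, peq (sq T x0 Q i) x0 (p x i) x

/-- `J x i y j`: the tile number `i` at `x` is the tile number `j` at its next corner `y` -/
def J (T : Set (Set ℂ)) (p : ℂ → ℕ → Set ℂ) (x : ℂ) (i : ℕ) (y : ℂ) (j : ℕ) : Prop :=
  x ∈ V T ∧ x ∈ ext (p x i) ∧ nx (p x i) x = y ∧ p y j = p x i

namespace Til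
variable {T : Set (Set ℂ)} (hT : Til T)
include hT

lemma frame {x0 : ℂ} (hx0 : x0 ∈ V T) {Q : Set ℂ} (hQ : Q ∈ cor T x0) :
    ∃ p, Fr T (cor T x0).ncard x0 Q p := by
  have hm : ∀ x : ℂ, ∃ g : Mot, x ∈ V T → g • x0 = x ∧ g • cor T x0 = cor T x := by
    intro x
    by_cases hx : x ∈ V T
    · obtain ⟨g, hg⟩ := hT.mono x0 hx0 x hx
      exact ⟨g, fun _ => hg⟩
    · exact ⟨1, fun h => absurd h hx⟩
  choose g hg using hm
  have hs := hT.sq_mem hx0 hQ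
  refine ⟨fun x i => g x • sq T x0 Q i, hx0, hQ, ?_, ?_, ?_, ?_, ?_, ?_, ?_⟩
  · exact (Set.ncard_pos (hT.cor_finite x0)).2 ⟨Q, hQ⟩
  · intro x hx i; exact (mem_cor_mot (hg x hx).2).2 (hs i)
  · intro x hx i
    change sc T x (g x • sq T x0 Q i) = g x • sq T x0 Q (i + 1)
    rw [sq_succ]
    exact hT.sc_mot hx0 hx (hg x hx).1 (hg x hx).2 (hs i)
  · intro x hx i
    change g x • sq T x0 Q (i + _) = g x • sq T x0 Q i
    rw [hT.sq_per hx0 hQ]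
  · intro x hx P hP
    rw [← (hg x hx).2] at hP
    obtain ⟨P', hP', rfl⟩ := hP
    obtain ⟨i, hi, rfl⟩ := hT.sq_ex hx0 hQ hP'
    exact ⟨i, hi, rfl⟩
  · intro x hx i hi j hj h
    exact hT.sq_inj hx0 hQ hi hj (smul_left_cancel _ h)
  · intro x hx i
    exact ⟨g x, rfl, (hg x hx).1⟩
end Til

namespace Fr
variable {T : Set (Set ℂ)} (hT : Til T) {k : ℕ} {x0 : ℂ} {Q : Set ℂ} {p : ℂ → ℕ → Set ℂ}
  (F : Fr T k x0 Q p)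
include F

lemma pmod {x : ℂ} (hx : x ∈ V T) (i : ℕ) : p x (i % k) = p x i := by
  have : ∀ n i, p x (i + k * n) = p x i := by
    intro n
    induction n with
    | zero => intro i; simp
    | succ n ih => intro i; rw [mul_add, mul_one, ← add_assoc, F.per x hx, ih]
  conv_rhs => rw [← Nat.mod_add_div i k]
  rw [this]

lemma S_of {x y : ℂ} (hx : x ∈ V T) (hy : y ∈ V T) {i j : ℕ} (h : peq (p x i) x (p y j) y) :
    peq (sq T x0 Q i) x0 (sq T x0 Q j) x0 :=
  ((F.pq x hx i).trans h).trans (F.pq y hy j).symm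

lemma of_S {x y : ℂ} (hx : x ∈ V T) (hy : y ∈ V T) {i j : ℕ}
    (h : peq (sq T x0 Q i) x0 (sq T x0 Q j) x0) : peq (p x i) x (p y j) y :=
  ((F.pq x hx i).symm.trans h).trans (F.pq y hy j)

lemma Jfun {x y y' : ℂ} {i j j' : ℕ} (h : J T p x i y j) (h' : J T p x i y' j') : y = y' :=
  h.2.2.1.symm.trans h'.2.2.1

lemma Jmod {x y : ℂ} {i j : ℕ} (hy : y ∈ V T) : J T p x i y (j % k) ↔ J T p x i y j := by
  unfold J; rw [F.pmod hy]

lemma Jmod' {x y : ℂ} {i j : ℕ} (hx : x ∈ V T) : J T p x (i % k) y j ↔ J T p x i y j := by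
  unfold J; rw [F.pmod hx]

lemma idx {x : ℂ} (hx : x ∈ V T) {i j : ℕ} (h : p x i = p x j) : i % k = j % k := by
  rw [← F.pmod hx i, ← F.pmod hx j] at h
  exact F.inj x hx _ (Nat.mod_lt _ F.kpos) _ (Nat.mod_lt _ F.kpos) h

include hT
lemma poly {x : ℂ} (hx : x ∈ V T) (i : ℕ) : Poly (p x i) := hT.poly _ (F.mem x hx i).1

lemma Jext {x y : ℂ} {i j : ℕ} (h : J T p x i y j) : y ∈ ext (p y j) := by
  rw [h.2.2.2, ← h.2.2.1]; exact (F.poly hT h.1 i).nx_ext h.2.1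

lemma Jv {x y : ℂ} {i j : ℕ} (h : J T p x i y j) : y ∈ V T := by
  refine ⟨p x i, (F.mem x h.1 i).1, ?_⟩
  rw [← h.2.2.1]; exact (F.poly hT h.1 i).nx_ext h.2.1

lemma Jex {x : ℂ} (hx : x ∈ V T) {i : ℕ} (hi : x ∈ ext (p x i)) : ∃ y, ∃ j < k, J T p x i y j := by
  have h1 := (F.poly hT hx i).nx_ext hi
  have hV : nx (p x i) x ∈ V T := ⟨p x i, (F.mem x hx i).1, h1⟩
  obtain ⟨j, hj, h⟩ := F.ex _ hV (p x i) ⟨(F.mem x hx i).1, extremePoints_subset h1⟩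
  exact ⟨_, j, hj, hx, hi, rfl, h⟩

lemma Jidx {x y y' : ℂ} {i j j' : ℕ} (h : J T p x i y j) (h' : J T p x i y' j') (hj : j < k) (hj' : j' < k) :
    j = j' := by
  obtain rfl := F.Jfun h h'
  exact F.inj y (F.Jv hT h) j hj j' hj' (h.2.2.2.trans h'.2.2.2.symm)

lemma Jtri {x y z : ℂ} {i j l : ℕ} (h : J T p x i y j) (h' : J T p y j z l)
    (h3 : (ext (p x i)).ncard = 3) : J T p z l x i := by
  have hz := F.Jv hT h'
  refine ⟨hz, F.Jext hT h', ?_, ?_⟩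
  · have := (F.poly hT h.1 i).iter_card h.2.1
    rw [h3] at this
    simp only [Function.iterate_succ, Function.comp, Function.iterate_zero, id] at this
    rw [h.2.2.1] at this
    rw [h'.2.2.2, h.2.2.2, ← h'.2.2.1, h.2.2.2, this]
  · rw [h'.2.2.2, h.2.2.2]

lemma Jsqu {x y z w : ℂ} {i j l m : ℕ} (h : J T p x i y j) (h' : J T p y j z l) (h'' : J T p z l w m)
    (h3 : (ext (p x i)).ncard = 4) : J T p w m x i := by
  have hw := F.Jv hT h''
  refine ⟨hw, F.Jext hT h'', ?_, ?_⟩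
  · have := (F.poly hT h.1 i).iter_card h.2.1
    rw [h3] at this
    simp only [Function.iterate_succ, Function.comp, Function.iterate_zero, id] at this
    rw [h.2.2.1] at this
    rw [h''.2.2.2, h'.2.2.2, h.2.2.2, ← h''.2.2.1, h'.2.2.2, h.2.2.2, ← h'.2.2.1, h.2.2.2, this]
  · rw [h''.2.2.2, h'.2.2.2, h.2.2.2]

lemma Sc {x : ℂ} (hx : x ∈ V T) (i : ℕ) : Sc T x (p x i) (p x (i + 1)) := by
  rw [← F.succ x hx]; exact hT.sc_spec hx (F.mem x hx i)

lemma Jinv {x y : ℂ} {i j : ℕ} (h : J T p x (i + 1) y j) (hi : x ∈ ext (p x i))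
    (hf : pv (p x i) x = nx (p x (i + 1)) x) : J T p y (j + 1) x i := by
  obtain ⟨h1, h2, h3⟩ := hT.rev (F.Sc hT h.1 i) hi h.2.1 hf
  rw [h.2.2.1] at h1 h2 h3
  have h4 : p y (j + 1) = p x i := by
    rw [← F.succ y h1, h.2.2.2]; exact hT.sc_eq h1 h2
  refine ⟨h1, ?_, by rw [h4, h3], h4.symm⟩
  rw [h4, ← h.2.2.1, ← hf]
  exact (F.poly hT h.1 i).pv_ext hi

/-- the converse direction of the inversion -/
lemma Jinv' {x y : ℂ} {i j : ℕ} (h : J T p x i y j) (hi : y ∈ ext (p y (j + 1)))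
    (hf : pv (p y j) y = nx (p y (j + 1)) y) : ∃ l < k, J T p y (j + 1) x l ∧ (l + 1) % k = i % k := by
  have hy := F.Jv hT h
  have hx' : nx (p y (j + 1)) y = x := by
    rw [← hf, h.2.2.2, ← h.2.2.1]; exact (F.poly hT h.1 i).pv_nx h.2.1
  obtain ⟨z, l, hl, hJ⟩ := F.Jex hT hy hi
  obtain rfl : x = z := hx'.symm.trans hJ.2.2.1
  refine ⟨l, hl, hJ, ?_⟩
  have := F.Jinv hT hJ (F.Jext hT h) hf
  exact F.idx h.1 (this.2.2.2.symm.trans h.2.2.2)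

lemma JS {x y : ℂ} {i j : ℕ} (h : J T p x i y j) (hR : Rg (p x i)) :
    peq (sq T x0 Q i) x0 (sq T x0 Q j) x0 := by
  refine F.S_of h.1 (F.Jv hT h) ?_
  have := F.Jext hT h
  rw [h.2.2.2] at this ⊢
  exact hR _ h.2.1 _ this

/-- transfer of a corona map to labels -/
lemma rigid (hr : ∀ d < k, (∀ i, peq (sq T x0 Q i) x0 (sq T x0 Q (i + d)) x0) → d = 0)
    {x y : ℂ} (hx : x ∈ V T) (hy : y ∈ V T) {g : Mot} (hg : g • x = y) (hgc : g • cor T x = cor T y) (i : ℕ) :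
    g • p x i = p y i := by
  obtain ⟨d, hd, h0⟩ := F.ex y hy (g • p x 0) ((mem_cor_mot hgc).2 (F.mem x hx 0))
  have key : ∀ i, g • p x i = p y (i + d) := by
    intro i
    induction i with
    | zero => rw [zero_add, h0]
    | succ i ih =>
      rw [← F.succ x hx, ← hT.sc_mot hx hy hg hgc (F.mem x hx i), ih, F.succ y hy]
      congr 1; omega
  have : d = 0 := by
    apply hr d hd
    intro i
    exact F.S_of hx hy ⟨g, key i, hg⟩
  rw [key i, this, add_zero]

end Fr
end MC

namespace MC
open MeasureTheory
open scoped Pointwise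

/-- combinatorics of the pattern `F3` -/
lemma F3comb (D : ℕ → ℕ → Prop) (lt : ∀ i j, D i j → i < 5 ∧ j < 5)
    (cl : ∀ i j, D i j → ((i = 2 ∨ i = 4) ↔ (j = 2 ∨ j = 4)))
    (inv : ∀ i j, D i j → D ((j + 1) % 5) ((i + 4) % 5))
    (tri : ∀ i j, D i j → i ≠ 2 → i ≠ 4 → ∃ l, D j l ∧ D l i)
    (squ : ∀ j, D 4 j → ∃ l m, D j l ∧ D l m ∧ D m 4) :
    ∀ i < 5, ∃ t, ∀ j, D i j → j = t := by
  have h1 : ∀ j, D 1 j → j = 0 := by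
    intro j h
    have a := lt _ _ h; have b := cl _ _ h; have c := cl _ _ (inv _ _ h)
    omega
  have h0 : ∀ j, D 0 j → j = 3 := by
    intro j h
    have a := lt _ _ h; have b := cl _ _ h; have c := cl _ _ (inv _ _ h)
    have : j = 1 ∨ j = 3 := by omega
    rcases this with rfl | rfl
    · exfalso
      obtain ⟨l, hl, hl'⟩ := tri _ _ h (by omega) (by omega)
      obtain rfl := h1 l hl
      have a := lt _ _ hl'; have b := cl _ _ hl'; have c := cl _ _ (inv _ _ hl')
      omega
    · rfl
  have h2 : ∀ j, D 2 j → j = 2 := by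
    intro j h
    have a := lt _ _ h; have b := cl _ _ h
    have : j = 2 ∨ j = 4 := by omega
    rcases this with rfl | rfl
    · rfl
    · have := h0 _ (inv _ _ h); omega
  have h4 : ∀ j, D 4 j → j = 4 := by
    intro j h
    have a := lt _ _ h; have b := cl _ _ h
    have : j = 2 ∨ j = 4 := by omega
    rcases this with rfl | rfl
    · obtain ⟨l, m, a1, a2, a3⟩ := squ _ h
      obtain rfl := h2 _ a1
      obtain rfl := h2 _ a2
      exact absurd (h2 _ a3) (by omega)
    · rfl
  have h3 : ∀ j, D 3 j → j = 1 := by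
    intro j h
    have a := lt _ _ h; have b := cl _ _ h; have c := cl _ _ (inv _ _ h)
    have : j = 1 ∨ j = 3 := by omega
    rcases this with rfl | rfl
    · rfl
    · have := h4 _ (inv _ _ h); omega
  intro i hi
  have : i = 0 ∨ i = 1 ∨ i = 2 ∨ i = 3 ∨ i = 4 := by omega
  rcases this with rfl | rfl | rfl | rfl | rfl
  exacts [⟨_, h0⟩, ⟨_, h1⟩, ⟨_, h2⟩, ⟨_, h3⟩, ⟨_, h4⟩]

/-- combinatorics of the pattern `F4`; `c` is the class function `0 1 0 1 2 2` -/
lemma F4comb (D : ℕ → ℕ → Prop) (c : ℕ → ℕ) (c0 : c 0 = 0) (c1 : c 1 = 1) (c2 : c 2 = 0) (c3 : c 3 = 1)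
    (c4 : c 4 = 2) (c5 : c 5 = 2) (lt : ∀ i j, D i j → i < 6 ∧ j < 6)
    (ex : ∀ i < 6, ∃ j, D i j)
    (cl : ∀ i j i' j', D i j → D i' j' → c i = c i' → c j = c j')
    (ne : ∀ i j, D i j → c i ≠ c j)
    (inv : ∀ i j, D i j → D ((j + 1) % 6) ((i + 5) % 6))
    (tri : ∀ i j, D i j → ∃ l, D j l ∧ D l i) :
    ∀ i < 6, ∃ t, ∀ j, D i j → j = t := by
  have six : ∀ i < 6, i = 0 ∨ i = 1 ∨ i = 2 ∨ i = 3 ∨ i = 4 ∨ i = 5 := by intro i hi; omega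
  have cv : ∀ i < 6, (c i = 0 ∧ (i = 0 ∨ i = 2)) ∨ (c i = 1 ∧ (i = 1 ∨ i = 3)) ∨ (c i = 2 ∧ (i = 4 ∨ i = 5)) := by
    intro i hi
    rcases six i hi with rfl | rfl | rfl | rfl | rfl | rfl <;> simp [*]
  obtain ⟨j, hj⟩ := ex 0 (by omega)
  have hj1 : c j = 2 := by
    have a1 := ne _ _ hj
    have a2 := cv j (lt _ _ hj).2
    by_contra hcon
    obtain ⟨l, hl, hl'⟩ := tri _ _ hj
    have a3 := ne _ _ hl
    have a4 := ne _ _ hl'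
    have a5 := cv l (lt _ _ hl').1
    obtain ⟨m, hm⟩ := ex 4 (by omega)
    have a6 := cl _ _ _ _ hm hl' (by omega)
    have a7 := inv _ _ hm
    have a8 := cv m (lt _ _ hm).2
    have a9 : m = 0 ∨ m = 2 := by omega
    rcases a9 with rfl | rfl
    · have := cl _ _ _ _ a7 hl (by norm_num; omega)
      norm_num at this
      omega
    · have := cl _ _ _ _ a7 hl (by norm_num; omega)
      norm_num at this
      omega
  have s0 : ∀ i j, D i j → c i = 0 → c j = 2 := fun i j' h hc => by
    have := cl _ _ _ _ h hj (by omega); omega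
  obtain ⟨l, hl, hl'⟩ := tri _ _ hj
  have hl1 : c l = 1 := by
    have a3 := ne _ _ hl
    have a4 := ne _ _ hl'
    have a5 := cv l (lt _ _ hl').1
    omega
  have s2 : ∀ i j, D i j → c i = 2 → c j = 1 := fun i j' h hc => by
    have := cl _ _ _ _ h hl (by omega); omega
  have s1 : ∀ i j, D i j → c i = 1 → c j = 0 := fun i j' h hc => by
    have := cl _ _ _ _ h hl' (by omega); omega
  have t0 : ∀ j, D 0 j → j = 5 := by
    intro j h
    have a1 := s0 _ _ h c0
    have a2 := cv j (lt _ _ h).2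
    have a3 : j = 4 ∨ j = 5 := by omega
    rcases a3 with rfl | rfl
    · have := s2 _ _ (inv _ _ h) (by norm_num; omega)
      norm_num at this; omega
    · rfl
  have t2 : ∀ j, D 2 j → j = 4 := by
    intro j h
    have a1 := s0 _ _ h c2
    have a2 := cv j (lt _ _ h).2
    have a3 : j = 4 ∨ j = 5 := by omega
    rcases a3 with rfl | rfl
    · rfl
    · have := s0 _ _ (inv _ _ h) (by norm_num; omega)
      norm_num at this; omega
  have t4 : ∀ j, D 4 j → j = 3 := by
    intro j h
    have a1 := s2 _ _ h c4
    have a2 := cv j (lt _ _ h).2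
    have a3 : j = 1 ∨ j = 3 := by omega
    rcases a3 with rfl | rfl
    · have := s0 _ _ (inv _ _ h) (by norm_num; omega)
      norm_num at this; omega
    · rfl
  have t5 : ∀ j, D 5 j → j = 1 := by
    intro j h
    have a1 := s2 _ _ h c5
    have a2 := cv j (lt _ _ h).2
    have a3 : j = 1 ∨ j = 3 := by omega
    rcases a3 with rfl | rfl
    · rfl
    · have := s2 _ _ (inv _ _ h) (by norm_num; omega)
      norm_num at this; omega
  have t1 : ∀ j, D 1 j → j = 0 := by
    intro j h
    have a1 := s1 _ _ h c1
    have a2 := cv j (lt _ _ h).2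
    have a3 : j = 0 ∨ j = 2 := by omega
    rcases a3 with rfl | rfl
    · rfl
    · obtain ⟨l, b1, b2⟩ := tri _ _ h
      obtain rfl := t2 _ b1
      have := t4 _ b2; omega
  have t3 : ∀ j, D 3 j → j = 2 := by
    intro j h
    have a1 := s1 _ _ h c3
    have a2 := cv j (lt _ _ h).2
    have a3 : j = 0 ∨ j = 2 := by omega
    rcases a3 with rfl | rfl
    · obtain ⟨l, b1, b2⟩ := tri _ _ h
      obtain rfl := t0 _ b1
      have := t5 _ b2; omega
    · rfl
  intro i hi
  rcases six i hi with rfl | rfl | rfl | rfl | rfl | rfl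
  exacts [⟨_, t0⟩, ⟨_, t1⟩, ⟨_, t2⟩, ⟨_, t3⟩, ⟨_, t4⟩, ⟨_, t5⟩]

/-- local combinatorics of the pattern `F2` -/
structure F2s (J : ℂ → ℕ → ℂ → ℕ → Prop) (W : Set ℂ) : Prop where
  lt : ∀ x i y j, J x i y j → i < 5 ∧ j < 5 ∧ x ∈ W ∧ y ∈ W
  ex : ∀ x ∈ W, ∀ i < 5, ∃ y j, J x i y j
  fn : ∀ x i y j y' j', J x i y j → J x i y' j' → y = y' ∧ j = j'
  cl : ∀ x i y j, J x i y j → (i = 4 ↔ j = 4)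
  inv : ∀ x i y j, J x i y j → J y ((j + 1) % 5) x ((i + 4) % 5)
  tri : ∀ x i y j z l, J x i y j → J y j z l → i ≠ 4 → J z l x i

namespace F2s
variable {J : ℂ → ℕ → ℂ → ℕ → Prop} {W : Set ℂ} (F : F2s J W)
include F

lemma t4 {x y : ℂ} {j : ℕ} (h : J x 4 y j) : j = 4 := by have := F.cl _ _ _ _ h; omega
lemma t0 {x y : ℂ} {j : ℕ} (h : J x 0 y j) : j = 3 := by
  have a := F.lt _ _ _ _ h
  have := F.cl _ _ _ _ h; have := F.cl _ _ _ _ (F.inv _ _ _ _ h); omega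
lemma le2 {x y : ℂ} {i j : ℕ} (h : J x i y j) (h0 : i ≠ 0) (h4 : i ≠ 4) : j ≤ 2 := by
  have a := F.lt _ _ _ _ h
  have := F.cl _ _ _ _ h; have := F.cl _ _ _ _ (F.inv _ _ _ _ h); omega
lemma t3 {x y : ℂ} {j : ℕ} (h : J x 3 y j) : j = 1 ∨ j = 2 := by
  have a := F.le2 h (by omega) (by omega)
  have : j ≠ 0 := by
    rintro rfl
    obtain ⟨w, m, hw⟩ := F.ex _ (F.lt _ _ _ _ h).2.2.2 0 (by omega)
    obtain rfl := F.t0 hw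
    have := F.le2 (F.tri _ _ _ _ _ _ h hw (by omega)) (by omega) (by omega)
    omega
  omega
lemma t1 {x y : ℂ} {j : ℕ} (h : J x 1 y j) : j = 0 ∨ j = 1 := by
  have a := F.le2 h (by omega) (by omega)
  have : j ≠ 2 := by
    rintro rfl
    have := F.t3 (F.inv _ _ _ _ h); omega
  omega

/-- a vertex at which the tile 1 goes to 1 is of type II -/
lemma typeII {x y : ℂ} (h : J x 1 y 1) : (∃ z, J x 2 z 0) ∧ ∃ z, J x 3 z 2 := by
  obtain ⟨z, l, hz⟩ := F.ex _ (F.lt _ _ _ _ h).2.2.2 1 (by omega)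
  have hl := F.t1 hz
  have hz' : J z l x 1 := F.tri _ _ _ _ _ _ h hz (by omega)
  have : l = 1 := by
    rcases hl with rfl | rfl
    · have := F.t0 hz'; omega
    · rfl
  subst this
  have h2 : J x 2 z 0 := F.inv _ _ _ _ hz'
  refine ⟨⟨z, h2⟩, ?_⟩
  obtain ⟨w, m, hw⟩ := F.ex _ (F.lt _ _ _ _ h).2.2.1 3 (by omega)
  rcases F.t3 hw with rfl | rfl
  · exfalso
    have b : J w 2 x 2 := F.inv _ _ _ _ hw
    have := F.tri _ _ _ _ _ _ b h2 (by omega)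
    have := F.t0 this
    omega
  · exact ⟨w, hw⟩

/-- a vertex at which the tile 1 goes to 0 is of type I -/
lemma typeI {x y : ℂ} (h : J x 1 y 0) : (∃ z, J x 2 z 2) ∧ ∃ z, J x 3 z 1 := by
  obtain ⟨w, m, hw⟩ := F.ex _ (F.lt _ _ _ _ h).2.2.1 3 (by omega)
  have hwI := F.inv _ _ _ _ hw
  rcases F.t3 hw with rfl | rfl
  · refine ⟨?_, w, hw⟩
    have b : J w 2 x 2 := hwI
    obtain ⟨u, n, hu⟩ := F.ex _ (F.lt _ _ _ _ h).2.2.1 2 (by omega)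
    have c := F.tri _ _ _ _ _ _ b hu (by omega)
    have d := F.le2 hu (by omega) (by omega)
    have : n = 2 := by
      have : n = 0 ∨ n = 1 ∨ n = 2 := by omega
      rcases this with rfl | rfl | rfl
      · have := F.t0 c; omega
      · have := F.t1 c; omega
      · rfl
    subst this
    exact ⟨u, hu⟩
  · exfalso
    have b : J w 3 x 2 := hwI
    obtain ⟨u, n, hu⟩ := F.ex _ (F.lt _ _ _ _ h).2.2.1 2 (by omega)
    have c := F.tri _ _ _ _ _ _ b hu (by omega)
    have d := F.le2 hu (by omega) (by omega)
    have : n = 0 := by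
      have : n = 0 ∨ n = 1 ∨ n = 2 := by omega
      rcases this with rfl | rfl | rfl
      · rfl
      · have := F.t1 c; omega
      · have := F.le2 c (by omega) (by omega); omega
    subst this
    have e : J u 1 x 1 := F.inv _ _ _ _ hu
    have f := F.tri _ _ _ _ _ _ e h (by omega)
    have := F.t0 f; omega

lemma t1ex {x : ℂ} (hx : x ∈ W) : (∃ y, J x 1 y 0) ∨ ∃ y, J x 1 y 1 := by
  obtain ⟨y, j, h⟩ := F.ex x hx 1 (by omega)
  rcases F.t1 h with rfl | rfl
  exacts [Or.inl ⟨y, h⟩, Or.inr ⟨y, h⟩]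

lemma prop {x y : ℂ} {i j : ℕ} (h : J x i y j) (hx : ∃ z, J x 1 z 0) : ∃ z, J y 1 z 0 := by
  obtain ⟨z, hz⟩ := hx
  obtain ⟨⟨z2, h2⟩, z3, h3⟩ := F.typeI hz
  have hl := F.lt _ _ _ _ h
  rcases F.t1ex hl.2.2.2 with h' | ⟨u, hu⟩
  · exact h'
  exfalso
  obtain ⟨⟨u2, k2⟩, u3, k3⟩ := F.typeII hu
  have : i = 0 ∨ i = 1 ∨ i = 2 ∨ i = 3 ∨ i = 4 := by omega
  rcases this with rfl | rfl | rfl | rfl | rfl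
  · obtain rfl := F.t0 h
    have a := F.tri _ _ _ _ _ _ h k3 (by omega)
    have b : J x 1 u3 1 := F.inv _ _ _ _ a
    have := (F.fn _ _ _ _ _ _ hz b).2; omega
  · obtain rfl := (F.fn _ _ _ _ _ _ hz h).2
    have b : J y 1 x 0 := F.inv _ _ _ _ h
    have := (F.fn _ _ _ _ _ _ hu b).2; omega
  · obtain rfl := (F.fn _ _ _ _ _ _ h2 h).2
    have a := F.tri _ _ _ _ _ _ h k2 (by omega)
    have := F.t0 a; omega
  · obtain rfl := (F.fn _ _ _ _ _ _ h3 h).2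
    have a := F.tri _ _ _ _ _ _ h hu (by omega)
    have := F.t1 a; omega
  · obtain rfl := F.t4 h
    have a : J y 0 x 3 := F.inv _ _ _ _ h
    have b := F.tri _ _ _ _ _ _ a h3 (by omega)
    have c : J y 1 z3 0 := F.inv _ _ _ _ b
    have := (F.fn _ _ _ _ _ _ hu c).2; omega

lemma main (hc : ∀ A : Set ℂ, A ⊆ W → A.Nonempty → (∀ x i y j, J x i y j → x ∈ A → y ∈ A) → A = W) :
    ∀ i < 5, ∃ t, ∀ x y j, J x i y j → j = t := by
  have key : (∀ x ∈ W, ∃ y, J x 1 y 0) ∨ ∀ x ∈ W, ∃ y, J x 1 y 1 := by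
    by_cases h : ∃ x ∈ W, ∃ y, J x 1 y 0
    · left
      have := hc {x ∈ W | ∃ y, J x 1 y 0} (fun x hx => hx.1) h
        (fun x i y j hJ hx => ⟨(F.lt _ _ _ _ hJ).2.2.2, F.prop hJ hx.2⟩)
      intro x hx
      rw [← this] at hx
      exact hx.2
    · right
      intro x hx
      rcases F.t1ex hx with h' | h'
      · exact absurd ⟨x, hx, h'⟩ h
      · exact h'
  intro i hi
  have : i = 0 ∨ i = 1 ∨ i = 2 ∨ i = 3 ∨ i = 4 := by omega
  rcases key with key | key
  · rcases this with rfl | rfl | rfl | rfl | rfl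
    · exact ⟨3, fun x y j h => F.t0 h⟩
    · refine ⟨0, fun x y j h => ?_⟩
      obtain ⟨z, hz⟩ := key x (F.lt _ _ _ _ h).2.2.1
      exact (F.fn _ _ _ _ _ _ h hz).2
    · refine ⟨2, fun x y j h => ?_⟩
      obtain ⟨z, hz⟩ := key x (F.lt _ _ _ _ h).2.2.1
      obtain ⟨⟨w, hw⟩, -⟩ := F.typeI hz
      exact (F.fn _ _ _ _ _ _ h hw).2
    · refine ⟨1, fun x y j h => ?_⟩
      obtain ⟨z, hz⟩ := key x (F.lt _ _ _ _ h).2.2.1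
      obtain ⟨-, w, hw⟩ := F.typeI hz
      exact (F.fn _ _ _ _ _ _ h hw).2
    · exact ⟨4, fun x y j h => F.t4 h⟩
  · rcases this with rfl | rfl | rfl | rfl | rfl
    · exact ⟨3, fun x y j h => F.t0 h⟩
    · refine ⟨1, fun x y j h => ?_⟩
      obtain ⟨z, hz⟩ := key x (F.lt _ _ _ _ h).2.2.1
      exact (F.fn _ _ _ _ _ _ h hz).2
    · refine ⟨0, fun x y j h => ?_⟩
      obtain ⟨z, hz⟩ := key x (F.lt _ _ _ _ h).2.2.1
      obtain ⟨⟨w, hw⟩, -⟩ := F.typeII hz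
      exact (F.fn _ _ _ _ _ _ h hw).2
    · refine ⟨2, fun x y j h => ?_⟩
      obtain ⟨z, hz⟩ := key x (F.lt _ _ _ _ h).2.2.1
      obtain ⟨-, w, hw⟩ := F.typeII hz
      exact (F.fn _ _ _ _ _ _ h hw).2
    · exact ⟨4, fun x y j h => F.t4 h⟩
end F2s

end MC

namespace MC
open MeasureTheory
open scoped Pointwise

lemma El_full {T : Set (Set ℂ)} (hT : Til T) {x x' : ℂ} {P P' : Set ℂ} (h : El T x x' P P')
    (hx : x ∈ ext P) : pv P x' = x := by
  obtain ⟨h1, h2, h3, h4, h5, h6, ⟨c, hc, hc'⟩, h8⟩ := h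
  have pP := hT.poly P h5.1.1
  have hpv := pP.pv_spec (hT.vnotint h2 h5.1.1)
  rcases hc.eq_or_lt with rfl | hlt
  · rw [one_smul] at hc'; exact sub_left_injective hc'
  · have := Poly.ext_not_seg hx (extremePoints_subset hpv.1) h5.1.2 (t := c - 1) (by linarith) (by
      have e : pv P x' = x' + c • (x - x') := by rw [← hc']; ring
      rw [e]; module)
    exact this.1

/-- the label of the next corner is determined -/
def Dt (T : Set (Set ℂ)) (k : ℕ) (p : ℂ → ℕ → Set ℂ) (i : ℕ) : Prop :=
  ∃ t, ∀ x y j, j < k → J T p x i y j → j = t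

/-- no rotation symmetry of the word -/
def Rig (T : Set (Set ℂ)) (k : ℕ) (x0 : ℂ) (Q : Set ℂ) : Prop :=
  ∀ d < k, (∀ i, peq (sq T x0 Q i) x0 (sq T x0 Q (i + d)) x0) → d = 0

namespace Fr
variable {T : Set (Set ℂ)} (hT : Til T) {k : ℕ} {x0 : ℂ} {Q : Set ℂ} {p : ℂ → ℕ → Set ℂ}
  (F : Fr T k x0 Q p)
include hT F

lemma Jinv_all (hns : ∀ x ∈ V T, ∀ P ∈ cor T x, x ∈ ext P) {x y : ℂ} {i j : ℕ} (h : J T p x i y j) :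
    J T p y ((j + 1) % k) x ((i + (k - 1)) % k) := by
  have hk := F.kpos
  have hx := h.1
  have hy := F.Jv hT h
  rw [F.Jmod hx, F.Jmod' hy]
  refine F.Jinv hT ?_ (hns x hx _ (F.mem x hx _)) (hT.full hns hx (F.Sc hT hx _))
  have : i + (k - 1) + 1 = i + k := by omega
  rw [this, ← F.Jmod' hx, Nat.add_mod_right, F.Jmod' hx]
  exact h

lemma Jconn (hns : ∀ x ∈ V T, ∀ P ∈ cor T x, x ∈ ext P) (A : Set ℂ) (hA : A ⊆ V T) (hne : A.Nonempty)
    (hcl : ∀ x i y j, i < k → j < k → J T p x i y j → x ∈ A → y ∈ A) : A = V T := by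
  refine hA.antisymm (hT.conn hA hne ?_)
  intro x x' P P' hE hx
  have hP : P ∈ cor T x := hE.2.2.2.1.2.1
  have e := El_full hT hE (hns x hE.1 P hP)
  have e' : nx P x = x' := by
    rw [← e]; exact (hT.poly P hP.1).nx_pv (hns x' hE.2.1 P hE.2.2.2.2.1.1)
  obtain ⟨i, hi, rfl⟩ := F.ex x hE.1 P hP
  obtain ⟨y, j, hj, hJ⟩ := F.Jex hT hE.1 (hns x hE.1 _ hP)
  obtain rfl : x' = y := e'.symm.trans hJ.2.2.1
  exact hcl _ _ _ _ hi hj hJ hx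

lemma Jnc {x y : ℂ} {i j : ℕ} (h : J T p x i y j) :
    (ext (sq T x0 Q i)).ncard = (ext (sq T x0 Q j)).ncard := by
  rw [(F.pq x h.1 i).cong.ncard, ← h.2.2.2, ← (F.pq y (F.Jv hT h) j).cong.ncard]

lemma Jrg {x y : ℂ} {i j : ℕ} (h : J T p x i y j) :
    Rg (sq T x0 Q i) ↔ Rg (sq T x0 Q j) := by
  rw [(F.pq x h.1 i).cong.Rg, ← h.2.2.2, ← (F.pq y (F.Jv hT h) j).cong.Rg]

lemma JS' {x y : ℂ} {i j : ℕ} (h : J T p x i y j) (hR : Rg (sq T x0 Q i)) :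
    peq (sq T x0 Q i) x0 (sq T x0 Q j) x0 := F.JS hT h ((F.pq x h.1 i).cong.Rg.1 hR)

lemma Jtri' {x y z : ℂ} {i j l : ℕ} (h : J T p x i y j) (h' : J T p y j z l)
    (h3 : (ext (sq T x0 Q i)).ncard = 3) : J T p z l x i :=
  F.Jtri hT h h' (by rw [← (F.pq x h.1 i).cong.ncard]; exact h3)

lemma Jsqu' {x y z w : ℂ} {i j l m : ℕ} (h : J T p x i y j) (h' : J T p y j z l) (h'' : J T p z l w m)
    (h3 : (ext (sq T x0 Q i)).ncard = 4) : J T p w m x i :=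
  F.Jsqu hT h h' h'' (by rw [← (F.pq x h.1 i).cong.ncard]; exact h3)

/-- equal classes have equal successors -/
lemma Jcl {x y x' y' : ℂ} {i j i' j' : ℕ} (h : J T p x i y j) (h' : J T p x' i' y' j')
    (hS : peq (sq T x0 Q i) x0 (sq T x0 Q i') x0) : peq (sq T x0 Q j) x0 (sq T x0 Q j') x0 := by
  refine F.S_of (F.Jv hT h) (F.Jv hT h') ?_
  have := peq.nx (F.poly hT h.1 i) h.2.1 (F.of_S h.1 h'.1 hS)
  rw [h.2.2.1, h'.2.2.1] at this
  rwa [h.2.2.2, h'.2.2.2]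

lemma Jne {x y : ℂ} {i j : ℕ} (h : J T p x i y j) (hR : ¬ Rg (sq T x0 Q i)) :
    ¬ peq (sq T x0 Q i) x0 (sq T x0 Q j) x0 := by
  intro hS
  apply hR
  rw [(F.pq x h.1 i).cong.Rg]
  have := F.of_S h.1 (F.Jv hT h) hS
  rw [h.2.2.2, ← h.2.2.1] at this
  exact (F.poly hT h.1 i).Rg_of_nx h.2.1 this

end Fr

namespace Til
variable {T : Set (Set ℂ)} (hT : Til T)
include hT

lemma ns_of {x0 : ℂ} (hx : x0 ∈ V T) {Q : Set ℂ} (hQ : Q ∈ cor T x0)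
    (he : ∀ i < (cor T x0).ncard, x0 ∈ ext (sq T x0 Q i)) : ∀ y ∈ V T, ∀ P ∈ cor T y, y ∈ ext P :=
  hT.ns_all hx (by
    intro P hP
    obtain ⟨i, hi, rfl⟩ := hT.sq_ex hx hQ hP
    exact he i hi)

lemma ex2 {x0 : ℂ} (hx : x0 ∈ V T) {Q : Set ℂ} (hQ : Q ∈ cor T x0) (h : Ex2 T x0 Q) :
    (∀ y ∈ V T, ∀ P ∈ cor T y, y ∈ ext P) ∧ ∃ Q' p, Fr T 5 x0 Q' p ∧ Rig T 5 x0 Q' ∧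
      ∀ i < 5, Dt T 5 p i := by
  obtain ⟨hk, he, a, s1, s2, s3, s4, hR, hm⟩ := h
  have hns := hT.ns_of hx hQ he
  refine ⟨hns, ?_⟩
  set Q' := sq T x0 Q a with hQ'd
  have hQ' : Q' ∈ cor T x0 := hT.sq_mem hx hQ a
  have cv : ∀ i, sq T x0 Q (a + i) = sq T x0 Q' i := fun i => by rw [add_comm, sq_add]
  have hper := hT.sq_per hx hQ'
  obtain ⟨p, F⟩ := hT.frame hx hQ'
  rw [hk] at F hper
  simp only [cv] at s1 s2 s3 s4
  have e0 : Q' = sq T x0 Q' 0 := rfl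
  change Rg Q' at hR
  change (ext Q').ncard = 3 at hm
  change peq Q' _ _ _ at s1 s2 s3
  change ¬ peq Q' _ _ _ at s4
  rw [e0] at hR hm s1 s2 s3 s4
  clear_value Q'
  have hS : ∀ i < 5, i ≠ 4 → peq (sq T x0 Q' 0) x0 (sq T x0 Q' i) x0 := by
    intro i hi h4
    have : i = 0 ∨ i = 1 ∨ i = 2 ∨ i = 3 := by omega
    rcases this with rfl | rfl | rfl | rfl
    exacts [peq.refl _ _, s1, s2, s3]
  refine ⟨Q', p, F, ?_, ?_⟩
  · intro d hd h
    by_contra hd0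
    have := h 4
    have h5 : 4 + d = (d - 1) + 5 := by omega
    rw [h5, hper] at this
    exact s4 ((hS (d - 1) (by omega) (by omega)).trans this.symm)
  · have FF : F2s (fun x i y j => i < 5 ∧ j < 5 ∧ J T p x i y j) (V T) := by
      refine ⟨?_, ?_, ?_, ?_, ?_, ?_⟩
      · rintro x i y j ⟨h1, h2, h3⟩; exact ⟨h1, h2, h3.1, F.Jv hT h3⟩
      · intro x hx' i hi
        obtain ⟨y, j, hj, h⟩ := F.Jex hT hx' (i := i) (hns x hx' _ (F.mem x hx' i))
        exact ⟨y, j, hi, hj, h⟩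
      · rintro x i y j y' j' ⟨h1, h2, h3⟩ ⟨h1', h2', h3'⟩
        exact ⟨F.Jfun h3 h3', F.Jidx hT h3 h3' h2 h2'⟩
      · rintro x i y j ⟨h1, h2, h3⟩
        constructor
        · rintro rfl
          by_contra h4
          have r := (hS j h2 h4).cong.Rg.1 hR
          exact s4 ((hS j h2 h4).trans (F.JS' hT h3 ((F.Jrg hT h3).2 r)).symm)
        · rintro rfl
          by_contra h4
          have r := (hS i h1 h4).cong.Rg.1 hR
          exact s4 ((hS i h1 h4).trans (F.JS' hT h3 r))
      · rintro x i y j ⟨h1, h2, h3⟩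
        exact ⟨Nat.mod_lt _ (by omega), Nat.mod_lt _ (by omega), F.Jinv_all hT hns h3⟩
      · rintro x i y j z l ⟨h1, h2, h3⟩ ⟨h1', h2', h3'⟩ h4
        exact ⟨h2', h1, F.Jtri' hT h3 h3' (by rw [← (hS i h1 h4).cong.ncard, hm])⟩
    intro i hi
    obtain ⟨t, ht⟩ := FF.main (fun A hA hne hcl => F.Jconn hT hns A hA hne
      (fun x i y j h1 h2 h3 hx => hcl x i y j ⟨h1, h2, h3⟩ hx)) i hi
    exact ⟨t, fun x y j hj hJ => ht x y j ⟨hi, hj, hJ⟩⟩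

lemma ex3 {x0 : ℂ} (hx : x0 ∈ V T) {Q : Set ℂ} (hQ : Q ∈ cor T x0) (h : Ex3 T x0 Q) :
    (∀ y ∈ V T, ∀ P ∈ cor T y, y ∈ ext P) ∧ ∃ Q' p, Fr T 5 x0 Q' p ∧ Rig T 5 x0 Q' ∧
      ∀ i < 5, Dt T 5 p i := by
  obtain ⟨hk, he, a, s1, s2, s3, s4, hR, hm, hm2, hm4⟩ := h
  have hns := hT.ns_of hx hQ he
  refine ⟨hns, ?_⟩
  set Q' := sq T x0 Q a with hQ'd
  have hQ' : Q' ∈ cor T x0 := hT.sq_mem hx hQ a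
  have cv : ∀ i, sq T x0 Q (a + i) = sq T x0 Q' i := fun i => by rw [add_comm, sq_add]
  have hper := hT.sq_per hx hQ'
  obtain ⟨p, F⟩ := hT.frame hx hQ'
  rw [hk] at F hper
  simp only [cv] at s1 s2 s3 s4 hm2 hm4
  have e0 : Q' = sq T x0 Q' 0 := rfl
  change (ext Q').ncard = 3 at hm
  change peq Q' _ _ _ at s1 s3
  change ¬ peq Q' _ _ _ at s2 s4
  rw [e0] at hm s1 s2 s3 s4
  clear_value Q'
  have hm' : ∀ i < 5, i ≠ 2 → i ≠ 4 → (ext (sq T x0 Q' i)).ncard = 3 := by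
    intro i hi h2 h4
    have : i = 0 ∨ i = 1 ∨ i = 3 := by omega
    rcases this with rfl | rfl | rfl
    exacts [hm, s1.cong.ncard ▸ hm, s3.cong.ncard ▸ hm]
  refine ⟨Q', p, F, ?_, ?_⟩
  · intro d hd h
    by_contra hd0
    have : d = 1 ∨ d = 2 ∨ d = 3 ∨ d = 4 := by omega
    rcases this with rfl | rfl | rfl | rfl
    · exact s2 (s1.trans (h 1))
    · exact s2 (h 0)
    · exact s4 (s1.trans (h 1))
    · exact s4 (h 0)
  · have := F3comb (fun i j => i < 5 ∧ j < 5 ∧ ∃ x y, J T p x i y j) ?_ ?_ ?_ ?_ ?_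
    · intro i hi
      obtain ⟨t, ht⟩ := this i hi
      exact ⟨t, fun x y j hj hJ => ht j ⟨hi, hj, x, y, hJ⟩⟩
    · rintro i j ⟨h1, h2, -⟩; exact ⟨h1, h2⟩
    · rintro i j ⟨h1, h2, x, y, h3⟩
      have hn := F.Jnc hT h3
      have m4 : ∀ i, i = 2 ∨ i = 4 → (ext (sq T x0 Q' i)).ncard = 4 := by
        rintro i (rfl | rfl)
        exacts [hm2, hm4]
      constructor
      · intro hi
        rw [m4 i hi] at hn
        by_contra hj
        rw [hm' j h2 (by omega) (by omega)] at hn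
        omega
      · intro hi
        rw [m4 j hi] at hn
        by_contra hj
        rw [hm' i h1 (by omega) (by omega)] at hn
        omega
    · rintro i j ⟨h1, h2, x, y, h3⟩
      exact ⟨Nat.mod_lt _ (by omega), Nat.mod_lt _ (by omega), y, x, F.Jinv_all hT hns h3⟩
    · rintro i j ⟨h1, h2, x, y, h3⟩ hi2 hi4
      have hy := F.Jv hT h3
      obtain ⟨z, l, hl, h4⟩ := F.Jex hT hy (hns y hy _ (F.mem y hy j))
      exact ⟨l, ⟨h2, hl, y, z, h4⟩, hl, h1, z, x, F.Jtri' hT h3 h4 (hm' i h1 hi2 hi4)⟩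
    · rintro j ⟨h1, h2, x, y, h3⟩
      have hy := F.Jv hT h3
      obtain ⟨z, l, hl, h4⟩ := F.Jex hT hy (hns y hy _ (F.mem y hy j))
      have hz := F.Jv hT h4
      obtain ⟨w, m, hmm, h5⟩ := F.Jex hT hz (hns z hz _ (F.mem z hz l))
      exact ⟨l, m, ⟨h2, hl, y, z, h4⟩, ⟨hl, hmm, z, w, h5⟩, hmm, h1, w, x, F.Jsqu' hT h3 h4 h5 hm4⟩

lemma ex4 {x0 : ℂ} (hx : x0 ∈ V T) {Q : Set ℂ} (hQ : Q ∈ cor T x0) (h : Ex4 T x0 Q) :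
    (∀ y ∈ V T, ∀ P ∈ cor T y, y ∈ ext P) ∧ ∃ Q' p, Fr T 6 x0 Q' p ∧ Rig T 6 x0 Q' ∧
      ∀ i < 6, Dt T 6 p i := by
  obtain ⟨hk, he, s02, s13, s45, n01, n04, n14, hR, hm, hC⟩ := h
  have hns := hT.ns_of hx hQ he
  refine ⟨hns, ?_⟩
  obtain ⟨p, F⟩ := hT.frame hx hQ
  rw [hk] at F hm hC
  simp only at s02 s13 s45 n01 n04 n14 hR hm hC
  refine ⟨Q, p, F, ?_, ?_⟩
  · intro d hd h
    by_contra hd0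
    have : d = 1 ∨ d = 2 ∨ d = 3 ∨ d = 4 ∨ d = 5 := by omega
    rcases this with rfl | rfl | rfl | rfl | rfl
    · exact n01 (h 0)
    · exact n04 (s02.trans (h 2))
    · exact n01 ((h 0).trans s13.symm)
    · exact n04 (h 0)
    · exact n04 ((h 0).trans s45.symm)
  · let c : ℕ → ℕ := fun i => if i = 0 ∨ i = 2 then 0 else if i = 1 ∨ i = 3 then 1 else 2
    let r : ℕ → ℕ := fun n => if n = 0 then 0 else if n = 1 then 1 else 4
    have hr : ∀ i < 6, peq (sq T x0 Q (r (c i))) x0 (sq T x0 Q i) x0 := by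
      intro i hi
      have : i = 0 ∨ i = 1 ∨ i = 2 ∨ i = 3 ∨ i = 4 ∨ i = 5 := by omega
      rcases this with rfl | rfl | rfl | rfl | rfl | rfl
      exacts [peq.refl _ _, peq.refl _ _, s02, s13, peq.refl _ _, s45]
    have c3 : ∀ i, c i = 0 ∨ c i = 1 ∨ c i = 2 := by
      intro i; simp only [c]; split_ifs <;> simp
    have cS : ∀ i < 6, ∀ j < 6, (peq (sq T x0 Q i) x0 (sq T x0 Q j) x0 ↔ c i = c j) := by
      intro i hi j hj
      constructor
      · intro h
        have hh := ((hr i hi).trans h).trans (hr j hj).symm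
        have hh' := hh.symm
        by_contra hne
        rcases c3 i with e | e | e <;> rcases c3 j with e' | e' | e' <;> rw [e, e'] at hh hh' hne <;>
          first | exact hne rfl | exact n01 hh | exact n01 hh' | exact n04 hh | exact n04 hh' |
            exact n14 hh | exact n14 hh'
      · intro h
        have := (hr i hi).symm
        rw [h] at this
        exact this.trans (hr j hj)
    have := F4comb (fun i j => i < 6 ∧ j < 6 ∧ ∃ x y, J T p x i y j) c rfl rfl rfl rfl rfl rfl ?_ ?_ ?_ ?_ ?_ ?_
    · intro i hi
      obtain ⟨t, ht⟩ := this i hi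
      exact ⟨t, fun x y j hj hJ => ht j ⟨hi, hj, x, y, hJ⟩⟩
    · rintro i j ⟨h1, h2, -⟩; exact ⟨h1, h2⟩
    · intro i hi
      obtain ⟨y, j, hj, h⟩ := F.Jex hT hx (hns x0 hx _ (F.mem x0 hx i))
      exact ⟨j, hi, hj, x0, y, h⟩
    · rintro i j i' j' ⟨h1, h2, x, y, h3⟩ ⟨h1', h2', x', y', h3'⟩ h
      exact (cS _ h2 _ h2').1 (F.Jcl hT h3 h3' ((cS _ h1 _ h1').2 h))
    · rintro i j ⟨h1, h2, x, y, h3⟩ h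
      exact F.Jne hT h3 (fun hh => hR ((hC i h1).Rg.2 hh)) ((cS _ h1 _ h2).2 h)
    · rintro i j ⟨h1, h2, x, y, h3⟩
      exact ⟨Nat.mod_lt _ (by omega), Nat.mod_lt _ (by omega), y, x, F.Jinv_all hT hns h3⟩
    · rintro i j ⟨h1, h2, x, y, h3⟩
      have hy := F.Jv hT h3
      obtain ⟨z, l, hl, h4⟩ := F.Jex hT hy (hns y hy _ (F.mem y hy j))
      exact ⟨l, ⟨h2, hl, y, z, h4⟩, hl, h1, z, x, F.Jtri' hT h3 h4 (hm i h1)⟩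

end Til
end MC

namespace MC
open MeasureTheory
open scoped Pointwise

lemma El_full' {T : Set (Set ℂ)} (hT : Til T) {x x' : ℂ} {P P' : Set ℂ} (h : El T x x' P P')
    (hx : x ∈ ext P') : nx P' x' = x := by
  obtain ⟨h1, h2, h3, h4, h5, h6, h8, ⟨c, hc, hc'⟩⟩ := h
  have pP := hT.poly P' h5.2.1.1
  have hpv := pP.nx_spec (hT.vnotint h2 h5.2.1.1)
  rcases hc.eq_or_lt with rfl | hlt
  · rw [one_smul] at hc'; exact sub_left_injective hc'
  · have := Poly.ext_not_seg hx (extremePoints_subset hpv.1) h5.2.1.2 (t := c - 1) (by linarith) (by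
      have e : nx P' x' = x' + c • (x - x') := by rw [← hc']; ring
      rw [e]; module)
    exact this.1

namespace Til
variable {T : Set (Set ℂ)} (hT : Til T)
include hT

lemma ex1 {x0 : ℂ} (hx0 : x0 ∈ V T) {Q : Set ℂ} (hQ : Q ∈ cor T x0) (h : Ex1 T x0 Q) :
    ∃ p, Fr T (cor T x0).ncard x0 Q p ∧ Rig T (cor T x0).ncard x0 Q ∧
      ∀ x x' P P', El T x x' P P' → peq P x' Q x0 → peq P' x' Q x0 → x ∈ ext P ∧ x' ∈ ext P ∧
        ∀ i < (cor T x0).ncard, p x i = P → Dt T (cor T x0).ncard p i := by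
  obtain ⟨hk, s1, s2, hR, hm, he, hn⟩ := h
  obtain ⟨p, F⟩ := hT.frame hx0 hQ
  generalize (cor T x0).ncard = k at *
  simp only at s1 s2 hR hm he hn
  have hS : ∀ i ≤ 2, peq (sq T x0 Q 0) x0 (sq T x0 Q i) x0 := by
    intro i hi
    have : i = 0 ∨ i = 1 ∨ i = 2 := by omega
    rcases this with rfl | rfl | rfl
    exacts [peq.refl _ _, s1, s2]
  have hS' : ∀ i < k, peq (sq T x0 Q 0) x0 (sq T x0 Q i) x0 → i ≤ 2 := by
    intro i hi h
    by_contra hc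
    exact hn i (by omega) hi h
  have he' : ∀ x ∈ V T, ∀ i ≤ 2, x ∈ ext (p x i) := fun x hx i hi =>
    (F.pq x hx i).ext.1 ((hS i hi).ext.1 he)
  have hR' : ∀ i ≤ 2, Rg (sq T x0 Q i) := fun i hi => (hS i hi).cong.Rg.1 hR
  have hm' : ∀ i ≤ 2, (ext (sq T x0 Q i)).ncard = 3 := fun i hi => (hS i hi).cong.ncard ▸ hm
  have hcl : ∀ x i y j, i ≤ 2 → j < k → J T p x i y j → j ≤ 2 := by
    intro x i y j hi hj hJ
    exact hS' j hj ((hS i hi).trans (F.JS' hT hJ (hR' i hi)))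
  have hcl' : ∀ x i y j, j ≤ 2 → i < k → J T p x i y j → i ≤ 2 := by
    intro x i y j hi hj hJ
    have := (F.Jrg hT hJ).2 (hR' j hi)
    exact hS' i hj ((hS j hi).trans (F.JS' hT hJ this).symm)
  have hfull : ∀ x ∈ V T, ∀ i ≤ 1, pv (p x i) x = nx (p x (i + 1)) x := by
    intro x hx i hi
    refine hT.full_reg (F.Sc hT hx i) (he' x hx i (by omega)) ((F.pq x hx i).cong.Rg.1 (hR' i (by omega))) ?_
    exact F.of_S hx hx ((hS i (by omega)).symm.trans (hS (i + 1) (by omega)))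
  have inv : ∀ x i y j, i ≤ 1 → J T p x (i + 1) y j → J T p y (j + 1) x i := fun x i y j hi h =>
    F.Jinv hT h (he' x h.1 i (by omega)) (hfull x h.1 i hi)
  have t12 : ∀ x i y j, i ≤ 1 → j < k → J T p x (i + 1) y j → j ≤ 1 := by
    intro x i y j hi hj h
    have a := hcl _ _ _ _ (by omega) hj h
    have := hcl' _ _ _ _ (by omega) (by omega) (inv _ _ _ _ hi h)
    omega
  have t0 : ∀ x y j, j < k → J T p x 0 y j → j = 2 := by
    intro x y j hj h
    have a := hcl _ _ _ _ (by omega) hj h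
    by_contra hc
    have hy := F.Jv hT h
    obtain ⟨l, hl, h1, h2⟩ := F.Jinv' hT h (he' y hy (j + 1) (by omega)) (hfull y hy j (by omega))
    have b := hcl _ _ _ _ (by omega) hl h1
    rw [Nat.mod_eq_of_lt (by omega : l + 1 < k)] at h2
    simp at h2
  have t2 : ∀ x y j, j < k → J T p x 2 y j → j = 1 := by
    intro x y j hj h
    have a := t12 x 1 y j (by omega) hj h
    by_contra hc
    obtain rfl : j = 0 := by omega
    have hy := F.Jv hT h
    obtain ⟨z, l, hl, h'⟩ := F.Jex hT hy (he' y hy 0 (by omega))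
    obtain rfl := t0 _ _ _ hl h'
    have := F.Jtri' hT h h' (hm' 2 (by omega))
    have := t12 _ 1 _ _ (by omega) (by omega) this
    omega
  have t1 : ∀ x y j, j < k → J T p x 1 y j → j = 0 := by
    intro x y j hj h
    have a := t12 x 0 y j (by omega) hj h
    by_contra hc
    obtain rfl : j = 1 := by omega
    have := t2 _ _ _ (by omega) (inv x 0 y 1 (by omega) h)
    omega
  refine ⟨p, F, ?_, ?_⟩
  · intro d hd h
    have a := hS' d hd (by simpa using h 0)
    by_contra hd0
    have : d = 1 ∨ d = 2 := by omega
    rcases this with rfl | rfl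
    · exact hn 3 (by omega) (by omega) (s2.trans (h 2))
    · exact hn 3 (by omega) (by omega) (s1.trans (h 1))
  · intro x x' P P' hE hP hP'
    have hx := hE.1
    have hx' := hE.2.1
    have hsc := hE.2.2.2.2.1
    obtain ⟨j, hj, rfl⟩ := F.ex x' hx' P hsc.1
    have hP'e : p x' (j + 1) = P' := by
      rw [← F.succ x' hx']; exact hT.sc_eq hx' hsc
    subst hP'e
    have a1 : peq (sq T x0 Q 0) x0 (sq T x0 Q j) x0 := hP.symm.trans (F.pq x' hx' j).symm
    have a2 : peq (sq T x0 Q 0) x0 (sq T x0 Q (j + 1)) x0 := hP'.symm.trans (F.pq x' hx' _).symm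
    have b1 := hS' _ hj a1
    have b2 := hS' _ (by omega) a2
    have hf := hfull x' hx' j (by omega)
    have ex' := he' x' hx' j b1
    have hpl := F.poly hT hx' j
    have hxe : pv (p x' j) x' = x := by
      rcases hT.one_straight hx hE.2.2.2.1.2.1 hE.2.2.2.1.1 (by
        intro h
        have := F.inj x' hx' j hj (j + 1) (by omega) h
        omega) with h | h
      · exact El_full hT hE h
      · rw [hf]; exact El_full' hT hE h
    have exx : x ∈ ext (p x' j) := by
      rw [← hxe]; exact hpl.pv_ext ex'
    refine ⟨exx, ex', ?_⟩
    intro i hi hiP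
    have hJ : J T p x i x' j := by
      refine ⟨hx, hiP ▸ exx, ?_, hiP.symm⟩
      rw [hiP, ← hxe]; exact hpl.nx_pv ex'
    have c1 := hcl' _ _ _ _ b1 hi hJ
    have : i = 0 ∨ i = 1 ∨ i = 2 := by omega
    rcases this with rfl | rfl | rfl
    · have := t0 _ _ _ hj hJ; omega
    · exact ⟨0, t1⟩
    · exact ⟨1, t2⟩

/-- determination along one elementary edge -/
lemma det {x y : ℂ} {g : Mot} (hy : y ∈ V T) (hg : g • x = y) (hgc : g • cor T x = cor T y)
    {x' : ℂ} {P P' : Set ℂ} (hE : El T x x' P P') :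
    g • x' ∈ V T ∧ g • cor T x' = cor T (g • x') := by
  have hx := hE.1
  have hx' := hE.2.1
  have hPc := hE.2.2.2.1.2.1
  have hPc' := hE.2.2.2.1.1
  have hsc := hE.2.2.2.2.1
  have gP := (mem_cor_mot hgc).2 hPc
  have gP' := (mem_cor_mot hgc).2 hPc'
  have hgx' : g • x' ∈ V T := by
    rcases hE.2.2.2.2.2.1 with h | h
    · exact ⟨g • P, gP.1, (mem_ext_mot _ _ _).2 h⟩
    · exact ⟨g • P', gP'.1, (mem_ext_mot _ _ _).2 h⟩
  refine ⟨hgx', ?_⟩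
  obtain ⟨h, hh, hhc⟩ := hT.mono x' hx' _ hgx'
  by_contra hcon
  have hr : (h⁻¹ * g) • x' = x' := by rw [mul_smul, inv_smul_eq_iff, hh]
  have m1 : ∀ R, g • R ∈ T → R ∈ cor T x' → (h⁻¹ * g) • R ∈ cor T x' := by
    intro R h1 h2
    rw [← mem_cor_mot hhc, mul_smul, smul_inv_smul]
    exact ⟨h1, smul_mem_smul_set h2.2⟩
  have hse := hT.sc_eq hx' hsc
  obtain ⟨Q, hQ, q1, q2, hEx⟩ := hT.bad hx' hsc.1 hr (m1 _ gP.1 hsc.1) (by rw [hse]; exact m1 _ gP'.1 hsc.2.1) (by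
    intro e
    apply hcon
    rw [mul_smul, inv_smul_eq_iff] at e
    rw [e, hhc])
  rw [hse] at q2
  have key : ∃ k Q' p, Fr T k x' Q' p ∧ Rig T k x' Q' ∧ x ∈ ext P ∧ x' ∈ ext P ∧
      ∀ i < k, p x i = P → Dt T k p i := by
    rcases hEx with e | e | e | e
    · obtain ⟨p, F, R, D⟩ := hT.ex1 hx' hQ e
      obtain ⟨-, s1, -⟩ := e
      have s1' : peq Q x' (sc T x' Q) x' := s1
      obtain ⟨d1, d2, d3⟩ := D x x' P P' hE q1 (q2.trans s1'.symm)
      exact ⟨_, Q, p, F, R, d1, d2, d3⟩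
    · obtain ⟨hns, Q', p, F, R, D⟩ := hT.ex2 hx' hQ e
      exact ⟨_, Q', p, F, R, hns x hx P hPc, hns x' hx' P hsc.1, fun i hi _ => D i hi⟩
    · obtain ⟨hns, Q', p, F, R, D⟩ := hT.ex3 hx' hQ e
      exact ⟨_, Q', p, F, R, hns x hx P hPc, hns x' hx' P hsc.1, fun i hi _ => D i hi⟩
    · obtain ⟨hns, Q', p, F, R, D⟩ := hT.ex4 hx' hQ e
      exact ⟨_, Q', p, F, R, hns x hx P hPc, hns x' hx' P hsc.1, fun i hi _ => D i hi⟩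
  obtain ⟨k, Q', p, F, R, e1, e2, D⟩ := key
  have hpl := hT.poly P hPc.1
  have hnx : nx P x = x' := by
    rw [← El_full hT hE e1]; exact hpl.nx_pv e2
  obtain ⟨i, hi, hiP⟩ := F.ex x hx P hPc
  obtain ⟨t, ht⟩ := D i hi hiP
  obtain ⟨z, j, hj, hJ⟩ := F.Jex hT hx (i := i) (hiP ▸ e1)
  obtain rfl : x' = z := by rw [← hnx, ← hiP]; exact hJ.2.2.1
  obtain rfl := ht _ _ _ hj hJ
  have hgi := F.rigid hT R hx hy hg hgc i
  rw [hiP] at hgi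
  obtain ⟨z, j', hj', hJ'⟩ := F.Jex hT hy (i := i) (by
    rw [← hgi, ← hg, mem_ext_mot]; exact e1)
  have hz : z = g • x' := by
    rw [← hJ'.2.2.1, ← hgi, ← hg, hpl.nx_mot g hPc.2 (hT.vnotint hx hPc.1), hnx]
  subst hz
  obtain rfl := ht _ _ _ hj' hJ'
  have hhi := F.rigid hT R hx' hgx' hh hhc j'
  rw [hJ.2.2.2, hJ'.2.2.2, hiP, ← hgi] at hhi
  have one := mot_one_of_fix hpl hsc.1.2 (hT.vnotint hx' hPc.1) hr (by
    rw [mul_smul, ← hhi, inv_smul_smul])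
  apply hcon
  rw [inv_mul_eq_one] at one
  rw [← one, hhc, hh]

lemma good_all {x y : ℂ} {g : Mot} (hx : x ∈ V T) (hy : y ∈ V T) (hg : g • x = y)
    (hgc : g • cor T x = cor T y) : ∀ P ∈ T, g • P ∈ T := by
  have := hT.conn (A := {z | z ∈ V T ∧ g • z ∈ V T ∧ g • cor T z = cor T (g • z)}) (fun z hz => hz.1)
    ⟨x, hx, hg ▸ hy, by rw [hgc, hg]⟩ (by
      rintro z z' P P' hE ⟨h1, h2, h3⟩
      exact ⟨hE.2.1, hT.det h2 rfl h3 hE⟩)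
  intro P hP
  obtain ⟨z, hz⟩ := (hT.poly P hP).ext_nonempty
  obtain ⟨h1, h2, h3⟩ := this ⟨P, hP, hz⟩
  exact ((mem_cor_mot h3).2 ⟨hP, extremePoints_subset hz⟩).1

theorem transitive {x y : ℂ} (hx : x ∈ V T) (hy : y ∈ V T) : ∃ g : Mot, g • x = y ∧ g • T = T := by
  obtain ⟨g, hg, hgc⟩ := hT.mono x hx y hy
  refine ⟨g, hg, ?_⟩
  have h1 := hT.good_all hx hy hg hgc
  have h2 := hT.good_all hy hx (g := g⁻¹) (by rw [← hg, inv_smul_smul]) (by rw [← hgc, inv_smul_smul])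
  ext P
  constructor
  · rintro ⟨Q, hQ, rfl⟩; exact h1 Q hQ
  · intro hP
    exact ⟨g⁻¹ • P, h2 P hP, smul_inv_smul _ _⟩

end Til
end MC

namespace MC
open scoped Pointwise

/-- the identification of `ℂ` with the Euclidean plane -/
def phi : ℂ ≃ₗᵢ[ℝ] E2 := Complex.orthonormalBasisOneI.repr

lemma phi_poly {P : Set ℂ} (h : IsConvexPolygon (phi '' P)) : Poly P := by
  obtain ⟨h1, h2, h3, h4⟩ := h
  have e : phi.symm '' (phi '' P) = P := by
    rw [← image_comp]; simp
  refine ⟨?_, ?_, ?_, ?_⟩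
  · rw [← e]; exact h1.image phi.symm.continuous
  · rw [← e]
    exact h2.linear_image phi.symm.toLinearEquiv.toLinearMap
  · have : phi '' interior P = interior (phi '' P) := phi.toHomeomorph.image_interior P
    rw [← this] at h3
    exact h3.of_image
  · have := image_extremePoints (𝕜 := ℝ) phi P
    rw [← this] at h4
    exact h4.of_finite_image phi.injective.injOn

/-- a direct isometry of the plane is a motion of `ℂ` -/
lemma exists_mot (f : E2 ≃ᵃⁱ[ℝ] E2) (hf : OrientationPreserving f) :
    ∃ g : Mot, ∀ z : ℂ, phi (g • z) = f (phi z) := by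
  let L : ℂ ≃ₗᵢ[ℝ] ℂ := (phi.trans f.linearIsometryEquiv).trans phi.symm
  have hdet : LinearMap.det (L.toLinearEquiv : ℂ →ₗ[ℝ] ℂ) = 1 := by
    have := LinearMap.det_conj (f.linearIsometryEquiv.toLinearEquiv : E2 →ₗ[ℝ] E2) phi.symm.toLinearEquiv
    rw [hf] at this
    rw [← this]
    rfl
  obtain ⟨a, ha⟩ := linear_isometry_complex L
  have hL : L = rotation a := by
    rcases ha with ha | ha
    · exact ha
    · exfalso
      rw [ha] at hdet
      have e : (((Complex.conjLIE.trans (rotation a)).toLinearEquiv : ℂ ≃ₗ[ℝ] ℂ) : ℂ →ₗ[ℝ] ℂ) =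
        ((rotation a).toLinearEquiv : ℂ →ₗ[ℝ] ℂ) ∘ₗ (Complex.conjLIE.toLinearEquiv : ℂ →ₗ[ℝ] ℂ) := rfl
      rw [e, LinearMap.det_comp, det_rotation, Complex.det_conjLIE] at hdet
      norm_num at hdet
  refine ⟨mkMot (a : ℂ) (phi.symm (f 0)) a.norm_coe, fun z => ?_⟩
  rw [mkMot_smul]
  have h1 : L z = a * z := by rw [hL]; rfl
  have h2 : phi (L z) = f.linearIsometryEquiv (phi z) := by
    change phi (phi.symm _) = _
    rw [LinearIsometryEquiv.apply_symm_apply]; rfl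
  rw [← h1, map_add, h2, LinearIsometryEquiv.apply_symm_apply]
  have := f.map_vadd 0 (phi z)
  simp only [vadd_eq_add, add_zero] at this
  exact this.symm

/-- a motion of `ℂ` is an isometry of the plane -/
lemma exists_iso (g : Mot) : ∃ f : E2 ≃ᵃⁱ[ℝ] E2, ∀ z : ℂ, f (phi z) = phi (g • z) := by
  let a : Circle := ⟨rot g, by simp [Submonoid.unitSphere, rot_norm]⟩
  refine ⟨((phi.symm.trans (rotation a)).toAffineIsometryEquiv.trans
    (AffineIsometryEquiv.constVAdd ℝ ℂ (g • (0 : ℂ)))).trans phi.toAffineIsometryEquiv, fun z => ?_⟩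
  rw [smul_def' g z]
  have h : rotation a z = rot g * z := rfl
  rw [← h]
  simp [add_comm]

theorem transfer (T : Set (Set E2)) (hT : IsTiling T) (hmc : MonocoronalRM T) :
    ∀ x y : E2, IsVertex T x → IsVertex T y → ∃ f : E2 ≃ᵃⁱ[ℝ] E2, IsSymmetry T f ∧ f x = y := by
  let T' : Set (Set ℂ) := {P | phi '' P ∈ T}
  have hb : ∀ P : Set E2, phi '' (phi.symm '' P) = P := fun P => by rw [← image_comp]; simp
  have hb' : ∀ P : Set ℂ, phi.symm '' (phi '' P) = P := fun P => by rw [← image_comp]; simp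
  have hinj : Function.Injective (fun P : Set ℂ => phi '' P) := image_injective.2 phi.injective
  have hv : ∀ x : ℂ, x ∈ V T' ↔ IsVertex T (phi x) := by
    intro x
    constructor
    · rintro ⟨P, hP, hx⟩
      refine ⟨phi '' P, hP, ?_⟩
      rw [← image_extremePoints (𝕜 := ℝ) phi P]
      exact mem_image_of_mem _ hx
    · rintro ⟨P, hP, hx⟩
      refine ⟨phi.symm '' P, ?_, ?_⟩
      · change phi '' _ ∈ T
        rwa [hb]
      · rw [← hb P, ← image_extremePoints (𝕜 := ℝ) phi] at hx
        obtain ⟨z, hz, e⟩ := hx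
        rw [← phi.injective e]; exact hz
  have hcor : ∀ x : ℂ, (fun P : Set ℂ => phi '' P) '' cor T' x = {P | P ∈ T ∧ phi x ∈ P} := by
    intro x
    ext P
    constructor
    · rintro ⟨Q, hQ, rfl⟩; exact ⟨hQ.1, mem_image_of_mem _ hQ.2⟩
    · rintro ⟨h1, h2⟩
      refine ⟨phi.symm '' P, ⟨?_, ?_⟩, hb P⟩
      · change phi '' _ ∈ T
        rwa [hb]
      · exact ⟨phi x, h2, by simp⟩
  have himg : ∀ (g : Mot) (f : E2 ≃ᵃⁱ[ℝ] E2), (∀ z : ℂ, phi (g • z) = f (phi z)) →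
      ∀ P : Set ℂ, phi '' (g • P) = f '' (phi '' P) := by
    intro g f h P
    rw [← image_smul, image_image, image_image]
    exact image_congr fun z _ => h z
  have H : Til T' := by
    refine ⟨fun P hP => phi_poly (hT.2.1 _ hP), ?_, ?_, ?_⟩
    · intro z
      have : phi z ∈ ⋃₀ T := by rw [hT.2.2.1]; trivial
      obtain ⟨P, hP, hz⟩ := this
      refine ⟨phi.symm '' P, ?_, ⟨phi z, hz, by simp⟩⟩
      change phi '' _ ∈ T
      rwa [hb]
    · intro P hP Q hQ hne
      have := hT.2.2.2 hP hQ (fun h => hne (hinj h))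
      have e : ∀ P : Set ℂ, interior (phi '' P) = phi '' interior P := fun P =>
        (phi.toHomeomorph.image_interior P).symm
      beta_reduce at this
      rw [e, e] at this
      exact disjoint_image_iff phi.injective |>.1 this
    · intro x hx y hy
      obtain ⟨f, hf, hxy, hc⟩ := hmc _ _ ((hv x).1 hx) ((hv y).1 hy)
      obtain ⟨g, hg⟩ := exists_mot f hf
      refine ⟨g, phi.injective (by rw [hg, hxy]), ?_⟩
      apply image_injective.2 hinj
      change (fun P : Set ℂ => phi '' P) '' (g • cor T' x) = (fun P : Set ℂ => phi '' P) '' cor T' y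
      rw [hcor, ← hc, ← hcor, ← image_smul, image_image, image_image]
      exact image_congr fun P _ => himg g f hg P
  intro x y hx hy
  have ex : phi (phi.symm x) = x := by simp
  have ey : phi (phi.symm y) = y := by simp
  obtain ⟨g, hgx, hgT⟩ := H.transitive ((hv (phi.symm x)).2 (ex.symm ▸ hx)) ((hv (phi.symm y)).2 (ey.symm ▸ hy))
  obtain ⟨f, hf⟩ := exists_iso g
  refine ⟨f, ?_, ?_⟩
  · have hTT : (fun P : Set ℂ => phi '' P) '' T' = T := by
      ext P
      constructor
      · rintro ⟨Q, hQ, rfl⟩; exact hQ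
      · intro hP
        refine ⟨phi.symm '' P, ?_, hb P⟩
        change phi '' _ ∈ T
        rwa [hb]
    unfold IsSymmetry
    conv_lhs => rw [← hTT]
    rw [← hTT]
    conv_rhs => rw [← hgT]
    rw [← image_smul, image_image, image_image]
    exact image_congr fun P _ => (himg g f (fun z => (hf z).symm) P).symm
  · rw [← ex, hf, hgx, ey]

end MC

/-- The symmetry group of a monocoronal (up to rigid motions) tiling of the plane
by convex polygons acts transitively on the vertices. -/
theorem monocoronalRM_vertexTransitive (T : Set (Set E2)) (hT : IsTiling T)
    (hmc : MonocoronalRM T) :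
    ∀ x y : E2, IsVertex T x → IsVertex T y →
      ∃ f : E2 ≃ᵃⁱ[ℝ] E2, IsSymmetry T f ∧ f x = y := by
  exact MC.transfer T hT hmc
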